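/- arXiv:0910.5490 — 3 statements merged into one kernel-verified Lean document; each statement's English description precedes it below -/
import Mathlib

section
/- There exists a function ε : (0,∞) → (0,∞) with the property that for every α ∈ (0, 1/6), ε(δ)/δ^{1/6−α} → 0 as δ → 0⁺, such that the following holds for every n ≥ 1 and every δ > 0: if X is an n×n complex matrix with ‖X‖ ≤ 1 and ‖[X*, X]‖ ≤ δ, then there exists an n×n matrix X′ which is normal (X′*X′ = X′X′*) with ‖X′‖ ≤ 1 and ‖X − X′‖ ≤ ε(δ). The function ε does not depend on the dimension n. -/
open Matrix

noncomputable section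

namespace AC

variable {m : Type*} [Fintype m] [DecidableEq m]

/-- The ℓ² operator norm of a complex matrix. -/
def opNorm (A : Matrix m m ℂ) : ℝ :=
  ‖Matrix.toEuclideanCLM (𝕜 := ℂ) A‖

/-- `(H₁, H₂, H₃)` is a δ-representation of the sphere: each `Hᵣ` is Hermitian, all
commutators have ℓ²-operator norm at most `δ`, and `‖H₁² + H₂² + H₃² − I‖ ≤ δ`. -/
def IsSphereRep (δ : ℝ) (H₁ H₂ H₃ : Matrix m m ℂ) : Prop :=
  H₁.IsHermitian ∧ H₂.IsHermitian ∧ H₃.IsHermitian ∧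
  opNorm (H₁ * H₂ - H₂ * H₁) ≤ δ ∧
  opNorm (H₁ * H₃ - H₃ * H₁) ≤ δ ∧
  opNorm (H₂ * H₃ - H₃ * H₂) ≤ δ ∧
  opNorm (H₁ ^ 2 + H₂ ^ 2 + H₃ ^ 2 - 1) ≤ δ

/-- The 2n×2n Hermitian block matrix `S(H₁,H₂,H₃) = [[H₃, H₁ − iH₂], [H₁ + iH₂, −H₃]]`. -/
def sphS (H₁ H₂ H₃ : Matrix m m ℂ) : Matrix (m ⊕ m) (m ⊕ m) ℂ :=
  Matrix.fromBlocks H₃ (H₁ - Complex.I • H₂) (H₁ + Complex.I • H₂) (-H₃)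

open Classical in
/-- The Bott index: the number of positive eigenvalues (with multiplicity) of
`S(H₁,H₂,H₃)` minus `n`.  (Junk value `0` if `S(H₁,H₂,H₃)` is not Hermitian.) -/
def bott (H₁ H₂ H₃ : Matrix m m ℂ) : ℤ :=
  if h : (sphS H₁ H₂ H₃).IsHermitian then
    ((Finset.univ.filter fun i => 0 < h.eigenvalues i).card : ℤ) - Fintype.card m
  else 0

end AC

namespace AlmostNormal

section Calculus

variable {A : Type*} [CStarAlgebra A]

theorem rcfc_id {T : A} (hT : IsSelfAdjoint T) : cfc (fun t : ℝ => t) T = T := cfc_id' ℝ T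

theorem ccfc_id {U : A} (hU : IsStarNormal U) : cfc (fun z : ℂ => z) U = U := cfc_id' ℂ U

variable [FiniteDimensional ℂ A]

theorem finite_spectrum (a : A) : (spectrum ℂ a).Finite := by
  have hp : minpoly ℂ a ≠ 0 := minpoly.ne_zero (Algebra.IsIntegral.isIntegral a)
  refine (Polynomial.finite_setOfPred_isRoot hp).subset fun x hx => ?_
  have h := spectrum.subset_polynomial_aeval a (minpoly ℂ a) ⟨x, hx, rfl⟩
  rw [minpoly.aeval] at h
  have : Nontrivial A := by
    by_contra hA
    rw [not_nontrivial_iff_subsingleton] at hA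
    simp [spectrum.of_subsingleton] at hx
  rw [spectrum.zero_eq] at h
  simpa using h

theorem finite_spectrum_real (a : A) : (spectrum ℝ a).Finite := by
  have : spectrum ℝ a = (fun x : ℝ => (x : ℂ)) ⁻¹' spectrum ℂ a :=
    (spectrum.preimage_algebraMap ℂ).symm
  rw [this]
  exact (finite_spectrum a).preimage Complex.ofReal_injective.injOn

theorem continuousOn_spectrum_real (f : ℝ → ℝ) (a : A) : ContinuousOn f (spectrum ℝ a) :=
  (finite_spectrum_real a).continuousOn f

theorem continuousOn_spectrum (f : ℂ → ℂ) (a : A) : ContinuousOn f (spectrum ℂ a) :=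
  (finite_spectrum a).continuousOn f

theorem rcfc_mul (f g : ℝ → ℝ) (a : A) : cfc f a * cfc g a = cfc (fun x => f x * g x) a :=
  (cfc_mul f g a (continuousOn_spectrum_real _ _) (continuousOn_spectrum_real _ _)).symm

theorem ccfc_mul (f g : ℂ → ℂ) (a : A) : cfc f a * cfc g a = cfc (fun x => f x * g x) a :=
  (cfc_mul f g a (continuousOn_spectrum _ _) (continuousOn_spectrum _ _)).symm

theorem rcfc_add (f g : ℝ → ℝ) (a : A) : cfc f a + cfc g a = cfc (fun x => f x + g x) a :=
  (cfc_add a f g (continuousOn_spectrum_real _ _) (continuousOn_spectrum_real _ _)).symm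

theorem ccfc_add (f g : ℂ → ℂ) (a : A) : cfc f a + cfc g a = cfc (fun x => f x + g x) a :=
  (cfc_add a f g (continuousOn_spectrum _ _) (continuousOn_spectrum _ _)).symm

theorem rcfc_sub (f g : ℝ → ℝ) (a : A) : cfc f a - cfc g a = cfc (fun x => f x - g x) a :=
  (cfc_sub f g a (continuousOn_spectrum_real _ _) (continuousOn_spectrum_real _ _)).symm

theorem ccfc_sub (f g : ℂ → ℂ) (a : A) : cfc f a - cfc g a = cfc (fun x => f x - g x) a :=
  (cfc_sub f g a (continuousOn_spectrum _ _) (continuousOn_spectrum _ _)).symm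

/-- Functional calculus acts on eigenvectors (elements of a right ideal) as expected. -/
theorem ccfc_mul_of_eigen (f : ℂ → ℂ) {U e : A} {z : ℂ} (hU : IsStarNormal U)
    (he : U * e = z • e) : cfc f U * e = f z • e := by
  classical
  set s : Finset ℂ := insert z (finite_spectrum U).toFinset with hs
  set p := Lagrange.interpolate s id f with hp
  have hev : ∀ x ∈ s, p.eval x = f x := fun x hx => by
    exact Lagrange.eval_interpolate_at_node (s := s) (v := id) f Function.injective_id.injOn hx
  have h1 : cfc f U = Polynomial.aeval U p := by
    rw [← cfc_polynomial p U]
    refine cfc_congr fun x hx => (hev x ?_).symm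
    simp [hs, hx]
  have h2 : ∀ q : Polynomial ℂ, Polynomial.aeval U q * e = q.eval z • e := by
    intro q
    induction q using Polynomial.induction_on' with
    | add p q hp hq => simp [add_mul, hp, hq, add_smul]
    | monomial n c =>
      have : ∀ n : ℕ, U ^ n * e = z ^ n • e := by
        intro n
        induction n with
        | zero => simp
        | succ n ih => rw [pow_succ, mul_assoc, he, mul_smul_comm, ih, smul_smul, pow_succ,
          mul_comm]
      simp [Polynomial.aeval_monomial, this, Algebra.algebraMap_eq_smul_one, smul_smul]
  rw [h1, h2, hev z (by simp [hs])]

theorem rcfc_mul_of_eigen (f : ℝ → ℝ) {T e : A} {r : ℝ} (hT : IsSelfAdjoint T)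
    (he : T * e = r • e) : cfc f T * e = f r • e := by
  rw [cfc_real_eq_complex f hT, ccfc_mul_of_eigen _ hT.isStarNormal (z := (r : ℂ))]
  · simp
  · simpa using he

end Calculus

section Order

variable {A : Type*} [CStarAlgebra A] [PartialOrder A] [StarOrderedRing A]

theorem norm_add_algebraMap_le {T : A} {M c : ℝ} (hMc : 0 ≤ c + M)
    (h1 : algebraMap ℝ A (-M) ≤ T) (h2 : T ≤ algebraMap ℝ A c) :
    ‖T + algebraMap ℝ A M‖ ≤ c + M := by
  have h0 : 0 ≤ T + algebraMap ℝ A M := by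
    rw [map_neg] at h1
    simpa using add_le_add_left h1 (algebraMap ℝ A M)
  rw [CStarAlgebra.norm_le_iff_le_algebraMap _ hMc h0, map_add]
  exact add_le_add_left h2 _

variable [FiniteDimensional ℂ A]

theorem le_norm_mul_of_algebraMap_le {K W : A} {r : ℝ} (hr : 0 < r) (hK : IsSelfAdjoint K)
    (h : algebraMap ℝ A r ≤ K) : r * ‖W‖ ≤ ‖W * K‖ := by
  have hs : ∀ x ∈ spectrum ℝ K, r ≤ x := (algebraMap_le_iff_le_spectrum (a := K)).1 h
  have h1 : K * cfc (fun x : ℝ => x⁻¹) K = 1 := by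
    conv_lhs => enter [1]; rw [← rcfc_id hK]
    rw [rcfc_mul, ← cfc_one ℝ K]
    exact cfc_congr fun x hx => mul_inv_cancel₀ (hr.trans_le (hs x hx)).ne'
  have h2 : ‖cfc (fun x : ℝ => x⁻¹) K‖ ≤ r⁻¹ := by
    refine norm_cfc_le (by positivity) fun x hx => ?_
    have := hs x hx
    rw [Real.norm_eq_abs, abs_inv, abs_of_pos (hr.trans_le this)]
    exact inv_anti₀ hr this
  have h3 : ‖W‖ ≤ ‖W * K‖ * r⁻¹ := by
    calc ‖W‖ = ‖W * K * cfc (fun x : ℝ => x⁻¹) K‖ := by rw [mul_assoc, h1, mul_one]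
      _ ≤ ‖W * K‖ * r⁻¹ := (norm_mul_le _ _).trans (by gcongr)
  rw [← div_eq_mul_inv, le_div_iff₀ hr] at h3
  linarith

/-- A quantitative Sylvester estimate: if `T₁ ≤ α < β ≤ T₂` then `W ↦ T₁ W - W T₂` is bounded
below by `β - α`. -/
theorem sylvester {T₁ T₂ W : A} {α β : ℝ} (hαβ : α < β) (h₁ : IsSelfAdjoint T₁)
    (h₂ : IsSelfAdjoint T₂) (hα : T₁ ≤ algebraMap ℝ A α) (hβ : algebraMap ℝ A β ≤ T₂) :
    (β - α) * ‖W‖ ≤ ‖T₁ * W - W * T₂‖ := by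
  set M : ℝ := ‖T₁‖ + |α| + |β| + 1
  have hM1 : 0 ≤ α + M := by
    have := neg_abs_le α; have := norm_nonneg T₁; have := abs_nonneg β; simp only [M]; linarith
  have hM2 : 0 < β + M := by
    have := neg_abs_le β; have := norm_nonneg T₁; have := abs_nonneg α; simp only [M]; linarith
  have hM3 : ‖T₁‖ ≤ M := by
    have := abs_nonneg β; have := abs_nonneg α; simp only [M]; linarith
  have e1 : ‖T₁ + algebraMap ℝ A M‖ ≤ α + M := by
    refine norm_add_algebraMap_le hM1 ?_ hα
    have := h₁.neg_algebraMap_norm_le_self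
    refine le_trans ?_ this
    rw [map_neg]
    exact neg_le_neg (algebraMap_mono A hM3)
  have e2 : (β + M) * ‖W‖ ≤ ‖W * (T₂ + algebraMap ℝ A M)‖ := by
    refine le_norm_mul_of_algebraMap_le hM2 (h₂.add (.algebraMap A (.all M))) ?_
    rw [map_add]; exact add_le_add_left hβ _
  have e3 : ‖(T₁ + algebraMap ℝ A M) * W‖ ≤ (α + M) * ‖W‖ :=
    (norm_mul_le _ _).trans (by gcongr)
  have e4 : T₁ * W - W * T₂ =
      (T₁ + algebraMap ℝ A M) * W - W * (T₂ + algebraMap ℝ A M) := by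
    rw [add_mul, mul_add, Algebra.commutes M W]; abel
  rw [e4]
  have := norm_sub_norm_le (W * (T₂ + algebraMap ℝ A M)) ((T₁ + algebraMap ℝ A M) * W)
  rw [norm_sub_rev] at this
  linarith

theorem sylvester' {T₁ T₂ W : A} {α β : ℝ} (hαβ : α < β) (h₁ : IsSelfAdjoint T₁)
    (h₂ : IsSelfAdjoint T₂) (hβ : algebraMap ℝ A β ≤ T₁) (hα : T₂ ≤ algebraMap ℝ A α) :
    (β - α) * ‖W‖ ≤ ‖T₁ * W - W * T₂‖ := by
  have := sylvester (W := W) (α := -β) (β := -α) (by linarith) h₁.neg h₂.neg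
    (by rw [map_neg]; exact neg_le_neg hβ) (by rw [map_neg]; exact neg_le_neg hα)
  rw [show T₁ * W - W * T₂ = -(-T₁ * W - W * -T₂) by noncomm_ring, norm_neg]
  rwa [show -α - -β = β - α by ring] at this

theorem rcfc_le_algebraMap (f : ℝ → ℝ) (T : A) {r : ℝ} (h : ∀ t ∈ spectrum ℝ T, f t ≤ r)
    (hT : IsSelfAdjoint T) : cfc f T ≤ algebraMap ℝ A r :=
  cfc_le_algebraMap f r T h (continuousOn_spectrum_real _ _) hT

theorem algebraMap_le_rcfc (f : ℝ → ℝ) (T : A) {r : ℝ} (h : ∀ t ∈ spectrum ℝ T, r ≤ f t)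
    (hT : IsSelfAdjoint T) : algebraMap ℝ A r ≤ cfc f T :=
  algebraMap_le_cfc f r T h (continuousOn_spectrum_real _ _) hT

theorem rcfc_mono (f g : ℝ → ℝ) (T : A) (h : ∀ t ∈ spectrum ℝ T, f t ≤ g t) :
    cfc f T ≤ cfc g T :=
  cfc_mono h (continuousOn_spectrum_real _ _) (continuousOn_spectrum_real _ _)

end Order

section OperatorLipschitz
open scoped FourierTransform

variable {A : Type*} [CStarAlgebra A] [FiniteDimensional ℂ A]

/-- The real parts of the spectrum, as a finite set. -/
def specRe (T : A) : Finset ℝ := (finite_spectrum T).toFinset.image Complex.re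

/-- The spectral projection of a self-adjoint `T` at `t`. -/
def specProj (T : A) (t : ℝ) : A := cfc (fun z : ℂ => if z.re = t then (1 : ℂ) else 0) T

theorem cfc_re_eq_sum (T : A) (c : ℝ → ℂ) :
    cfc (fun z : ℂ => c z.re) T = ∑ t ∈ specRe T, c t • specProj T t := by
  have h : ∀ t, c t • specProj T t = cfc (fun z : ℂ => c t * if z.re = t then (1 : ℂ) else 0) T :=
    fun t => (cfc_const_mul _ _ _ (continuousOn_spectrum _ _)).symm
  simp_rw [h]
  have h2 := (cfc_sum (s := specRe T)
    (fun (t : ℝ) (z : ℂ) => c t * if z.re = t then (1 : ℂ) else 0) T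
    (fun t _ => continuousOn_spectrum _ _)).symm
  rw [h2]
  refine cfc_congr fun z hz => ?_
  have : z.re ∈ specRe T := Finset.mem_image_of_mem _ (by simpa using hz)
  simp [this]

theorem norm_sum_specProj_le {T : A} {c : ℝ → ℂ} (hc : ∀ t, ‖c t‖ ≤ 1) :
    ‖∑ t ∈ specRe T, c t • specProj T t‖ ≤ 1 := by
  rw [← cfc_re_eq_sum]
  exact norm_cfc_le zero_le_one fun z _ => hc _

theorem norm_schur_le (φ : SchwartzMap ℝ ℂ) (T D : A) (r : ℝ) :
    ‖∑ l ∈ specRe T, ∑ m ∈ specRe T,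
      φ ((1 - r) * l + r * m) • (specProj T l * D * specProj T m)‖ ≤
      (∫ t, ‖𝓕 φ t‖) * ‖D‖ := by
  have hφi : MeasureTheory.Integrable (fun t => 𝓕 φ t) := (𝓕 φ).integrable
  set E : ℝ → A := fun t => ∑ l ∈ specRe T,
    Complex.exp ((2 * Real.pi * (t * l) : ℝ) * Complex.I) • specProj T l with hE
  have hE1 : ∀ t, ‖E t‖ ≤ 1 := fun t =>
    norm_sum_specProj_le fun l => (Complex.norm_exp_ofReal_mul_I _).le
  have hφ : ∀ x : ℝ, φ x =
      ∫ t : ℝ, Complex.exp ((2 * Real.pi * (t * x) : ℝ) * Complex.I) • 𝓕 φ t := by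
    intro x
    have h1 : 𝓕⁻ (𝓕 φ) = φ := FourierPair.fourierInv_fourier_eq φ
    have h2 : 𝓕⁻ (𝓕 φ) x = φ x := by rw [h1]
    rw [← h2, SchwartzMap.fourierInv_coe, Real.fourierInv_eq']
    simp [mul_comm]
  have hi : ∀ x : ℝ, MeasureTheory.Integrable
      (fun t : ℝ => Complex.exp ((2 * Real.pi * (t * x) : ℝ) * Complex.I) • 𝓕 φ t) := by
    intro x
    refine (MeasureTheory.integrable_norm_iff ?_).1 ?_
    · exact ((by fun_prop : Continuous fun t : ℝ =>
        Complex.exp ((2 * Real.pi * (t * x) : ℝ) * Complex.I)).smul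
          (𝓕 φ).continuous).aestronglyMeasurable
    · simp_rw [norm_smul, Complex.norm_exp_ofReal_mul_I, one_mul]
      exact hφi.norm
  have key : ∑ l ∈ specRe T, ∑ m ∈ specRe T,
      φ ((1 - r) * l + r * m) • (specProj T l * D * specProj T m) =
      ∫ t, 𝓕 φ t • (E ((1 - r) * t) * D * E (r * t)) := by
    have e1 : ∀ t, 𝓕 φ t • (E ((1 - r) * t) * D * E (r * t)) =
        ∑ l ∈ specRe T, ∑ m ∈ specRe T,
          (Complex.exp ((2 * Real.pi * (t * ((1 - r) * l + r * m)) : ℝ) * Complex.I) • 𝓕 φ t) •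
            (specProj T l * D * specProj T m) := by
      intro t
      simp only [hE, Finset.sum_mul, Finset.mul_sum, Finset.smul_sum, smul_mul_assoc,
        mul_smul_comm, smul_smul, smul_eq_mul]
      rw [Finset.sum_comm]
      refine Finset.sum_congr rfl fun l _ => Finset.sum_congr rfl fun m _ => ?_
      congr 1
      rw [show ((2 * Real.pi * (t * ((1 - r) * l + r * m)) : ℝ) : ℂ) * Complex.I =
        ((2 * Real.pi * ((1 - r) * t * l) : ℝ) : ℂ) * Complex.I +
        ((2 * Real.pi * (r * t * m) : ℝ) : ℂ) * Complex.I by push_cast; ring, Complex.exp_add]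
      ring
    simp_rw [e1]
    rw [MeasureTheory.integral_finsetSum]
    · refine Finset.sum_congr rfl fun l _ => ?_
      rw [MeasureTheory.integral_finsetSum]
      · refine Finset.sum_congr rfl fun m _ => ?_
        rw [integral_smul_const, hφ]
      · exact fun m _ => (hi _).smul_const _
    · exact fun l _ => MeasureTheory.integrable_finsetSum _ fun m _ => (hi _).smul_const _
  rw [key, ← MeasureTheory.integral_mul_const]
  refine MeasureTheory.norm_integral_le_of_norm_le (hφi.norm.mul_const _)
    (Filter.Eventually.of_forall fun t => ?_)
  rw [norm_smul]
  gcongr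
  calc ‖E ((1 - r) * t) * D * E (r * t)‖ ≤ ‖E ((1 - r) * t)‖ * ‖D‖ * ‖E (r * t)‖ := norm_mul₃_le
    _ ≤ 1 * ‖D‖ * 1 := by gcongr <;> exact hE1 _
    _ = ‖D‖ := by ring

/-- A function whose derivative is smooth and compactly supported is operator Lipschitz, with a
constant that does not depend on the algebra. -/
def OpLip (f : ℝ → ℝ) : Prop :=
  ContDiff ℝ (⊤ : ℕ∞) f ∧ HasCompactSupport (deriv f)

theorem OpLip.exists_schwartz {f : ℝ → ℝ} (hf : OpLip f) :
    ∃ φ : SchwartzMap ℝ ℂ, ∀ x, HasDerivAt (fun y : ℝ => (f y : ℂ)) (φ x) x := by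
  have h1 : ContDiff ℝ (⊤ : ℕ∞) (deriv f) := by
    have := hf.1
    rw [show ((⊤ : ℕ∞) : WithTop ℕ∞) = (⊤ : ℕ∞) + 1 from rfl, contDiff_succ_iff_deriv] at this
    exact this.2.2
  have h2 : ContDiff ℝ (⊤ : ℕ∞) (fun x => ((deriv f x : ℝ) : ℂ)) :=
    Complex.ofRealCLM.contDiff.comp h1
  have h3 : HasCompactSupport (fun x => ((deriv f x : ℝ) : ℂ)) :=
    hf.2.comp_left (g := fun x : ℝ => (x : ℂ)) (by simp)
  refine ⟨h3.toSchwartzMap h2, fun x => ?_⟩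
  have : HasDerivAt f (deriv f x) x := (hf.1.differentiable (by simp) x).hasDerivAt
  exact this.ofReal_comp

/-- The operator Lipschitz constant of `f`. -/
theorem OpLip.exists_const {f : ℝ → ℝ} (hf : OpLip f) :
    ∃ C : ℝ, 0 ≤ C ∧ ∀ (A : Type) [CStarAlgebra A] [FiniteDimensional ℂ A] (T s : A),
      IsSelfAdjoint T → ‖s * cfc f T - cfc f T * s‖ ≤ C * ‖s * T - T * s‖ := by
  obtain ⟨φ, hφ⟩ := hf.exists_schwartz
  refine ⟨∫ t, ‖𝓕 φ t‖, MeasureTheory.integral_nonneg fun _ => norm_nonneg _, ?_⟩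
  intro A _ _ T s hT
  set P := specProj T
  set σ := specRe T
  have hsum : ∀ g : ℝ → ℝ, cfc g T = ∑ t ∈ σ, (g t : ℂ) • P t := fun g => by
    rw [cfc_real_eq_complex g hT, cfc_re_eq_sum T (fun t => (g t : ℂ))]
  have hone : ∑ t ∈ σ, P t = 1 := by
    have := hsum (fun _ => 1)
    simp only [Complex.ofReal_one, one_smul] at this
    rw [← this, cfc_const_one ℝ T]
  have hPT : ∀ t, T * P t = (t : ℂ) • P t := by
    intro t
    have e : T = cfc (fun z : ℂ => z) T := (ccfc_id hT.isStarNormal).symm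
    have : cfc (fun z : ℂ => z) T * P t = (t : ℂ) • P t := by
      simp only [P, specProj]
      rw [ccfc_mul, ← cfc_const_mul _ _ _ (continuousOn_spectrum _ _)]
      refine cfc_congr fun z hz => ?_
      have hz' : z = z.re := hT.mem_spectrum_eq_re hz
      by_cases h : z.re = t
      · simp only [h, if_true, mul_one]; rw [hz', h]
      · simp [h]
    rwa [← e] at this
  have hTP : ∀ t, P t * T = (t : ℂ) • P t := by
    intro t
    rw [← hPT t]
    have : Commute (P t) T := Commute.cfc (Commute.refl T) (by rw [hT.star_eq]) _
    exact this.eq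
  set H : ℝ → A :=
    fun r => ∑ l ∈ σ, ∑ m ∈ σ, (f ((1 - r) * l + r * m) : ℂ) • (P l * s * P m) with hH
  have H0 : H 0 = cfc f T * s := by
    simp only [hH, sub_zero, one_mul, zero_mul, add_zero, ← Finset.smul_sum, ← Finset.mul_sum,
      hone, mul_one, hsum, Finset.sum_mul, smul_mul_assoc]
  have H1 : H 1 = s * cfc f T := by
    simp only [hH, sub_self, one_mul, zero_mul, zero_add]
    rw [Finset.sum_comm]
    simp only [← Finset.smul_sum, ← Finset.sum_mul, hone, one_mul, hsum, Finset.mul_sum,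
      mul_smul_comm]
  rw [← H0, ← H1]
  refine norm_image_sub_le_of_norm_deriv_le_segment_01'
    (f' := fun r => ∑ l ∈ σ, ∑ m ∈ σ, φ ((1 - r) * l + r * m) • (P l * (s * T - T * s) * P m)) ?_ ?_
  · intro r _
    refine HasDerivAt.hasDerivWithinAt ?_
    refine HasDerivAt.fun_sum fun l _ => HasDerivAt.fun_sum fun m _ => ?_
    have e : P l * (s * T - T * s) * P m = ((m - l : ℝ) : ℂ) • (P l * s * P m) := by
      rw [mul_sub, sub_mul, ← mul_assoc, mul_assoc _ T, hPT, ← mul_assoc (P l) T, hTP,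
        mul_smul_comm, smul_mul_assoc, smul_mul_assoc, ← sub_smul]
      push_cast; rfl
    rw [e, smul_smul]
    refine HasDerivAt.smul_const ?_ _
    have h1 : HasDerivAt (fun r : ℝ => (1 - r) * l + r * m) (m - l) r := by
      have h := (((hasDerivAt_id r).const_sub 1).mul_const l).add ((hasDerivAt_id r).mul_const m)
      rw [show m - l = -1 * l + 1 * m by ring]
      exact h
    have h2 := (hφ ((1 - r) * l + r * m)).scomp r h1
    rw [Complex.real_smul, mul_comm] at h2
    exact h2
  · intro r _
    exact norm_schur_le φ T _ r

end OperatorLipschitz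

section Cutoffs

theorem OpLip.of_const {f : ℝ → ℝ} (h : ContDiff ℝ (⊤ : ℕ∞) f) (a b c d : ℝ)
    (h1 : ∀ t ≤ a, f t = c) (h2 : ∀ t, b ≤ t → f t = d) : OpLip f := by
  refine ⟨h, HasCompactSupport.intro (isCompact_Icc (a := a) (b := b)) fun x hx => ?_⟩
  rw [Set.mem_Icc, not_and_or, not_le, not_le] at hx
  rcases hx with hx | hx
  · have : f =ᶠ[nhds x] fun _ => c := by
      filter_upwards [gt_mem_nhds hx] with t ht using h1 t ht.le
    rw [this.deriv_eq, deriv_const]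
  · have : f =ᶠ[nhds x] fun _ => d := by
      filter_upwards [lt_mem_nhds hx] with t ht using h2 t ht.le
    rw [this.deriv_eq, deriv_const]

/-- A smooth step from `-1` (for `t ≤ -1/4`) to `1` (for `t ≥ 1/4`). -/
def signStep (t : ℝ) : ℝ := 2 * Real.smoothTransition (2 * t + 1 / 2) - 1

/-- A smooth step from `0` (for `t ≤ -1/16`) to `1` (for `t ≥ 1/16`). -/
def unitStep (t : ℝ) : ℝ := Real.smoothTransition (8 * t + 1 / 2)

/-- A smooth bump, `1` on `[-1/2, 1/2]` and `0` outside `[-3/4, 3/4]`. -/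
def bump (t : ℝ) : ℝ := Real.smoothTransition (3 - 4 * t) * Real.smoothTransition (3 + 4 * t)

/-- A smooth cutoff, `1` for `t ≤ 1/16` and `0` for `t ≥ 1/8`. -/
def lowCut (t : ℝ) : ℝ := Real.smoothTransition (2 - 16 * t)

/-- A compactly supported smooth function equal to `t ^ (-1/4)` on `[1/16, 10]`. -/
def quarterInv (t : ℝ) : ℝ :=
  t ^ (-(1 / 4) : ℝ) * (Real.smoothTransition (32 * t - 1) * Real.smoothTransition (11 - t))

theorem contDiff_smoothTransition_comp (g : ℝ → ℝ) (hg : ContDiff ℝ (⊤ : ℕ∞) g) :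
    ContDiff ℝ (⊤ : ℕ∞) fun t => Real.smoothTransition (g t) :=
      Real.smoothTransition.contDiff.comp hg

theorem signStep_of_le {t : ℝ} (h : t ≤ -1 / 4) : signStep t = -1 := by
  rw [signStep, Real.smoothTransition.zero_of_nonpos (show 2 * t + 1 / 2 ≤ 0 by linarith)]
  norm_num

theorem signStep_of_ge {t : ℝ} (h : 1 / 4 ≤ t) : signStep t = 1 := by
  rw [signStep, Real.smoothTransition.one_of_one_le (show 1 ≤ 2 * t + 1 / 2 by linarith)]
  norm_num

theorem abs_signStep_le (t : ℝ) : |signStep t| ≤ 1 := by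
  have := Real.smoothTransition.nonneg (2 * t + 1 / 2)
  have := Real.smoothTransition.le_one (2 * t + 1 / 2)
  rw [abs_le, signStep]; constructor <;> linarith

theorem opLip_signStep : OpLip signStep := by
  refine .of_const ?_ (-1 / 4) (1 / 4) (-1) 1 (fun t => signStep_of_le) fun t => signStep_of_ge
  exact (contDiff_const.mul (contDiff_smoothTransition_comp _ (by fun_prop))).sub contDiff_const

theorem unitStep_of_le {t : ℝ} (h : t ≤ -1 / 16) : unitStep t = 0 :=
  Real.smoothTransition.zero_of_nonpos (by linarith)

theorem unitStep_of_ge {t : ℝ} (h : 1 / 16 ≤ t) : unitStep t = 1 :=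
  Real.smoothTransition.one_of_one_le (by linarith)

theorem unitStep_nonneg (t : ℝ) : 0 ≤ unitStep t := Real.smoothTransition.nonneg _

theorem unitStep_le_one (t : ℝ) : unitStep t ≤ 1 := Real.smoothTransition.le_one _

theorem opLip_unitStep : OpLip unitStep :=
  .of_const (contDiff_smoothTransition_comp _ (by fun_prop)) (-1 / 16) (1 / 16) 0 1
    (fun t => unitStep_of_le) fun t => unitStep_of_ge

theorem bump_nonneg (t : ℝ) : 0 ≤ bump t :=
  mul_nonneg (Real.smoothTransition.nonneg _) (Real.smoothTransition.nonneg _)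

theorem bump_le_one (t : ℝ) : bump t ≤ 1 :=
  mul_le_one₀ (Real.smoothTransition.le_one _) (Real.smoothTransition.nonneg _)
    (Real.smoothTransition.le_one _)

theorem bump_of_abs_le {t : ℝ} (h : |t| ≤ 1 / 2) : bump t = 1 := by
  rw [abs_le] at h
  rw [bump, Real.smoothTransition.one_of_one_le (by linarith),
    Real.smoothTransition.one_of_one_le (by linarith), mul_one]

theorem bump_of_ge {t : ℝ} (h : 3 / 4 ≤ t) : bump t = 0 := by
  rw [bump, Real.smoothTransition.zero_of_nonpos (by linarith), zero_mul]

theorem bump_of_le {t : ℝ} (h : t ≤ -3 / 4) : bump t = 0 := by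
  rw [bump, Real.smoothTransition.zero_of_nonpos (x := 3 + 4 * t) (by linarith), mul_zero]

theorem opLip_bump : OpLip bump :=
  .of_const ((contDiff_smoothTransition_comp _ (by fun_prop)).mul
    (contDiff_smoothTransition_comp _ (by fun_prop))) (-3 / 4) (3 / 4) 0 0
    (fun t => bump_of_le) fun t => bump_of_ge

theorem lowCut_nonneg (t : ℝ) : 0 ≤ lowCut t := Real.smoothTransition.nonneg _

theorem lowCut_le_one (t : ℝ) : lowCut t ≤ 1 := Real.smoothTransition.le_one _

theorem lowCut_of_le {t : ℝ} (h : t ≤ 1 / 16) : lowCut t = 1 :=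
  Real.smoothTransition.one_of_one_le (by linarith)

theorem lowCut_of_ge {t : ℝ} (h : 1 / 8 ≤ t) : lowCut t = 0 :=
  Real.smoothTransition.zero_of_nonpos (by linarith)

theorem opLip_lowCut : OpLip lowCut :=
  .of_const (contDiff_smoothTransition_comp _ (by fun_prop)) (1 / 16) (1 / 8) 1 0
    (fun t => lowCut_of_le) fun t => lowCut_of_ge

theorem quarterInv_of_le {t : ℝ} (h : t ≤ 1 / 32) : quarterInv t = 0 := by
  rw [quarterInv, Real.smoothTransition.zero_of_nonpos (x := 32 * t - 1) (by linarith)]; simp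

theorem quarterInv_of_ge {t : ℝ} (h : 11 ≤ t) : quarterInv t = 0 := by
  rw [quarterInv, Real.smoothTransition.zero_of_nonpos (x := 11 - t) (by linarith)]; simp

theorem quarterInv_sq {t : ℝ} (h1 : 1 / 16 ≤ t) (h2 : t ≤ 10) :
    quarterInv t * quarterInv t = t ^ (-(1 / 2) : ℝ) := by
  rw [quarterInv, Real.smoothTransition.one_of_one_le (x := 32 * t - 1) (by linarith),
    Real.smoothTransition.one_of_one_le (x := 11 - t) (by linarith), mul_one, mul_one,
    ← Real.rpow_add (by linarith)]
  norm_num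

theorem quarterInv_nonneg (t : ℝ) : 0 ≤ quarterInv t := by
  rcases le_total t (1 / 32) with h | h
  · rw [quarterInv_of_le h]
  · exact mul_nonneg (Real.rpow_nonneg (by linarith) _)
      (mul_nonneg (Real.smoothTransition.nonneg _) (Real.smoothTransition.nonneg _))

theorem quarterInv_sq_le (t : ℝ) : quarterInv t * quarterInv t ≤ 6 := by
  rcases le_total t (1 / 32) with h | h
  · rw [quarterInv_of_le h]; norm_num
  · have hs : Real.smoothTransition (32 * t - 1) * Real.smoothTransition (11 - t) ≤ 1 :=
      mul_le_one₀ (Real.smoothTransition.le_one _) (Real.smoothTransition.nonneg _)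
        (Real.smoothTransition.le_one _)
    have h1 : quarterInv t ≤ t ^ (-(1 / 4) : ℝ) :=
      mul_le_of_le_one_right (Real.rpow_nonneg (by linarith) _) hs
    have h2 : quarterInv t * quarterInv t ≤ t ^ (-(1 / 2) : ℝ) := by
      calc _ ≤ t ^ (-(1 / 4) : ℝ) * t ^ (-(1 / 4) : ℝ) :=
            mul_le_mul h1 h1 (quarterInv_nonneg t) (Real.rpow_nonneg (by linarith) _)
        _ = t ^ (-(1 / 2) : ℝ) := by
            rw [← Real.rpow_add (by linarith)]; norm_num
    refine h2.trans ?_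
    have h3 : t ^ (-(1 / 2) : ℝ) ≤ (1 / 32 : ℝ) ^ (-(1 / 2) : ℝ) :=
      Real.rpow_le_rpow_of_nonpos (by norm_num) h (by norm_num)
    refine h3.trans ?_
    have : (1 / 32 : ℝ) ^ (-(1 / 2) : ℝ) = √32 := by
      rw [one_div, Real.inv_rpow (by norm_num), Real.rpow_neg (by norm_num), inv_inv,
        Real.sqrt_eq_rpow]
    rw [this, Real.sqrt_le_left (by norm_num)]
    norm_num

theorem quarterInv_le (t : ℝ) : quarterInv t ≤ 3 := by
  nlinarith [quarterInv_sq_le t, quarterInv_nonneg t]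

theorem opLip_quarterInv : OpLip quarterInv := by
  refine .of_const (contDiff_iff_contDiffAt.2 fun t => ?_) (1 / 32) 11 0 0
    (fun t => quarterInv_of_le) fun t => quarterInv_of_ge
  rcases lt_or_ge t (1 / 32) with h | h
  · have : quarterInv =ᶠ[nhds t] fun _ => 0 := by
      filter_upwards [gt_mem_nhds h] with u hu using quarterInv_of_le hu.le
    exact contDiffAt_const.congr_of_eventuallyEq this
  · refine ContDiffAt.mul ?_ ((contDiff_smoothTransition_comp _ (by fun_prop)).mul
      (contDiff_smoothTransition_comp _ (by fun_prop))).contDiffAt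
    exact contDiffAt_id.rpow_const_of_ne (by simp only [id]; linarith)

end Cutoffs

section Families

variable {ι : Type*} (A : ι → Type) [∀ i, CStarAlgebra (A i)]

/-- Uniformly bounded families of elements of the algebras `A i`. -/
def bdd : Subring (∀ i, A i) where
  carrier := {x | ∃ C : ℝ, ∀ i, ‖x i‖ ≤ C}
  mul_mem' := by
    rintro x y ⟨C, hC⟩ ⟨D, hD⟩
    exact ⟨C * D, fun i => (norm_mul_le _ _).trans
      (mul_le_mul (hC i) (hD i) (norm_nonneg _) ((norm_nonneg _).trans (hC i)))⟩
  one_mem' := by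
    refine ⟨1, fun i => ?_⟩
    rcases subsingleton_or_nontrivial (A i) with h | h
    · rw [Subsingleton.elim ((1 : ∀ i, A i) i) 0]; simp
    · simp
  add_mem' := by
    rintro x y ⟨C, hC⟩ ⟨D, hD⟩
    exact ⟨C + D, fun i => (norm_add_le _ _).trans (add_le_add (hC i) (hD i))⟩
  zero_mem' := ⟨0, fun i => by simp⟩
  neg_mem' := by
    rintro x ⟨C, hC⟩
    exact ⟨C, fun i => by simpa using hC i⟩

/-- The two-sided ideal of families that are `O(η)`. -/
def small (η : ι → ℝ) : Ideal (bdd A) where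
  carrier := {x | ∃ C : ℝ, ∀ i, ‖x.1 i‖ ≤ C * η i}
  add_mem' := by
    rintro x y ⟨C, hC⟩ ⟨D, hD⟩
    exact ⟨C + D, fun i => (norm_add_le _ _).trans (by
      rw [add_mul]; exact add_le_add (hC i) (hD i))⟩
  zero_mem' := ⟨0, fun i => by simp⟩
  smul_mem' := by
    rintro ⟨x, K, hK⟩ y ⟨C, hC⟩
    refine ⟨K * C, fun i => (norm_mul_le _ _).trans ?_⟩
    rw [mul_assoc]
    exact mul_le_mul (hK i) (hC i) (norm_nonneg _) ((norm_nonneg _).trans (hK i))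

instance (η : ι → ℝ) : (small A η).IsTwoSided where
  mul_mem_of_left := by
    rintro x ⟨y, K, hK⟩ ⟨C, hC⟩
    refine ⟨C * K, fun i => (norm_mul_le _ _).trans ?_⟩
    rw [mul_right_comm]
    exact mul_le_mul (hC i) (hK i) (norm_nonneg _) ((norm_nonneg _).trans (hC i))

/-- Bounded families modulo `O(η)`. -/
def Quo (η : ι → ℝ) : Type _ := bdd A ⧸ small A η

instance (η : ι → ℝ) : Ring (Quo A η) := inferInstanceAs (Ring (bdd A ⧸ small A η))

variable {A}

/-- The class of a bounded family modulo `O(η)`. -/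
def cls (η : ι → ℝ) : bdd A →+* Quo A η := Ideal.Quotient.mk (small A η)

theorem cls_eq {η : ι → ℝ} {x y : bdd A} :
    cls η x = cls η y ↔ ∃ C : ℝ, ∀ i, ‖x.1 i - y.1 i‖ ≤ C * η i :=
  Ideal.Quotient.eq

theorem cls_eq_zero {η : ι → ℝ} {x : bdd A} :
    cls η x = 0 ↔ ∃ C : ℝ, ∀ i, ‖x.1 i‖ ≤ C * η i :=
  Ideal.Quotient.eq_zero_iff_mem

/-- The pointwise adjoint of a bounded family. -/
def adj (x : bdd A) : bdd A :=
  ⟨fun i => star (x.1 i), x.2.imp fun C hC i => by simpa using hC i⟩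

theorem adj_mul (x y : bdd A) : adj (x * y) = adj y * adj x := by
  ext i; simp [adj]

theorem cls_adj {η : ι → ℝ} {x y : bdd A} (h : cls η x = cls η y) :
    cls η (adj x) = cls η (adj y) := by
  rw [cls_eq] at h ⊢
  refine h.imp fun C hC i => ?_
  simpa [adj, ← star_sub] using hC i

/-- A family is self-adjoint if it is so pointwise. -/
def SA (x : bdd A) : Prop := ∀ i, IsSelfAdjoint (x.1 i)

theorem SA.adj_eq {x : bdd A} (h : SA x) : adj x = x := by
  ext i; exact h i

/-- Pointwise real functional calculus with a bounded function. -/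
def rfc (f : ℝ → ℝ) (hf : ∃ C, ∀ t, |f t| ≤ C) (x : bdd A) : bdd A :=
  ⟨fun i => cfc f (x.1 i), hf.imp fun _ hC _ =>
    norm_cfc_le ((abs_nonneg _).trans (hC 0)) fun t _ => hC t⟩

/-- Pointwise complex functional calculus with a bounded function. -/
def cfcB (f : ℂ → ℂ) (hf : ∃ C, ∀ t, ‖f t‖ ≤ C) (x : bdd A) : bdd A :=
  ⟨fun i => cfc f (x.1 i), hf.imp fun _ hC _ =>
    norm_cfc_le ((norm_nonneg _).trans (hC 0)) fun t _ => hC t⟩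

theorem sa_rfc (f : ℝ → ℝ) (hf : ∃ C, ∀ t, |f t| ≤ C) (x : bdd A) :
    SA (rfc f hf x) := fun i => cfc_predicate f (x.1 i)

variable [∀ i, FiniteDimensional ℂ (A i)]

theorem commute_cls_rfc {η : ι → ℝ} {f : ℝ → ℝ} (hf : ∃ C, ∀ t, |f t| ≤ C) (hl : OpLip f)
    {s x : bdd A} (hx : SA x) (h : Commute (cls η s) (cls η x)) :
    Commute (cls η s) (cls η (rfc f hf x)) := by
  rw [commute_iff_eq, ← map_mul, ← map_mul, cls_eq] at h ⊢
  obtain ⟨C, hC⟩ := h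
  obtain ⟨K, hK, hK2⟩ := hl.exists_const
  refine ⟨K * C, fun i => (hK2 (A i) (x.1 i) (s.1 i) (hx i)).trans ?_⟩
  rw [mul_assoc]
  exact mul_le_mul_of_nonneg_left (hC i) hK

variable [∀ i, PartialOrder (A i)] [∀ i, StarOrderedRing (A i)]

theorem cls_eq_zero_of_sylvester {η : ι → ℝ} {T₁ T₂ W : bdd A} {α β : ℝ} (hαβ : α < β)
    (h₁ : SA T₁) (h₂ : SA T₂) (hα : ∀ i, T₁.1 i ≤ algebraMap ℝ (A i) α)
    (hβ : ∀ i, algebraMap ℝ (A i) β ≤ T₂.1 i)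
    (h : cls η T₁ * cls η W = cls η W * cls η T₂) : cls η W = 0 := by
  rw [← map_mul, ← map_mul, cls_eq] at h
  rw [cls_eq_zero]
  obtain ⟨C, hC⟩ := h
  refine ⟨(β - α)⁻¹ * C, fun i => ?_⟩
  have := (sylvester (W := W.1 i) hαβ (h₁ i) (h₂ i) (hα i) (hβ i)).trans (hC i)
  rw [mul_assoc, ← div_eq_inv_mul, le_div_iff₀ (by linarith)]
  linarith

theorem cls_eq_zero_of_sylvester' {η : ι → ℝ} {T₁ T₂ W : bdd A} {α β : ℝ} (hαβ : α < β)
    (h₁ : SA T₁) (h₂ : SA T₂) (hβ : ∀ i, algebraMap ℝ (A i) β ≤ T₁.1 i)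
    (hα : ∀ i, T₂.1 i ≤ algebraMap ℝ (A i) α)
    (h : cls η T₁ * cls η W = cls η W * cls η T₂) : cls η W = 0 := by
  rw [← map_mul, ← map_mul, cls_eq] at h
  rw [cls_eq_zero]
  obtain ⟨C, hC⟩ := h
  refine ⟨(β - α)⁻¹ * C, fun i => ?_⟩
  have := (sylvester' (W := W.1 i) hαβ (h₁ i) (h₂ i) (hβ i) (hα i)).trans (hC i)
  rw [mul_assoc, ← div_eq_inv_mul, le_div_iff₀ (by linarith)]
  linarith

end Families

section Polar

theorem bdd_unitStep : ∃ C, ∀ t, |unitStep t| ≤ C :=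
  ⟨1, fun t => by rw [abs_of_nonneg (unitStep_nonneg t)]; exact unitStep_le_one t⟩

theorem bdd_bump : ∃ C, ∀ t, |bump t| ≤ C :=
  ⟨1, fun t => by rw [abs_of_nonneg (bump_nonneg t)]; exact bump_le_one t⟩

theorem bdd_lowCut : ∃ C, ∀ t, |lowCut t| ≤ C :=
  ⟨1, fun t => by rw [abs_of_nonneg (lowCut_nonneg t)]; exact lowCut_le_one t⟩

theorem bdd_quarterInv : ∃ C, ∀ t, |quarterInv t| ≤ C :=
  ⟨3, fun t => by rw [abs_of_nonneg (quarterInv_nonneg t)]; exact quarterInv_le t⟩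

/-- Truncation of a real number to an interval. -/
def clip (l u t : ℝ) : ℝ := max l (min u t)

theorem abs_clip_le (l u t : ℝ) : |clip l u t| ≤ |l| + |u| := by
  rw [clip, abs_le]
  constructor
  · exact le_trans (by linarith [neg_abs_le l, abs_nonneg u]) (le_max_left _ _)
  · exact max_le (by linarith [le_abs_self l, abs_nonneg u])
      ((min_le_left _ _).trans (by linarith [le_abs_self u, abs_nonneg l]))

theorem bdd_clip (l u : ℝ) : ∃ C, ∀ t, |clip l u t| ≤ C := ⟨_, abs_clip_le l u⟩

variable {A : Type*} [CStarAlgebra A] [FiniteDimensional ℂ A]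

theorem exists_isUnit_add (Y : A) {ε : ℝ} (hε : 0 < ε) :
    ∃ τ : ℝ, |τ| ≤ ε ∧ IsUnit (Y + algebraMap ℝ A τ) := by
  have hfin := finite_spectrum_real (-Y)
  obtain ⟨τ, hτ, hτ'⟩ := ((Set.Ioo_infinite hε).sdiff hfin).nonempty
  refine ⟨τ, ?_, ?_⟩
  · rw [abs_of_pos hτ.1]; exact hτ.2.le
  · rw [spectrum.notMem_iff] at hτ'
    rwa [sub_neg_eq_add, add_comm] at hτ'

theorem spectrum_star_mul_self [PartialOrder A] [StarOrderedRing A] {X : A} (hX : IsUnit X)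
    (hn : ‖X‖ ≤ 3) :
    ∀ t ∈ spectrum ℝ (star X * X), 0 < t ∧ t ≤ 10 := by
  intro t ht
  have h0 : 0 ≤ t := spectrum_nonneg_of_nonneg (star_mul_self_nonneg X) ht
  refine ⟨lt_of_le_of_ne h0 ?_, ?_⟩
  · rintro rfl
    rw [spectrum.zero_mem_iff] at ht
    exact ht ((hX.star).mul hX)
  · have h1 : ‖t‖ ≤ ‖star X * X‖ * ‖(1 : A)‖ := spectrum.norm_le_norm_mul_of_mem ht
    have h2 : ‖star X * X‖ = ‖X‖ * ‖X‖ := CStarRing.norm_star_mul_self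
    have h3 : ‖(1 : A)‖ ≤ 1 := by
      rcases subsingleton_or_nontrivial A with h | h
      · rw [Subsingleton.elim (1 : A) 0]; simp
      · simp
    rw [Real.norm_of_nonneg h0, h2] at h1
    nlinarith [norm_nonneg X, norm_nonneg (1 : A), mul_nonneg (norm_nonneg X) (norm_nonneg X)]

/-- The unitary part of the polar decomposition of an invertible element. -/
def polU (X : A) : A := X * cfc (fun t : ℝ => t ^ (-(1 / 2) : ℝ)) (star X * X)

variable {X : A}

theorem polU_mul_cfc (f : ℝ → ℝ) :
    polU X * cfc f (star X * X) = X * cfc (fun t => t ^ (-(1 / 2) : ℝ) * f t) (star X * X) := by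
  rw [polU, mul_assoc, rcfc_mul]

theorem polU_mul : polU X * (star X * X) = X * star X * polU X := by
  have hN : IsSelfAdjoint (star X * X) := .star_mul_self X
  have : Commute (cfc (fun t : ℝ => t ^ (-(1 / 2) : ℝ)) (star X * X)) (star X * X) :=
    Commute.cfc_real (Commute.refl _) _
  rw [polU, mul_assoc, this.eq]
  simp only [mul_assoc]

theorem star_polU_mul [PartialOrder A] [StarOrderedRing A]
    (hX : IsUnit X) (hn : ‖X‖ ≤ 3) : star (polU X) * polU X = 1 := by
  have hN : IsSelfAdjoint (star X * X) := .star_mul_self X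
  set P := cfc (fun t : ℝ => t ^ (-(1 / 2) : ℝ)) (star X * X) with hP
  have hPs : star P = P := (cfc_predicate (p := IsSelfAdjoint) _ _ : IsSelfAdjoint P)
  have h1 : star (polU X) * polU X = P * (star X * X) * P := by
    rw [polU, star_mul, ← hP, hPs]; simp only [mul_assoc]
  rw [h1]
  conv_lhs => enter [1, 2]; rw [← rcfc_id hN]
  rw [hP, rcfc_mul, rcfc_mul, ← cfc_one ℝ (star X * X)]
  refine cfc_congr fun t ht => ?_
  have ht0 := (spectrum_star_mul_self hX hn t ht).1
  simp only [Pi.one_apply]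
  nth_rewrite 2 [← Real.rpow_one t]
  rw [← Real.rpow_add ht0, ← Real.rpow_add ht0]
  norm_num

theorem polU_mul_star [PartialOrder A] [StarOrderedRing A]
    (hX : IsUnit X) (hn : ‖X‖ ≤ 3) : polU X * star (polU X) = 1 := by
  have hN : IsSelfAdjoint (star X * X) := .star_mul_self X
  have hu : IsUnit (polU X) := by
    refine hX.mul ?_
    have key : ∀ p q : ℝ, p + q = 0 → cfc (fun t : ℝ => t ^ p) (star X * X) *
        cfc (fun t : ℝ => t ^ q) (star X * X) = 1 := by
      intro p q hpq
      rw [rcfc_mul, ← cfc_one ℝ (star X * X)]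
      refine cfc_congr fun t ht => ?_
      have ht0 := (spectrum_star_mul_self hX hn t ht).1
      simp only [Pi.one_apply]
      rw [← Real.rpow_add ht0, hpq, Real.rpow_zero]
    exact ⟨⟨_, _, key (-(1 / 2)) (1 / 2) (by norm_num), key (1 / 2) (-(1 / 2)) (by norm_num)⟩, rfl⟩
  have h := star_polU_mul hX hn
  obtain ⟨u, hu⟩ := hu
  rw [← hu] at h ⊢
  rw [eq_comm, ← Units.mul_inv u]
  congr 1
  exact Units.inv_eq_of_mul_eq_one_left h

theorem polU_mul_cut [PartialOrder A] [StarOrderedRing A]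
    (hX : IsUnit X) (hn : ‖X‖ ≤ 3) :
    polU X * (1 - cfc lowCut (star X * X) * cfc lowCut (star X * X)) =
      X * (cfc quarterInv (star X * X) * cfc quarterInv (star X * X) *
        (1 - cfc lowCut (star X * X) * cfc lowCut (star X * X))) := by
  have hN : IsSelfAdjoint (star X * X) := .star_mul_self X
  have h1 : (1 : A) = cfc (fun _ : ℝ => (1 : ℝ)) (star X * X) := (cfc_const_one ℝ _).symm
  rw [h1, rcfc_mul, rcfc_mul, rcfc_sub, rcfc_mul, polU_mul_cfc]
  congr 1
  refine cfc_congr fun t ht => ?_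
  obtain ⟨h0, h10⟩ := spectrum_star_mul_self hX hn t ht
  rcases le_total t (1 / 16) with h | h
  · rw [lowCut_of_le h]; ring
  · rw [quarterInv_sq h h10]

theorem polU_mul_of_eigen {e : A} {z : ℂ} {r : ℝ} (h : X * e = z • e)
    (h2 : star X * X * e = r • e) : polU X * e = ((r ^ (-(1 / 2) : ℝ) : ℝ) * z : ℂ) • e := by
  rw [polU, mul_assoc, rcfc_mul_of_eigen _ (.star_mul_self X) h2, mul_smul_comm, h, mul_smul]
  simp

end Polar

section UnitaryCalculus

variable {A : Type*} [CStarAlgebra A] [FiniteDimensional ℂ A]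

theorem norm_eq_one_of_mem_spectrum {U : A} (h1 : star U * U = 1) (h2 : U * star U = 1) {z : ℂ}
    (hz : z ∈ spectrum ℂ U) : ‖z‖ = 1 := by
  have hU : U ∈ unitary A := ⟨h1, h2⟩
  simpa using spectrum.subset_circle_of_unitary hU hz

theorem isStarNormal_of_unitary {U : A} (h1 : star U * U = 1) (h2 : U * star U = 1) :
    IsStarNormal U := ⟨by rw [commute_iff_eq, h1, h2]⟩

theorem isSelfAdjoint_cfc_ofReal (F : ℂ → ℝ) (U : A) :
    IsSelfAdjoint (cfc (fun z => (F z : ℂ)) U) := by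
  rw [isSelfAdjoint_iff, ← cfc_star]
  simp

theorem cfc_ofReal_nonneg [PartialOrder A] [StarOrderedRing A] {F : ℂ → ℝ} {U : A}
    (h : ∀ z ∈ spectrum ℂ U, 0 ≤ F z) : 0 ≤ cfc (fun z => (F z : ℂ)) U := by
  have : cfc (fun z => (F z : ℂ)) U =
      star (cfc (fun z => ((√(F z) : ℝ) : ℂ)) U) * cfc (fun z => ((√(F z) : ℝ) : ℂ)) U := by
    rw [(isSelfAdjoint_cfc_ofReal _ U).star_eq, ccfc_mul]
    refine cfc_congr fun z hz => ?_
    rw [← Complex.ofReal_mul, Real.mul_self_sqrt (h z hz)]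
  rw [this]
  exact star_mul_self_nonneg _

theorem cfc_ofReal_const {U : A} (hU : IsStarNormal U) (r : ℝ) :
    cfc (fun _ : ℂ => (r : ℂ)) U = algebraMap ℝ A r := by
  rw [cfc_const (r : ℂ) U]; rfl

theorem cfc_ofReal_le [PartialOrder A] [StarOrderedRing A] {F : ℂ → ℝ} {U : A} {r : ℝ}
    (hU : IsStarNormal U) (h : ∀ z ∈ spectrum ℂ U, F z ≤ r) :
    cfc (fun z => (F z : ℂ)) U ≤ algebraMap ℝ A r := by
  rw [← sub_nonneg, ← cfc_ofReal_const hU, ccfc_sub]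
  have := cfc_ofReal_nonneg (U := U) (F := fun z => r - F z) fun z hz => sub_nonneg.2 (h z hz)
  simpa using this

theorem le_cfc_ofReal [PartialOrder A] [StarOrderedRing A] {F : ℂ → ℝ} {U : A} {r : ℝ}
    (hU : IsStarNormal U) (h : ∀ z ∈ spectrum ℂ U, r ≤ F z) :
    algebraMap ℝ A r ≤ cfc (fun z => (F z : ℂ)) U := by
  rw [← sub_nonneg, ← cfc_ofReal_const hU, ccfc_sub]
  have := cfc_ofReal_nonneg (U := U) (F := fun z => F z - r) fun z hz => sub_nonneg.2 (h z hz)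
  simpa using this

end UnitaryCalculus

section UnitaryFamilies

variable {ι : Type*} {A : ι → Type} [∀ i, CStarAlgebra (A i)]

/-- Pointwise functional calculus of a family with a bounded real-valued function on `ℂ`. -/
def uf (F : ℂ → ℝ) (hF : ∃ C, ∀ z, |F z| ≤ C) (U : bdd A) : bdd A :=
  cfcB (fun z => (F z : ℂ)) (by simpa using hF) U

open Classical in
/-- The indicator function of a predicate. -/
def indic (p : ℂ → Prop) (z : ℂ) : ℝ := if p z then 1 else 0

theorem indic_of_pos {p : ℂ → Prop} {z : ℂ} (h : p z) : indic p z = 1 := if_pos h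

theorem indic_of_neg {p : ℂ → Prop} {z : ℂ} (h : ¬p z) : indic p z = 0 := if_neg h

theorem bdd_indic (p : ℂ → Prop) : ∃ C, ∀ z, |indic p z| ≤ C :=
  ⟨1, fun z => by unfold indic; split_ifs <;> simp⟩

/-- Pointwise spectral projection of a family. -/
def ind (p : ℂ → Prop) (U : bdd A) : bdd A := uf (indic p) (bdd_indic p) U

/-- Pointwise truncated real part of a family. -/
def cre (l u : ℝ) (U : bdd A) : bdd A :=
  uf (fun z => clip l u z.re) ⟨_, fun z => abs_clip_le l u z.re⟩ U

/-- Pointwise truncated imaginary part of a family. -/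
def cim (l u : ℝ) (U : bdd A) : bdd A :=
  uf (fun z => clip l u z.im) ⟨_, fun z => abs_clip_le l u z.im⟩ U

/-- The constant scalar family. -/
def scal (z : ℂ) : bdd A :=
  ⟨fun i => algebraMap ℂ (A i) z, ‖z‖, fun i => by
    change ‖algebraMap ℂ (A i) z‖ ≤ ‖z‖
    rcases subsingleton_or_nontrivial (A i) with h | h
    · rw [Subsingleton.elim (algebraMap ℂ (A i) z) 0]; simp
    · simp⟩

theorem scal_commute (z : ℂ) (x : bdd A) : Commute (scal z) x := by
  ext i; exact Algebra.commutes z (x.1 i)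

variable {U : bdd A}

/-- Pointwise unitary families. -/
def IsU (U : bdd A) : Prop := adj U * U = 1 ∧ U * adj U = 1

theorem IsU.left (hU : IsU U) (i : ι) :
    star (U.1 i) * U.1 i = 1 := congrFun (congrArg Subtype.val hU.1) i

theorem IsU.right (hU : IsU U) (i : ι) :
    U.1 i * star (U.1 i) = 1 := congrFun (congrArg Subtype.val hU.2) i

variable [∀ i, FiniteDimensional ℂ (A i)]

theorem sa_uf (F : ℂ → ℝ) (hF : ∃ C, ∀ z, |F z| ≤ C) : SA (uf F hF U) :=
  fun i => isSelfAdjoint_cfc_ofReal F (U.1 i)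

theorem uf_commute (F H : ℂ → ℝ) (hF hH) : Commute (uf F hF U) (uf H hH U) := by
  ext i; exact (cfc_commute_cfc _ _ (U.1 i)).eq

theorem IsU.normal (hU : IsU U) (i : ι) : IsStarNormal (U.1 i) :=
  isStarNormal_of_unitary (hU.left i) (hU.right i)

theorem IsU.norm_eq (hU : IsU U) (i : ι) {z : ℂ} (hz : z ∈ spectrum ℂ (U.1 i)) : ‖z‖ = 1 :=
  norm_eq_one_of_mem_spectrum (hU.left i) (hU.right i) hz

theorem IsU.uf_commute_self (hU : IsU U) (F : ℂ → ℝ) (hF) : Commute U (uf F hF U) := by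
  have h := fun i => hU.normal i
  ext i
  exact ((Commute.refl (U.1 i)).cfc (h i).star_comm_self _).symm.eq

theorem IsU.uf_mul_congr (hU : IsU U) {F H F' H' : ℂ → ℝ} {hF hH hF' hH'}
    (h : ∀ z, ‖z‖ = 1 → F z * H z = F' z * H' z) :
    uf F hF U * uf H hH U = uf F' hF' U * uf H' hH' U := by
  ext i
  change cfc _ (U.1 i) * cfc _ (U.1 i) = cfc _ (U.1 i) * cfc _ (U.1 i)
  rw [ccfc_mul, ccfc_mul]
  refine cfc_congr fun z hz => ?_
  have := h z (hU.norm_eq i hz)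
  simp only [← Complex.ofReal_mul, this]

theorem IsU.uf_mul (hU : IsU U) {F H K : ℂ → ℝ} {hF hH hK}
    (h : ∀ z, ‖z‖ = 1 → F z * H z = K z) :
    uf F hF U * uf H hH U = uf K hK U := by
  ext i
  change cfc _ (U.1 i) * cfc _ (U.1 i) = cfc _ (U.1 i)
  rw [ccfc_mul]
  refine cfc_congr fun z hz => ?_
  have := h z (hU.norm_eq i hz)
  simp only [← Complex.ofReal_mul, this]

theorem IsU.one_sub_ind (hU : IsU U) (p : ℂ → Prop) : 1 - ind p U = ind (fun z => ¬p z) U := by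
  have h := fun i => hU.normal i
  ext i
  change 1 - cfc _ (U.1 i) = cfc _ (U.1 i)
  rw [← cfc_one ℂ (U.1 i), Pi.one_def, ccfc_sub]
  refine cfc_congr fun z _ => ?_
  by_cases hz : p z
  · simp [indic_of_pos hz, indic_of_neg (p := fun z => ¬p z) (not_not.2 hz)]
  · simp [indic_of_neg hz, indic_of_pos (p := fun z => ¬p z) hz]

theorem IsU.ind_mul (hU : IsU U) (p q : ℂ → Prop) :
    ind p U * ind q U = ind (fun z => p z ∧ q z) U :=
  hU.uf_mul fun z _ => by
    by_cases hp : p z <;> by_cases hq : q z <;> simp [indic, hp, hq]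

theorem IsU.ind_add (hU : IsU U) {p q r : ℂ → Prop}
    (h : ∀ z, ‖z‖ = 1 → indic p z + indic q z = indic r z) :
    ind p U + ind q U = ind r U := by
  ext i
  change cfc _ (U.1 i) + cfc _ (U.1 i) = cfc _ (U.1 i)
  rw [ccfc_add]
  refine cfc_congr fun z hz => ?_
  have := h z (hU.norm_eq i hz)
  simp only [← Complex.ofReal_add, this]

theorem IsU.cre_add (hU : IsU U) : cre (-1) 1 U + cre (-1) 1 U = U + adj U := by
  have h := fun i => hU.normal i
  ext i
  change cfc _ (U.1 i) + cfc _ (U.1 i) = U.1 i + star (U.1 i)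
  rw [ccfc_add]
  have e : U.1 i = cfc (fun z : ℂ => z) (U.1 i) := (ccfc_id (h i)).symm
  have e2 : star (U.1 i) = cfc (fun z : ℂ => star z) (U.1 i) := by
    rw [cfc_star (fun z : ℂ => z), ← e]
  have key : U.1 i + star (U.1 i) = cfc (fun z : ℂ => z + star z) (U.1 i) := by
    rw [← ccfc_add, ← e2, ← e]
  rw [key]
  refine cfc_congr fun z hz => ?_
  have hz1 := hU.norm_eq i hz
  have h1 := abs_le.1 ((Complex.abs_re_le_norm z).trans hz1.le)
  have : clip (-1) 1 z.re = z.re := by rw [clip, min_eq_right h1.2, max_eq_right h1.1]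
  simp only [this]
  apply Complex.ext <;> simp

theorem IsU.cim_add (hU : IsU U) :
    cim (-1) 1 U + cim (-1) 1 U = scal Complex.I * (adj U - U) := by
  have h := fun i => hU.normal i
  ext i
  change cfc _ (U.1 i) + cfc _ (U.1 i) = algebraMap ℂ (A i) Complex.I * (star (U.1 i) - U.1 i)
  rw [ccfc_add]
  have e : U.1 i = cfc (fun z : ℂ => z) (U.1 i) := (ccfc_id (h i)).symm
  have e2 : star (U.1 i) = cfc (fun z : ℂ => star z) (U.1 i) := by
    rw [cfc_star (fun z : ℂ => z), ← e]
  have key : algebraMap ℂ (A i) Complex.I * (star (U.1 i) - U.1 i) =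
      cfc (fun z : ℂ => Complex.I * (star z - z)) (U.1 i) := by
    rw [← ccfc_mul (fun _ => Complex.I) (fun z => star z - z), ← ccfc_sub, ← e2, ← e,
      cfc_const Complex.I (U.1 i) (h i)]
  rw [key]
  refine cfc_congr fun z hz => ?_
  have hz1 := hU.norm_eq i hz
  have h1 := abs_le.1 ((Complex.abs_im_le_norm z).trans hz1.le)
  have : clip (-1) 1 z.im = z.im := by rw [clip, min_eq_right h1.2, max_eq_right h1.1]
  simp only [this]
  apply Complex.ext <;> simp

variable [∀ i, PartialOrder (A i)] [∀ i, StarOrderedRing (A i)]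

theorem IsU.uf_le (hU : IsU U) {F : ℂ → ℝ} {hF} {r : ℝ} (h : ∀ z, F z ≤ r) (i : ι) :
    (uf F hF U).1 i ≤ algebraMap ℝ (A i) r :=
  cfc_ofReal_le (hU.normal i) fun z _ => h z

theorem IsU.le_uf (hU : IsU U) {F : ℂ → ℝ} {hF} {r : ℝ} (h : ∀ z, r ≤ F z) (i : ι) :
    algebraMap ℝ (A i) r ≤ (uf F hF U).1 i :=
  le_cfc_ofReal (hU.normal i) fun z _ => h z

end UnitaryFamilies

section Hole

theorem conjugate_le {A : Type*} [CStarAlgebra A] [PartialOrder A] [StarOrderedRing A]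
    {θ c n : A} {r : ℝ} (hr : 0 ≤ r) (hc : IsSelfAdjoint c) (hn : IsSelfAdjoint n)
    (hθ : θ ≤ algebraMap ℝ A r) (hcc : c * c ≤ 1) (hnn : n * n ≤ algebraMap ℝ A 6) :
    n * (c * θ * c) * n ≤ algebraMap ℝ A (r * 6) := by
  have h1 : c * θ * c ≤ algebraMap ℝ A r := by
    have h := star_left_conjugate_le_conjugate hθ c
    have h2 : r • (c * c) ≤ r • (1 : A) := smul_le_smul_of_nonneg_left hcc hr
    rw [hc.star_eq] at h
    refine h.trans ?_
    rw [Algebra.algebraMap_eq_smul_one, mul_smul_comm, mul_one, smul_mul_assoc]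
    exact h2
  have h := star_left_conjugate_le_conjugate h1 n
  have h2 : r • (n * n) ≤ r • (algebraMap ℝ A 6) := smul_le_smul_of_nonneg_left hnn hr
  rw [hn.star_eq] at h
  refine h.trans ?_
  rw [Algebra.algebraMap_eq_smul_one, mul_smul_comm, mul_one, smul_mul_assoc]
  refine h2.trans (le_of_eq ?_)
  rw [map_mul, Algebra.smul_def]

theorem le_conjugate {A : Type*} [CStarAlgebra A] [PartialOrder A] [StarOrderedRing A]
    {θ c n : A} {r : ℝ} (hr : 0 ≤ r) (hc : IsSelfAdjoint c) (hn : IsSelfAdjoint n)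
    (hθ : algebraMap ℝ A (-r) ≤ θ) (hcc : c * c ≤ 1) (hnn : n * n ≤ algebraMap ℝ A 6) :
    algebraMap ℝ A (-(r * 6)) ≤ n * (c * θ * c) * n := by
  have h := conjugate_le (θ := -θ) hr hc hn (by rw [neg_le]; simpa using hθ) hcc hnn
  rw [map_neg, neg_le]
  simpa using h

theorem mem_Icc_of_norm_le_one {A : Type*} [CStarAlgebra A] {a : A} (h : ‖a‖ ≤ 1) {t : ℝ}
    (ht : t ∈ spectrum ℝ a) : t ∈ Set.Icc (-1 : ℝ) 1 := by
  have : Nontrivial A := by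
    by_contra hc
    rw [not_nontrivial_iff_subsingleton] at hc
    exact ht (isUnit_of_subsingleton _)
  have := (spectrum.norm_le_norm_of_mem ht).trans h
  rwa [Real.norm_eq_abs, abs_le] at this

variable {ι : Type*} {A : ι → Type} [∀ i, CStarAlgebra (A i)]
  [∀ i, FiniteDimensional ℂ (A i)] [∀ i, PartialOrder (A i)] [∀ i, StarOrderedRing (A i)]

theorem SA.mul_of {x y : bdd A} (hx : SA x) (hy : SA y) (h : Commute x y) : SA (x * y) :=
  fun i => (IsSelfAdjoint.commute_iff (hx i) (hy i)).1
    (congrFun (congrArg Subtype.val h.eq) i)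

theorem SA.conj {x y : bdd A} (hx : SA x) (hy : SA y) : SA (x * y * x) := fun i => by
  change IsSelfAdjoint (x.1 i * y.1 i * x.1 i)
  have := (hy i).conjugate (x.1 i)
  rwa [(hx i).star_eq] at this

theorem SA.add {x y : bdd A} (hx : SA x) (hy : SA y) : SA (x + y) :=
  fun i => (hx i).add (hy i)

theorem SA.sub {x y : bdd A} (hx : SA x) (hy : SA y) : SA (x - y) :=
  fun i => (hx i).sub (hy i)

theorem sa_one : SA (1 : bdd A) := fun _ => IsSelfAdjoint.one _

theorem sa_zero : SA (0 : bdd A) := fun _ => IsSelfAdjoint.zero _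

/-- Halving in the quotient of bounded families. -/
theorem cls_half {η : ι → ℝ} {y z : Quo A η} (h : y + y = z + z) : y = z := by
  have e : cls η (scal (1 / 2 : ℂ) + scal (1 / 2 : ℂ) : bdd A) = 1 := by
    rw [← map_one (cls η)]
    congr 1
    ext i
    change algebraMap ℂ (A i) (1 / 2) + algebraMap ℂ (A i) (1 / 2) = 1
    rw [← map_add]; norm_num
  rw [map_add] at e
  calc y = (cls η (scal (1 / 2 : ℂ)) + cls η (scal (1 / 2 : ℂ))) * y := by rw [e, one_mul]
    _ = cls η (scal (1 / 2 : ℂ)) * (y + y) := by rw [add_mul, mul_add]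
    _ = (cls η (scal (1 / 2 : ℂ)) + cls η (scal (1 / 2 : ℂ))) * z := by rw [h, add_mul, mul_add]
    _ = z := by rw [e, one_mul]

/-- The algebraic relations modulo `O(η)` behind the construction of a projection. -/
structure HoleData (η : ι → ℝ) (a f c U v n : bdd A) : Prop where
  isU : IsU U
  sa_a : SA a
  norm_a : ∀ i, ‖a.1 i‖ ≤ 1
  f_eq : f = rfc unitStep bdd_unitStep a
  sa_c : SA c
  sa_v : SA v
  sa_n : SA n
  c_le : ∀ i, c.1 i * c.1 i ≤ 1
  n_le : ∀ i, n.1 i * n.1 i ≤ algebraMap ℝ (A i) 6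
  af : Commute (cls η a) (cls η f)
  ac : Commute (cls η a) (cls η c)
  av : Commute (cls η a) (cls η v)
  an : Commute (cls η a) (cls η n)
  fc : Commute (cls η f) (cls η c)
  fv : Commute (cls η f) (cls η v)
  fn : Commute (cls η f) (cls η n)
  cv : Commute (cls η c) (cls η v)
  cn : Commute (cls η c) (cls η n)
  vn : Commute (cls η v) (cls η n)
  uv : Commute (cls η U) (cls η v)
  un : Commute (cls η U) (cls η n)
  fu : Commute (cls η f) (cls η U * (1 - cls η v * cls η v))
  ku : cls η (cre (-1) 1 U) * (1 - cls η v * cls η v) =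
    cls η c * cls η a * cls η c * (cls η n * cls η n * (1 - cls η v * cls η v))

namespace HoleData

variable {η : ι → ℝ} {a f c U v n : bdd A}

theorem sa_f (H : HoleData η a f c U v n) : SA f := by rw [H.f_eq]; exact sa_rfc _ _ _

theorem comm_adj {y : bdd A} (hy : SA y)
    (h : Commute (cls η U) (cls η y)) :
    Commute (cls η (adj U)) (cls η y) := by
  rw [commute_iff_eq, ← map_mul, ← map_mul] at h ⊢
  have := cls_adj h
  rw [adj_mul, adj_mul, hy.adj_eq] at this
  exact this.symm

theorem comm_cre (H : HoleData η a f c U v n) {y : bdd A} (hy : SA y)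
    (h : Commute (cls η U) (cls η y)) :
    Commute (cls η (cre (-1) 1 U)) (cls η y) := by
  have h2 := h.add_left (comm_adj hy h)
  rw [← map_add, ← H.isU.cre_add, map_add, commute_iff_eq, add_mul, mul_add] at h2
  exact cls_half h2

theorem comm_cim (H : HoleData η a f c U v n) {y : bdd A} (hy : SA y)
    (h : Commute (cls η U) (cls η y)) :
    Commute (cls η (cim (-1) 1 U)) (cls η y) := by
  have h1 : Commute (cls η (scal Complex.I)) (cls η y) := (scal_commute _ y).map (cls η)
  have h2 := h1.mul_left ((comm_adj hy h).sub_left h)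
  rw [← map_sub, ← map_mul, ← H.isU.cim_add, map_add, commute_iff_eq, add_mul, mul_add] at h2
  exact cls_half h2

end HoleData

end Hole

section Hole

theorem sort_intertwine {R : Type*} [Ring R] {n c θ a ψ u q K T : R} (hθ : θ * ψ = a * ψ)
    (ψa : Commute ψ a) (ψc : Commute ψ c) (ψn : Commute ψ n) (ac : Commute a c)
    (an : Commute a n) (cn : Commute c n)
    (ku : K * u = c * a * c * (n * n * u)) (hKu : Commute K u) (hq : K * q = q * T) :
    n * (c * θ * c) * n * (ψ * u * q) = ψ * u * q * T := by
  calc n * (c * θ * c) * n * (ψ * u * q) = n * c * (θ * ψ) * c * n * u * q := by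
        simp only [mul_assoc, ψn.symm.left_comm, ψc.symm.left_comm]
    _ = ψ * (c * a * c * (n * n * u)) * q := by
        rw [hθ]
        simp only [mul_assoc, ψn.symm.left_comm, ψc.symm.left_comm, ψa.symm.left_comm,
          ac.symm.left_comm, an.symm.left_comm, cn.symm.left_comm]
    _ = ψ * u * (K * q) := by rw [← ku, hKu.eq]; simp only [mul_assoc]
    _ = ψ * u * q * T := by rw [hq]; simp only [mul_assoc]

variable {ι : Type*} {A : ι → Type} [∀ i, CStarAlgebra (A i)]
  [∀ i, FiniteDimensional ℂ (A i)] [∀ i, PartialOrder (A i)] [∀ i, StarOrderedRing (A i)]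

theorem uf_ind {U : bdd A} (hU : IsU U) {p : ℂ → Prop} {F G : ℂ → ℝ} {hF hG}
    (h : ∀ z, ‖z‖ = 1 → p z → F z = G z) : uf F hF U * ind p U = uf G hG U * ind p U :=
  hU.uf_mul_congr fun z hz => by
    by_cases hp : p z
    · rw [h z hz hp]
    · rw [indic_of_neg hp, mul_zero, mul_zero]

theorem SA.le_clip {a : bdd A} (ha : SA a) {l u : ℝ} (h : l ≤ u) (i : ι) :
    (rfc (clip l u) (bdd_clip l u) a).1 i ≤ algebraMap ℝ (A i) u :=
  rcfc_le_algebraMap _ _ (fun _ _ => max_le h (min_le_left _ _)) (ha i)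

theorem SA.clip_le {a : bdd A} (ha : SA a) {l u : ℝ} (i : ι) :
    algebraMap ℝ (A i) l ≤ (rfc (clip l u) (bdd_clip l u) a).1 i :=
  algebraMap_le_rcfc _ _ (fun _ _ => le_max_left _ _) (ha i)

theorem clip_of_mem {l u t : ℝ} (h1 : l ≤ t) (h2 : t ≤ u) : clip l u t = t := by
  rw [clip, min_eq_right h2, max_eq_right h1]

theorem sa_cre (l u : ℝ) (U : bdd A) : SA (cre l u U) := sa_uf _ _

theorem sa_ind (p : ℂ → Prop) (U : bdd A) : SA (ind p U) := sa_uf _ _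

theorem IsU.le_cre {U : bdd A} (hU : IsU U) (l u : ℝ) (i : ι) :
    algebraMap ℝ (A i) l ≤ (cre l u U).1 i :=
  hU.le_uf (F := fun z => clip l u z.re) (fun _ => le_max_left _ _) i

theorem IsU.cre_le {U : bdd A} (hU : IsU U) {l u : ℝ} (h : l ≤ u) (i : ι) :
    (cre l u U).1 i ≤ algebraMap ℝ (A i) u :=
  hU.uf_le (F := fun z => clip l u z.re) (fun _ => max_le h (min_le_left _ _)) i

namespace HoleData

variable {η : ι → ℝ} {a f c U v n : bdd A}

theorem clip_mul_one_sub (H : HoleData η a f c U v n) :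
    rfc (clip (-1) (1 / 16)) (bdd_clip _ _) a * (1 - f) = a * (1 - f) := by
  ext i
  rw [H.f_eq]
  change cfc _ (a.1 i) * (1 - cfc unitStep (a.1 i)) = a.1 i * (1 - cfc unitStep (a.1 i))
  have h1 : (1 : A i) = cfc (fun _ : ℝ => (1 : ℝ)) (a.1 i) := (cfc_const_one ℝ _ (H.sa_a i)).symm
  have key : a.1 i * (1 - cfc unitStep (a.1 i)) =
      cfc (fun t => t * (1 - unitStep t)) (a.1 i) := by
    rw [← rcfc_mul (fun t => t), rcfc_id (H.sa_a i), ← rcfc_sub, ← h1]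
  rw [key, h1, rcfc_sub, rcfc_mul]
  refine cfc_congr fun t ht => ?_
  have := mem_Icc_of_norm_le_one (H.norm_a i) ht
  rcases le_total t (1 / 16) with h | h
  · rw [clip_of_mem this.1 h]
  · rw [unitStep_of_ge h]; ring

theorem clip_mul (H : HoleData η a f c U v n) :
    rfc (clip (-(1 / 16)) 1) (bdd_clip _ _) a * f = a * f := by
  ext i
  rw [H.f_eq]
  change cfc _ (a.1 i) * cfc unitStep (a.1 i) = a.1 i * cfc unitStep (a.1 i)
  have key : a.1 i * cfc unitStep (a.1 i) = cfc (fun t => t * unitStep t) (a.1 i) := by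
    rw [← rcfc_mul (fun t => t), rcfc_id (H.sa_a i)]
  rw [key, rcfc_mul]
  refine cfc_congr fun t ht => ?_
  have := mem_Icc_of_norm_le_one (H.norm_a i) ht
  rcases le_total (-(1 / 16)) t with h | h
  · rw [clip_of_mem h this.2]
  · rw [unitStep_of_le (by linarith)]; ring

theorem comm_one_sub_vv {y : bdd A} (h : Commute (cls η y) (cls η v)) :
    Commute (cls η y) (1 - cls η v * cls η v) :=
  (Commute.one_right _).sub_right (h.mul_right h)

theorem comm_cre_u (H : HoleData η a f c U v n) :
    Commute (cls η (cre (-1) 1 U)) (1 - cls η v * cls η v) :=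
  comm_one_sub_vv (H.comm_cre H.sa_v H.uv)

theorem one_sub_f_cut (H : HoleData η a f c U v n) : (1 - cls η f) * (1 - cls η v * cls η v) *
    cls η (ind (fun z => 1 / 2 < z.re) U) = 0 := by
  have hq : cls η (cre (-1) 1 U) * cls η (ind (fun z => 1 / 2 < z.re) U) =
      cls η (ind (fun z => 1 / 2 < z.re) U) * cls η (cre (1 / 2) 1 U) := by
    rw [← map_mul, ← map_mul]
    congr 1
    refine (uf_ind H.isU fun z hz hp => ?_).trans (uf_commute _ _ _ _).eq
    have := (abs_le.1 ((Complex.abs_re_le_norm z).trans hz.le))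
    rw [clip_of_mem this.1 this.2, clip_of_mem hp.le this.2]
  have one : ∀ {y : Quo A η}, Commute (1 : Quo A η) y := Commute.one_left _
  have key := sort_intertwine (K := cls η (cre (-1) 1 U)) (T := cls η (cre (1 / 2) 1 U))
    (θ := cls η (rfc (clip (-1) (1 / 16)) (bdd_clip _ _) a))
    (by rw [← map_one (cls η), ← map_sub, ← map_mul, H.clip_mul_one_sub, map_mul])
    (one.sub_left H.af.symm) (one.sub_left H.fc) (one.sub_left H.fn) H.ac H.an H.cn H.ku
    H.comm_cre_u hq
  have e : (1 - cls η f) * (1 - cls η v * cls η v) * cls η (ind (fun z => 1 / 2 < z.re) U) =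
      cls η ((1 - f) * (1 - v * v) * ind (fun z => 1 / 2 < z.re) U) := by
    simp only [map_mul, map_sub, map_one]
  rw [e] at key ⊢
  simp only [← map_mul (cls η) n, ← map_mul (cls η) c, ← map_mul] at key
  rw [map_mul, map_mul _ _ (cre (1 / 2) 1 U)] at key
  have hle : ∀ i, (n * (c * rfc (clip (-1) (1 / 16)) (bdd_clip _ _) a * c) * n).1 i ≤
      algebraMap ℝ (A i) (1 / 16 * 6) := fun i =>
    conjugate_le (by norm_num) (H.sa_c i) (H.sa_n i) (H.sa_a.le_clip (by norm_num) i)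
      (H.c_le i) (H.n_le i)
  exact cls_eq_zero_of_sylvester (α := 1 / 16 * 6) (β := 1 / 2) (by norm_num)
    (H.sa_n.conj (H.sa_c.conj (sa_rfc _ _ _))) (sa_cre _ _ _) hle
    (H.isU.le_cre _ _) key

theorem f_cut (H : HoleData η a f c U v n) : cls η f * (1 - cls η v * cls η v) *
    cls η (ind (fun z => z.re < -(1 / 2)) U) = 0 := by
  have hq : cls η (cre (-1) 1 U) * cls η (ind (fun z => z.re < -(1 / 2)) U) =
      cls η (ind (fun z => z.re < -(1 / 2)) U) * cls η (cre (-1) (-(1 / 2)) U) := by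
    rw [← map_mul, ← map_mul]
    congr 1
    refine (uf_ind H.isU fun z hz hp => ?_).trans (uf_commute _ _ _ _).eq
    have := (abs_le.1 ((Complex.abs_re_le_norm z).trans hz.le))
    rw [clip_of_mem this.1 this.2, clip_of_mem this.1 hp.le]
  have key := sort_intertwine (K := cls η (cre (-1) 1 U)) (T := cls η (cre (-1) (-(1 / 2)) U))
    (θ := cls η (rfc (clip (-(1 / 16)) 1) (bdd_clip _ _) a))
    (by rw [← map_mul, H.clip_mul, map_mul])
    H.af.symm H.fc H.fn H.ac H.an H.cn H.ku H.comm_cre_u hq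
  have e : cls η f * (1 - cls η v * cls η v) * cls η (ind (fun z => z.re < -(1 / 2)) U) =
      cls η (f * (1 - v * v) * ind (fun z => z.re < -(1 / 2)) U) := by
    simp only [map_mul, map_sub, map_one]
  rw [e] at key ⊢
  simp only [← map_mul (cls η) n, ← map_mul (cls η) c, ← map_mul] at key
  rw [map_mul, map_mul _ _ (cre (-1) (-(1 / 2)) U)] at key
  have hle : ∀ i, algebraMap ℝ (A i) (-(1 / 16 * 6)) ≤
      (n * (c * rfc (clip (-(1 / 16)) 1) (bdd_clip _ _) a * c) * n).1 i := fun i =>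
    le_conjugate (by norm_num) (H.sa_c i) (H.sa_n i) (H.sa_a.clip_le i)
      (H.c_le i) (H.n_le i)
  exact cls_eq_zero_of_sylvester' (α := -(1 / 2)) (β := -(1 / 16 * 6)) (by norm_num)
    (H.sa_n.conj (H.sa_c.conj (sa_rfc _ _ _))) (sa_cre _ _ _) hle
    (H.isU.cre_le (by norm_num)) key

end HoleData

end Hole

section Hole

variable {ι : Type*} {A : ι → Type} [∀ i, CStarAlgebra (A i)]
  [∀ i, FiniteDimensional ℂ (A i)] [∀ i, PartialOrder (A i)] [∀ i, StarOrderedRing (A i)]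

theorem intertwine_uf {η : ι → ℝ} {U y : bdd A} (hU : IsU U) {p q : ℂ → Prop}
    {F F₁ F₂ : ℂ → ℝ} {hF hF₁ hF₂}
    (hc : Commute (cls η (uf F hF U)) (cls η y)) (h₁ : ∀ z, ‖z‖ = 1 → p z → F₁ z = F z)
    (h₂ : ∀ z, ‖z‖ = 1 → q z → F₂ z = F z) :
    cls η (uf F₁ hF₁ U) * cls η (ind p U * y * ind q U) =
      cls η (ind p U * y * ind q U) * cls η (uf F₂ hF₂ U) := by
  have e1 : uf F₁ hF₁ U * ind p U = ind p U * uf F hF U :=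
    (uf_ind hU h₁).trans (uf_commute _ _ _ _).eq
  have e2 : ind q U * uf F₂ hF₂ U = uf F hF U * ind q U :=
    (uf_commute _ _ _ _).eq.trans (uf_ind hU h₂)
  rw [← map_mul, ← map_mul, mul_assoc (ind p U * y), e2, ← mul_assoc, ← mul_assoc, e1]
  simp only [map_mul, mul_assoc]
  rw [hc.left_comm]

theorem cut_eq_zero {η : ι → ℝ} {U y : bdd A} (hU : IsU U) {p q : ℂ → Prop}
    {F F₁ F₂ : ℂ → ℝ} {hF} (hF₁ : ∃ C, ∀ z, |F₁ z| ≤ C) (hF₂ : ∃ C, ∀ z, |F₂ z| ≤ C) {α β : ℝ}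
    (hαβ : α < β) (hc : Commute (cls η (uf F hF U)) (cls η y))
    (h₁ : ∀ z, ‖z‖ = 1 → p z → F₁ z = F z)
    (h₂ : ∀ z, ‖z‖ = 1 → q z → F₂ z = F z) (hα : ∀ z, F₁ z ≤ α) (hβ : ∀ z, β ≤ F₂ z) :
    cls η (ind p U * y * ind q U) = 0 :=
  cls_eq_zero_of_sylvester hαβ (sa_uf F₁ hF₁) (sa_uf F₂ hF₂) (hU.uf_le hα) (hU.le_uf hβ)
    (intertwine_uf hU hc h₁ h₂)

theorem cut_eq_zero' {η : ι → ℝ} {U y : bdd A} (hU : IsU U) {p q : ℂ → Prop}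
    {F F₁ F₂ : ℂ → ℝ} {hF} (hF₁ : ∃ C, ∀ z, |F₁ z| ≤ C) (hF₂ : ∃ C, ∀ z, |F₂ z| ≤ C) {α β : ℝ}
    (hαβ : α < β) (hc : Commute (cls η (uf F hF U)) (cls η y))
    (h₁ : ∀ z, ‖z‖ = 1 → p z → F₁ z = F z)
    (h₂ : ∀ z, ‖z‖ = 1 → q z → F₂ z = F z) (hβ : ∀ z, β ≤ F₁ z) (hα : ∀ z, F₂ z ≤ α) :
    cls η (ind p U * y * ind q U) = 0 :=
  cls_eq_zero_of_sylvester' hαβ (sa_uf F₁ hF₁) (sa_uf F₂ hF₂) (hU.le_uf hβ) (hU.uf_le hα)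
    (intertwine_uf hU hc h₁ h₂)

theorem clip_le_of_le {l u t : ℝ} (h : l ≤ u) : clip l u t ≤ u := max_le h (min_le_left _ _)

theorem le_clip_of {l u t : ℝ} : l ≤ clip l u t := le_max_left _ _

theorem adj_ind (p : ℂ → Prop) (U : bdd A) : adj (ind p U) = ind p U := (sa_ind p U).adj_eq

namespace HoleData

variable {η : ι → ℝ} {a f c U v n : bdd A}

theorem cut_plus (H : HoleData η a f c U v n) :
    cls η (ind (fun z => ¬0 < z.re) U * v * ind (fun z => 1 / 2 < z.re) U) = 0 := by
  refine cut_eq_zero H.isU (α := 0) (β := 1 / 2) (F := fun z => clip (-1) 1 z.re)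
    (F₁ := fun z => clip (-1) 0 z.re) (F₂ := fun z => clip (1 / 2) 1 z.re)
    ⟨_, fun z => abs_clip_le _ _ z.re⟩ ⟨_, fun z => abs_clip_le _ _ z.re⟩ (by norm_num)
    (H.comm_cre H.sa_v H.uv) (fun z hz hp => ?_) (fun z hz hp => ?_)
    (fun z => clip_le_of_le (by norm_num)) fun z => le_clip_of
  all_goals have := (abs_le.1 ((Complex.abs_re_le_norm z).trans hz.le))
  · rw [clip_of_mem this.1 this.2, clip_of_mem this.1 (not_lt.1 hp)]
  · rw [clip_of_mem this.1 this.2, clip_of_mem hp.le this.2]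

theorem cut_minus (H : HoleData η a f c U v n) :
    cls η (ind (fun z => 0 < z.re) U * v * ind (fun z => z.re < -(1 / 2)) U) = 0 := by
  refine cut_eq_zero' H.isU (α := -(1 / 2)) (β := 0) (F := fun z => clip (-1) 1 z.re)
    (F₁ := fun z => clip 0 1 z.re) (F₂ := fun z => clip (-1) (-(1 / 2)) z.re)
    ⟨_, fun z => abs_clip_le _ _ z.re⟩ ⟨_, fun z => abs_clip_le _ _ z.re⟩ (by norm_num)
    (H.comm_cre H.sa_v H.uv) (fun z hz hp => ?_) (fun z hz hp => ?_)
    (fun z => le_clip_of) fun z => clip_le_of_le (by norm_num)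
  all_goals have := (abs_le.1 ((Complex.abs_re_le_norm z).trans hz.le))
  · rw [clip_of_mem this.1 this.2, clip_of_mem hp.le this.2]
  · rw [clip_of_mem this.1 this.2, clip_of_mem this.1 hp.le]

end HoleData

/-- The correction term. -/
def corr (f U v : bdd A) : bdd A := v * (ind (fun z => 0 < z.re) U - f) * v

namespace HoleData

variable {η : ι → ℝ} {a f c U v n : bdd A}

theorem sa_corr (H : HoleData η a f c U v n) :
    SA (corr f U v) := H.sa_v.conj ((sa_ind _ _).sub H.sa_f)

theorem sa_add_corr (H : HoleData η a f c U v n) : SA (f + corr f U v) := H.sa_f.add H.sa_corr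

theorem cls_add_corr (H : HoleData η a f c U v n) : cls η (f + corr f U v) =
    cls η f * (1 - cls η v * cls η v) + cls η v * cls η (ind (fun z => 0 < z.re) U) * cls η v := by
  simp only [corr, map_add, map_mul, map_sub, mul_sub, sub_mul, mul_one, mul_assoc]
  rw [H.fv.symm.left_comm]
  abel

theorem cls_one_sub_add_corr (H : HoleData η a f c U v n) : 1 - cls η (f + corr f U v) =
    (1 - cls η f) * (1 - cls η v * cls η v) +
      cls η v * cls η (ind (fun z => ¬0 < z.re) U) * cls η v := by
  rw [H.cls_add_corr, ← H.isU.one_sub_ind, map_sub, map_one]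
  noncomm_ring

theorem comm_u_add_corr (H : HoleData η a f c U v n) :
    Commute (cls η U) (cls η (f + corr f U v)) := by
  rw [H.cls_add_corr]
  have hu : Commute (cls η U) (1 - cls η v * cls η v) :=
    (Commute.one_right _).sub_right (H.uv.mul_right H.uv)
  have hh : Commute (cls η U) (cls η (ind (fun z => 0 < z.re) U)) :=
    (H.isU.uf_commute_self _ _).map (cls η)
  refine Commute.add_right ?_ ((H.uv.mul_right hh).mul_right H.uv)
  have h1 : Commute (cls η f) (1 - cls η v * cls η v) :=
    (Commute.one_right _).sub_right (H.fv.mul_right H.fv)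
  have := H.fu.eq
  rw [commute_iff_eq, h1.eq, ← mul_assoc, ← this, mul_assoc, hu.eq, ← mul_assoc, ← mul_assoc, h1.eq]

theorem add_corr_minus (H : HoleData η a f c U v n) :
    cls η (f + corr f U v) * cls η (ind (fun z => z.re < -(1 / 2)) U) = 0 := by
  have h := H.cut_minus
  rw [map_mul, map_mul] at h
  rw [H.cls_add_corr, add_mul, H.f_cut, zero_add, mul_assoc, mul_assoc,
    ← mul_assoc (cls η (ind _ _)),
    h, mul_zero]

theorem add_corr_plus (H : HoleData η a f c U v n) :
    (1 - cls η (f + corr f U v)) * cls η (ind (fun z => 1 / 2 < z.re) U) = 0 := by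
  have h := H.cut_plus
  rw [map_mul, map_mul] at h
  rw [H.cls_one_sub_add_corr, add_mul, H.one_sub_f_cut, zero_add, mul_assoc, mul_assoc,
    ← mul_assoc (cls η (ind _ _)), h, mul_zero]

theorem minus_add_corr (H : HoleData η a f c U v n) :
    cls η (ind (fun z => z.re < -(1 / 2)) U) * cls η (f + corr f U v) = 0 := by
  have h := H.add_corr_minus
  rw [← map_mul, ← map_zero (cls η)] at h
  have := cls_adj h
  rw [adj_mul, adj_ind, H.sa_add_corr.adj_eq, sa_zero.adj_eq, map_mul, map_zero] at this
  exact this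

theorem plus_add_corr (H : HoleData η a f c U v n) :
    cls η (ind (fun z => 1 / 2 < z.re) U) * cls η (f + corr f U v) =
      cls η (ind (fun z => 1 / 2 < z.re) U) := by
  have h := H.add_corr_plus
  rw [sub_mul, one_mul, sub_eq_zero, ← map_mul] at h
  have := cls_adj h
  rw [adj_mul, adj_ind, H.sa_add_corr.adj_eq, map_mul] at this
  exact this.symm

theorem lower_cut (H : HoleData η a f c U v n) :
    cls η (ind (fun z => z.im ≤ -(1 / 2)) U * (f + corr f U v) *
    ind (fun z => ¬z.im < 0) U) = 0 := by
  refine cut_eq_zero H.isU (α := -(1 / 2)) (β := 0) (F := fun z => clip (-1) 1 z.im)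
    (F₁ := fun z => clip (-1) (-(1 / 2)) z.im) (F₂ := fun z => clip 0 1 z.im)
    ⟨_, fun z => abs_clip_le _ _ z.im⟩ ⟨_, fun z => abs_clip_le _ _ z.im⟩ (by norm_num)
    (H.comm_cim H.sa_add_corr H.comm_u_add_corr) (fun z hz hp => ?_) (fun z hz hp => ?_)
    (fun z => clip_le_of_le (by norm_num)) fun z => le_clip_of
  all_goals have := (abs_le.1 ((Complex.abs_im_le_norm z).trans hz.le))
  · rw [clip_of_mem this.1 this.2, clip_of_mem this.1 hp]
  · rw [clip_of_mem this.1 this.2, clip_of_mem (not_lt.1 hp) this.2]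

theorem ind_decomp (H : HoleData η a f c U v n) :
    ind (fun z => z.im < 0) U = ind (fun z => z.im ≤ -(1 / 2)) U +
    (ind (fun z => -(1 / 2) < z.im ∧ z.im < 0) U * ind (fun z => 1 / 2 < z.re) U +
      ind (fun z => -(1 / 2) < z.im ∧ z.im < 0) U * ind (fun z => z.re < -(1 / 2)) U) := by
  have hre : ∀ z : ℂ, ‖z‖ = 1 → -(1 / 2) < z.im → z.im < 0 → 1 / 2 < z.re ∨ z.re < -(1 / 2) := by
    intro z hz h1 h2
    by_contra! hc
    have := Complex.sq_norm z
    rw [hz, Complex.normSq_apply] at this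
    nlinarith
  rw [H.isU.ind_mul, H.isU.ind_mul, H.isU.ind_add
    (r := fun z => -(1 / 2) < z.im ∧ z.im < 0) fun z hz => ?_]
  · refine (H.isU.ind_add fun z hz => ?_).symm
    unfold indic
    split_ifs <;> grind
  · have := hre z hz
    unfold indic
    split_ifs <;> grind

theorem proj_cut (H : HoleData η a f c U v n) :
    cls η (ind (fun z => z.im < 0) U) * cls η (f + corr f U v) *
    cls η (ind (fun z => ¬z.im < 0) U) = 0 := by
  have h := H.lower_cut
  rw [map_mul, map_mul] at h
  have h3 : cls η (ind (fun z => -(1 / 2) < z.im ∧ z.im < 0) U) *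
      cls η (ind (fun z => 1 / 2 < z.re) U) * cls η (ind (fun z => ¬z.im < 0) U) = 0 := by
    rw [← map_mul, ← map_mul, ← map_zero (cls η), H.isU.ind_mul, H.isU.ind_mul]
    congr 1
    ext i
    refine (cfc_congr (g := fun _ => (0 : ℂ)) fun z _ => ?_).trans (cfc_const_zero ℂ _)
    rw [indic_of_neg fun hz => hz.2 hz.1.1.2, Complex.ofReal_zero]
  rw [H.ind_decomp, map_add, map_add, map_mul, map_mul, add_mul, add_mul, h, zero_add, add_mul,
    mul_assoc (cls η (ind _ _)) _ (cls η (f + _)), H.plus_add_corr, mul_assoc _ _ (cls η (f + _)),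
    H.minus_add_corr, add_mul, h3]
  simp

/-- The spectral projection commutes with the corrected step modulo `O(η)`. -/
theorem commute_proj (H : HoleData η a f c U v n) :
    Commute (cls η (ind (fun z => z.im < 0) U)) (cls η (f + corr f U v)) := by
  have h := H.proj_cut
  rw [← H.isU.one_sub_ind, map_sub, map_one, mul_sub, mul_one, sub_eq_zero] at h
  have h2 : cls η (adj (ind (fun z => z.im < 0) U * (f + corr f U v))) = _ :=
    cls_adj (y := ind (fun z => z.im < 0) U * (f + corr f U v) * ind (fun z => z.im < 0) U)
      (by rw [map_mul, map_mul, map_mul]; exact h)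
  rw [adj_mul, adj_mul, adj_mul, adj_ind, H.sa_add_corr.adj_eq, map_mul, map_mul, map_mul,
    ← mul_assoc, ← h] at h2
  exact h2.symm

end HoleData

end Hole

section Hole

variable {ι : Type*} {A : ι → Type} [∀ i, CStarAlgebra (A i)]
  [∀ i, FiniteDimensional ℂ (A i)] [∀ i, PartialOrder (A i)] [∀ i, StarOrderedRing (A i)]

theorem norm_le_one_of_star_mul_self {A : Type*} [CStarAlgebra A] {U : A} (h : star U * U = 1) :
    ‖U‖ ≤ 1 := by
  rcases subsingleton_or_nontrivial A with h1 | h1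
  · rw [Subsingleton.elim U 0]; simp
  · have : ‖U‖ * ‖U‖ = 1 := by rw [← CStarRing.norm_star_mul_self, h, norm_one]
    nlinarith [norm_nonneg U]

/-- The unitary polar part of a family of invertible elements. -/
def polB (X : bdd A) (hX : ∀ i, IsUnit (X.1 i) ∧ ‖X.1 i‖ ≤ 3) : bdd A :=
  ⟨fun i => polU (X.1 i), 1, fun i =>
    norm_le_one_of_star_mul_self (star_polU_mul (hX i).1 (hX i).2)⟩

theorem isU_polB (X : bdd A) (hX : ∀ i, IsUnit (X.1 i) ∧ ‖X.1 i‖ ≤ 3) : IsU (polB X hX) :=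
  ⟨by ext i; exact star_polU_mul (hX i).1 (hX i).2,
    by ext i; exact polU_mul_star (hX i).1 (hX i).2⟩

theorem sa_adj_mul (X : bdd A) : SA (adj X * X) := fun i => .star_mul_self (X.1 i)

theorem lowCut_mul_eq_zero {η : ι → ℝ} {N m E : bdd A} (sN : SA N)
    (hN : ∀ i, ∀ t ∈ spectrum ℝ (N.1 i), 0 ≤ t) (sm : SA m)
    (hm : ∀ i, algebraMap ℝ (A i) (1 / 4) ≤ m.1 i)
    (mv : Commute (cls η m) (cls η (rfc lowCut bdd_lowCut N)))
    (Nv : Commute (cls η N) (cls η (rfc lowCut bdd_lowCut N)))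
    (hNE : cls η N * cls η E = cls η m * cls η E) :
    cls η (rfc lowCut bdd_lowCut N) * cls η E = 0 := by
  set v := rfc lowCut bdd_lowCut N with hv
  have hNv : rfc (clip 0 (1 / 8)) (bdd_clip _ _) N * v = N * v := by
    ext i
    change cfc _ (N.1 i) * cfc lowCut (N.1 i) = N.1 i * cfc lowCut (N.1 i)
    have key : N.1 i * cfc lowCut (N.1 i) = cfc (fun t => t * lowCut t) (N.1 i) := by
      rw [← rcfc_mul (fun t => t), rcfc_id (sN i)]
    rw [key, rcfc_mul]
    refine cfc_congr fun t ht => ?_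
    rcases le_total t (1 / 8) with h | h
    · rw [clip_of_mem (hN i t ht) h]
    · rw [lowCut_of_ge h]; ring
  have h1 : ∀ i, (rfc (clip 0 (1 / 8)) (bdd_clip _ _) N - m).1 i ≤
      algebraMap ℝ (A i) (-(1 / 8)) := fun i => by
    have h3 := sub_le_sub (sN.le_clip (l := 0) (u := 1 / 8) (by norm_num) i) (hm i)
    rw [← map_sub] at h3
    norm_num at h3 ⊢
    exact h3
  have h2 : cls η (rfc (clip 0 (1 / 8)) (bdd_clip _ _) N - m) * cls η (v * E) =
      cls η (v * E) * cls η 0 := by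
    have e : cls η (rfc (clip 0 (1 / 8)) (bdd_clip _ _) N) * cls η v = cls η N * cls η v := by
      rw [← map_mul, hNv, map_mul]
    rw [map_zero, mul_zero, map_sub, sub_mul, map_mul, ← mul_assoc, e, ← mul_assoc, mv.eq, Nv.eq,
      mul_assoc, hNE, mul_assoc, sub_self]
  rw [← map_mul]
  exact cls_eq_zero_of_sylvester (α := -(1 / 8)) (β := 0) (by norm_num) ((sa_rfc _ _ _).sub sm)
    sa_zero h1
    (fun i => by rw [map_zero]; exact le_rfl) h2

theorem sq_mul_of_eigen {R : Type*} [Ring R] {I x β c a E : R} (hx : x = c * a * c)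
    (hI : I * I = -1) (xI : Commute x I) (βI : Commute β I) (xβ : Commute x β)
    (ac : Commute a c) (hE : a * a * E = E) :
    (x - I * β) * (x + I * β) * E = (c * c * (c * c) + β * β) * E := by
  have e : (x - I * β) * (x + I * β) = x * x - I * I * (β * β) := by
    rw [sub_mul, mul_add, mul_add]
    simp only [mul_assoc]
    rw [xI.left_comm, βI.left_comm, xβ.eq]
    abel
  have e2 : x * x = c * c * (c * c) * (a * a) := by
    rw [hx]; simp only [mul_assoc, ac.left_comm, ac.eq]
  rw [e, hI, e2, neg_one_mul, sub_neg_eq_add, add_mul, mul_assoc _ (a * a), hE, ← add_mul]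

set_option maxHeartbeats 1000000 in
theorem holeData {η : ι → ℝ} {a β x X : bdd A} (hX : ∀ i, IsUnit (X.1 i) ∧ ‖X.1 i‖ ≤ 3)
    (ha : SA a) (hβ : SA β) (na : ∀ i, ‖a.1 i‖ ≤ 1)
    (hc : Commute (cls η a) (cls η β)) (hx : SA x) (hXx : X = x + scal Complex.I * β)
    (hxa : cls η x = cls η (rfc bump bdd_bump β) * cls η a * cls η (rfc bump bdd_bump β)) :
    HoleData η a (rfc unitStep bdd_unitStep a) (rfc bump bdd_bump β) (polB X hX)
      (rfc lowCut bdd_lowCut (adj X * X)) (rfc quarterInv bdd_quarterInv (adj X * X)) ∧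
    ∀ E : bdd A, a * a * E = E → cls η (rfc lowCut bdd_lowCut (adj X * X)) * cls η E = 0 := by
  set f := rfc unitStep bdd_unitStep a with hf
  set c := rfc bump bdd_bump β with hcdef
  set N := adj X * X with hN
  set v := rfc lowCut bdd_lowCut N with hv
  set n := rfc quarterInv bdd_quarterInv N with hn
  set U := polB X hX with hU
  have sN : SA N := sa_adj_mul X
  have sc : SA c := sa_rfc _ _ _
  have sv : SA v := sa_rfc _ _ _
  have sn : SA n := sa_rfc _ _ _
  have isU : IsU U := isU_polB X hX
  have ac : Commute (cls η a) (cls η c) := commute_cls_rfc _ opLip_bump hβ hc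
  have βc : Commute (cls η β) (cls η c) := commute_cls_rfc _ opLip_bump hβ (Commute.refl _)
  have af : Commute (cls η a) (cls η f) := commute_cls_rfc _ opLip_unitStep ha (Commute.refl _)
  have βf : Commute (cls η β) (cls η f) := commute_cls_rfc _ opLip_unitStep ha hc.symm
  have cf : Commute (cls η c) (cls η f) := commute_cls_rfc _ opLip_unitStep ha ac.symm
  have hXa : adj X = x - scal Complex.I * β := by
    ext i
    rw [hXx]
    change star (x.1 i + algebraMap ℂ (A i) Complex.I * β.1 i) =
      x.1 i - algebraMap ℂ (A i) Complex.I * β.1 i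
    rw [star_add, star_mul, (hx i).star_eq, (hβ i).star_eq, ← algebraMap_star_comm,
      ← Algebra.commutes, Complex.star_def, Complex.conj_I, map_neg, neg_mul, sub_eq_add_neg]
  have hI : ∀ y : bdd A, Commute (cls η y) (cls η (scal Complex.I)) := fun y =>
    ((scal_commute _ y).map (cls η)).symm
  have key : ∀ y : bdd A, Commute (cls η y) (cls η a) → Commute (cls η y) (cls η c) →
      Commute (cls η y) (cls η β) → Commute (cls η y) (cls η X) ∧ Commute (cls η y) (cls η N) := by
    intro y h1 h2 h3
    have hyx : Commute (cls η y) (cls η x) := by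
      rw [hxa]; exact (h2.mul_right h1).mul_right h2
    have h4 : Commute (cls η y) (cls η X) := by
      rw [hXx, map_add, map_mul]; exact hyx.add_right ((hI y).mul_right h3)
    refine ⟨h4, ?_⟩
    rw [hN, map_mul]
    refine Commute.mul_right ?_ h4
    rw [hXa, map_sub, map_mul]; exact hyx.sub_right ((hI y).mul_right h3)
  obtain ⟨aX, aN⟩ := key a (Commute.refl _) ac hc
  obtain ⟨cX, cN⟩ := key c ac.symm (Commute.refl _) βc.symm
  obtain ⟨fX, fN⟩ := key f af.symm cf.symm βf.symm
  obtain ⟨βX, βN⟩ := key β hc.symm βc (Commute.refl _)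
  have xβ : Commute (cls η x) (cls η β) := by
    rw [hxa]; exact (βc.symm.mul_left hc).mul_left βc.symm
  have xX : Commute (cls η x) (cls η X) := by
    rw [hXx, map_add, map_mul]
    exact (Commute.refl _).add_right ((hI x).mul_right xβ)
  have adX : Commute (cls η (adj X)) (cls η X) := by
    rw [hXa, map_sub, map_mul]
    exact xX.sub_left (((hI X).symm).mul_left βX)
  have XN : Commute (cls η X) (cls η N) := by
    rw [hN, map_mul]; exact adX.symm.mul_right (Commute.refl _)
  have UN : Commute (cls η U) (cls η N) := by
    have h : U * N = X * adj X * U := by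
      ext i
      exact polU_mul
    rw [commute_iff_eq, ← map_mul, h, map_mul, map_mul, ← adX.eq, ← map_mul, ← hN]
  have toV : ∀ y : bdd A, Commute (cls η y) (cls η N) → Commute (cls η y) (cls η v) := fun y h =>
    commute_cls_rfc _ opLip_lowCut sN h
  have toN : ∀ y : bdd A, Commute (cls η y) (cls η N) → Commute (cls η y) (cls η n) := fun y h =>
    commute_cls_rfc _ opLip_quarterInv sN h
  have hcut : U * (1 - v * v) = X * (n * n * (1 - v * v)) := by
    ext i
    exact polU_mul_cut (hX i).1 (hX i).2
  have Xv := toV X XN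
  have Xn := toN X XN
  have vn : Commute (cls η v) (cls η n) := toN v (toV N (Commute.refl _)).symm
  have Xg : Commute (cls η X) (cls η (n * n * (1 - v * v))) := by
    simp only [map_mul, map_sub, map_one]
    exact (Xn.mul_right Xn).mul_right ((Commute.one_right _).sub_right (Xv.mul_right Xv))
  have fg : Commute (cls η f) (cls η (n * n * (1 - v * v))) := by
    have fv := toV f fN
    have fn := toN f fN
    simp only [map_mul, map_sub, map_one]
    exact (fn.mul_right fn).mul_right ((Commute.one_right _).sub_right (fv.mul_right fv))
  have Uu : Commute (cls η U) (cls η (1 - v * v)) := by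
    have h := toV U UN
    simp only [map_mul, map_sub, map_one]
    exact (Commute.one_right _).sub_right (h.mul_right h)
  have su : SA (1 - v * v) := sa_one.sub (sv.mul_of sv (Commute.refl _))
  have sg : SA (n * n * (1 - v * v)) := by
    refine (sn.mul_of sn (Commute.refl _)).mul_of su ?_
    have : Commute n v := by ext i; exact (cfc_commute_cfc _ _ (N.1 i)).eq
    exact (Commute.one_right _).sub_right ((this.mul_left this).mul_right (this.mul_left this))
  refine ⟨⟨isU, ha, na, rfl, sc, sv, sn, fun i => ?_, fun i => ?_, af, ac, toV a aN, toN a aN,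
    cf.symm, toV f fN, toN f fN, toV c cN, toN c cN, vn, toV U UN, toN U UN, ?_, ?_⟩, ?_⟩
  · change cfc bump (β.1 i) * cfc bump (β.1 i) ≤ 1
    rw [rcfc_mul, ← map_one (algebraMap ℝ (A i))]
    exact rcfc_le_algebraMap _ _
      (fun t _ => mul_le_one₀ (bump_le_one t) (bump_nonneg t) (bump_le_one t)) (hβ i)
  · change cfc quarterInv (N.1 i) * cfc quarterInv (N.1 i) ≤ _
    rw [rcfc_mul]
    exact rcfc_le_algebraMap _ _ (fun t _ => quarterInv_sq_le t) (sN i)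
  · have h : cls η U * (1 - cls η v * cls η v) = cls η (U * (1 - v * v)) := by
      simp only [map_mul, map_sub, map_one]
    rw [h, hcut, map_mul]
    exact fX.mul_right fg
  · have h1 : cls η (1 - v * v) = 1 - cls η v * cls η v := by
      simp only [map_mul, map_sub, map_one]
    have h2 : cls η (n * n * (1 - v * v)) = cls η n * cls η n * (1 - cls η v * cls η v) := by
      simp only [map_mul, map_sub, map_one]
    rw [← h1, ← hxa, h1, ← h2, ← h1]
    have h3 : cls η ((1 - v * v) * U) = cls η (X * (n * n * (1 - v * v))) := by
      rw [← hcut, map_mul, map_mul]; exact Uu.symm.eq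
    have h4 := cls_adj h3
    rw [adj_mul, adj_mul, su.adj_eq, sg.adj_eq] at h4
    have h5 : cls η (adj X * (n * n * (1 - v * v))) =
        cls η (n * n * (1 - v * v) * adj X) := by
      have := cls_adj ((map_mul (cls η) _ _).trans (Xg.eq.trans (map_mul (cls η) _ _).symm))
      rw [adj_mul X, adj_mul _ X, sg.adj_eq] at this
      exact this.symm
    apply cls_half
    rw [← map_mul, ← map_mul, ← map_add, ← map_add, ← add_mul, isU.cre_add, add_mul, hcut,
      map_add, h4, ← h5, ← map_add, ← add_mul, ← add_mul, hXx, ← hXx, hXa]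
    congr 2
    rw [hXx]; abel
  · intro E hE
    set m : bdd A := c * c * (c * c) + β * β with hm
    have sm : SA m := ((sc.mul_of sc (Commute.refl _)).mul_of (sc.mul_of sc (Commute.refl _))
      (Commute.refl _)).add (hβ.mul_of hβ (Commute.refl _))
    have hNE : cls η N * cls η E = cls η m * cls η E := by
      have hII : (scal Complex.I * scal Complex.I : bdd A) = -1 := by
        ext i
        change algebraMap ℂ (A i) Complex.I * algebraMap ℂ (A i) Complex.I = -1
        rw [← map_mul, Complex.I_mul_I, map_neg, map_one]
      have hII' := congrArg (cls η) hII
      have hE' := congrArg (cls η) hE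
      simp only [map_mul, map_neg, map_one] at hII' hE'
      have := sq_mul_of_eigen hxa hII' (hI x) (hI β) xβ ac hE'
      rw [hN, hXa, hXx, hm]
      simp only [map_mul, map_sub, map_add]
      exact this
    have mv : Commute (cls η m) (cls η v) := by
      have cv := toV c cN
      have βv := toV β βN
      simp only [hm, map_add, map_mul]
      exact ((cv.mul_left cv).mul_left (cv.mul_left cv)).add_left (βv.mul_left βv)
    refine lowCut_mul_eq_zero sN
      (fun i t ht => (spectrum_star_mul_self (hX i).1 (hX i).2 t ht).1.le) sm (fun i => ?_) mv
      (toV N (Commute.refl _)) hNE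
    have e : m.1 i = cfc (fun t => bump t * bump t * (bump t * bump t) + t * t) (β.1 i) := by
      rw [← rcfc_add, ← rcfc_mul (fun t => bump t * bump t), ← rcfc_mul bump bump,
        ← rcfc_mul (fun t => t), rcfc_id (hβ i)]
      rfl
    rw [e]
    refine algebraMap_le_rcfc _ _ (fun t _ => ?_) (hβ i)
    rcases le_total |t| (1 / 2) with h | h
    · rw [bump_of_abs_le h]; nlinarith [mul_self_nonneg t]
    · have : (1 / 4 : ℝ) ≤ t * t := by rw [← abs_mul_abs_self t]; nlinarith
      nlinarith [mul_self_nonneg (bump t * bump t)]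

end Hole

section HoleEdge

theorem norm_algebraMap_real_le (A : Type*) [CStarAlgebra A] (r : ℝ) :
    ‖algebraMap ℝ A r‖ ≤ |r| := by
  rcases subsingleton_or_nontrivial A with h | h
  · rw [Subsingleton.elim (algebraMap ℝ A r) 0]; simp
  · simp

variable {A : Type*} [CStarAlgebra A] [FiniteDimensional ℂ A]

theorem polU_mul_of_edge {x β e : A} {τ σ : ℝ} (hx : IsSelfAdjoint x) (hβ : IsSelfAdjoint β)
    (xe : x * e = τ • e) (βe : β * e = σ • e) :
    polU (x + algebraMap ℂ A Complex.I * β) * e =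
      (((τ * τ + σ * σ) ^ (-(1 / 2) : ℝ) : ℝ) * (τ + Complex.I * σ) : ℂ) • e ∧
    star (x + algebraMap ℂ A Complex.I * β) * (x + algebraMap ℂ A Complex.I * β) * e =
      (τ * τ + σ * σ) • e := by
  have c1 : ∀ (r : ℝ), (r • e : A) = (r : ℂ) • e := fun r => (Complex.coe_smul r e).symm
  rw [c1] at xe βe
  have h1 : (x + algebraMap ℂ A Complex.I * β) * e = ((τ : ℂ) + Complex.I * σ) • e := by
    rw [add_mul, mul_assoc, xe, βe, ← Algebra.smul_def, smul_smul, add_smul]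
  have h0 : star (x + algebraMap ℂ A Complex.I * β) = x - algebraMap ℂ A Complex.I * β := by
    rw [star_add, star_mul, hx.star_eq, hβ.star_eq, ← algebraMap_star_comm]
    simp [Algebra.commutes, sub_eq_add_neg]
  have h2 : star (x + algebraMap ℂ A Complex.I * β) * (x + algebraMap ℂ A Complex.I * β) * e =
      (τ * τ + σ * σ) • e := by
    rw [mul_assoc, h1, mul_smul_comm, h0, sub_mul, mul_assoc, xe, βe, ← Algebra.smul_def,
      smul_smul, ← sub_smul, smul_smul, c1]
    congr 1
    push_cast
    linear_combination (-(σ : ℂ) * σ) * Complex.I_mul_I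
  exact ⟨polU_mul_of_eigen h1 h2, h2⟩

end HoleEdge

section HoleFamily

variable {ι : Type*} {A : ι → Type} [∀ i, CStarAlgebra (A i)]
  [∀ i, FiniteDimensional ℂ (A i)] [∀ i, PartialOrder (A i)] [∀ i, StarOrderedRing (A i)]

theorem hole_family {η : ι → ℝ} (hη : ∀ i, 0 < η i) {a β : bdd A} (ha : SA a) (hβ : SA β)
    (na : ∀ i, ‖a.1 i‖ ≤ 1) (nβ : ∀ i, ‖β.1 i‖ ≤ 1) (hc : Commute (cls η a) (cls η β)) :
    ∃ G κ : bdd A, SA G ∧ G * G = G ∧ SA κ ∧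
      (∀ i e, β.1 i * e = -e → G.1 i * e = e ∧ κ.1 i * e = 0) ∧
      (∀ i e, β.1 i * e = e → G.1 i * e = 0 ∧ κ.1 i * e = 0) ∧
      Commute (cls η G) (cls η (rfc unitStep bdd_unitStep a + κ)) ∧
      ∀ E, a * a * E = E → cls η κ * cls η E = 0 := by
  set c := rfc bump bdd_bump β with hcdef
  have sc : SA c := sa_rfc _ _ _
  have nc : ∀ i, ‖c.1 i‖ ≤ 1 := fun i => norm_cfc_le zero_le_one fun t _ => by
    rw [Real.norm_eq_abs, abs_of_nonneg (bump_nonneg t)]; exact bump_le_one t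
  choose τ hτ hτu using fun i => exists_isUnit_add
    ((c * a * c + scal Complex.I * β).1 i) (lt_min (hη i) one_pos)
  set t : bdd A :=
    ⟨fun i => algebraMap ℝ (A i) (τ i), 1, fun i => (norm_algebraMap_real_le (A i) (τ i)).trans
    ((hτ i).trans (min_le_right _ _))⟩ with htdef
  have ht0 : cls η t = 0 := cls_eq_zero.2 ⟨1, fun i => by
    rw [one_mul]
    exact (norm_algebraMap_real_le (A i) (τ i)).trans ((hτ i).trans (min_le_left _ _))⟩
  have st : SA t := fun i => .algebraMap (A i) (.all (τ i))
  set x := c * a * c + t with hxdef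
  have sx : SA x := (sc.conj ha).add st
  set X := x + scal Complex.I * β with hXdef
  have hX : ∀ i, IsUnit (X.1 i) ∧ ‖X.1 i‖ ≤ 3 := fun i => by
    refine ⟨?_, ?_⟩
    · have : X.1 i = (c * a * c + scal Complex.I * β).1 i + algebraMap ℝ (A i) (τ i) := by
        rw [hXdef, hxdef, add_right_comm]; rfl
      rw [this]; exact hτu i
    · have h1 : ‖c.1 i * a.1 i * c.1 i‖ ≤ 1 := by
        refine (norm_mul_le _ _).trans (mul_le_one₀ ((norm_mul_le _ _).trans
          (mul_le_one₀ (nc i) (norm_nonneg _) (na i))) (norm_nonneg _) (nc i))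
      have h2 : ‖algebraMap ℝ (A i) (τ i)‖ ≤ 1 :=
        (norm_algebraMap_real_le (A i) (τ i)).trans ((hτ i).trans (min_le_right _ _))
      have h3 : ‖algebraMap ℂ (A i) Complex.I * β.1 i‖ ≤ 1 := by
        rw [← Algebra.smul_def, norm_smul, Complex.norm_I, one_mul]; exact nβ i
      have := (norm_add₃_le (a := c.1 i * a.1 i * c.1 i) (b := algebraMap ℝ (A i) (τ i))
        (c := algebraMap ℂ (A i) Complex.I * β.1 i))
      change ‖c.1 i * a.1 i * c.1 i + algebraMap ℝ (A i) (τ i) +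
        algebraMap ℂ (A i) Complex.I * β.1 i‖ ≤ 3
      linarith
  have hxa : cls η x = cls η c * cls η a * cls η c := by
    rw [hxdef, map_add, ht0, add_zero, map_mul, map_mul]
  obtain ⟨H, HE⟩ := holeData hX ha hβ na hc sx hXdef hxa
  set v := rfc lowCut bdd_lowCut (adj X * X) with hv
  set U := polB X hX with hU
  set f := rfc unitStep bdd_unitStep a with hf
  have edge : ∀ i (e : A i) (σ : ℝ), σ * σ = 1 → bump σ = 0 → β.1 i * e = σ • e →
      ∃ z : ℂ, (∃ r : ℝ, 0 < r ∧ z.im = r * σ) ∧ U.1 i * e = z • e ∧ v.1 i * e = 0 := by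
    intro i e σ hσ hb he
    have ce : c.1 i * e = 0 := by
      change cfc bump (β.1 i) * e = 0
      rw [rcfc_mul_of_eigen bump (hβ i) he, hb, zero_smul]
    have xe : x.1 i * e = τ i • e := by
      change (c.1 i * a.1 i * c.1 i + algebraMap ℝ (A i) (τ i)) * e = _
      rw [add_mul, mul_assoc _ (c.1 i), ce, mul_zero, zero_add, Algebra.smul_def]
    obtain ⟨h1, h2⟩ := polU_mul_of_edge (sx i) (hβ i) xe he
    have hr : 0 < τ i * τ i + σ * σ := by rw [hσ]; nlinarith [mul_self_nonneg (τ i)]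
    refine ⟨_, ⟨_, Real.rpow_pos_of_pos hr (-(1 / 2)), ?_⟩, h1, ?_⟩
    · simp
    · change cfc lowCut (star (X.1 i) * X.1 i) * e = 0
      have h3 : star (X.1 i) * X.1 i * e = (τ i * τ i + σ * σ) • e := h2
      rw [rcfc_mul_of_eigen lowCut (.star_mul_self _) h3, lowCut_of_ge, zero_smul]
      rw [hσ]; nlinarith [mul_self_nonneg (τ i)]
  have κe : ∀ i (e : A i), v.1 i * e = 0 → (corr f U v).1 i * e = 0 := fun i e h => by
    change v.1 i * (_ : A i) * v.1 i * e = 0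
    rw [mul_assoc, h, mul_zero]
  refine ⟨ind (fun z => z.im < 0) U, corr f U v, sa_ind _ _, ?_, H.sa_corr, ?_, ?_,
    H.commute_proj, ?_⟩
  · rw [H.isU.ind_mul]; simp
  · intro i e he
    obtain ⟨z, ⟨r, hr, hz⟩, h1, h2⟩ := edge i e (-1) (by norm_num) (bump_of_le (by norm_num))
      (by simpa using he)
    refine ⟨?_, κe i e h2⟩
    change cfc _ (U.1 i) * e = e
    rw [ccfc_mul_of_eigen _ (H.isU.normal i) h1, indic_of_pos (by linarith)]
    simp
  · intro i e he
    obtain ⟨z, ⟨r, hr, hz⟩, h1, h2⟩ := edge i e 1 (by norm_num) (bump_of_ge (by norm_num))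
      (by simpa using he)
    refine ⟨?_, κe i e h2⟩
    change cfc _ (U.1 i) * e = 0
    rw [ccfc_mul_of_eigen _ (H.isU.normal i) h1, indic_of_neg (by simp [hz, hr.le])]
    simp
  · intro E hE
    rw [corr, map_mul, mul_assoc, HE E hE, mul_zero]

end HoleFamily

section Uniform

/-- A pair of almost commuting self-adjoint contractions in some finite-dimensional C⋆-algebra. -/
structure AlmostCommutingPair where
  A : Type
  [cstar : CStarAlgebra A]
  [fin : FiniteDimensional ℂ A]
  [order : PartialOrder A]
  [starOrder : StarOrderedRing A]
  η : ℝ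
  a : A
  β : A
  η_pos : 0 < η
  sa_a : IsSelfAdjoint a
  sa_β : IsSelfAdjoint β
  norm_a : ‖a‖ ≤ 1
  norm_β : ‖β‖ ≤ 1
  norm_comm : ‖a * β - β * a‖ ≤ η

attribute [instance] AlmostCommutingPair.cstar AlmostCommutingPair.fin AlmostCommutingPair.order
  AlmostCommutingPair.starOrder

theorem exists_almost_commuting_projection : ∃ C : ℝ, 0 ≤ C ∧ ∀ (A : Type) [CStarAlgebra A]
    [FiniteDimensional ℂ A] [PartialOrder A] [StarOrderedRing A] (η : ℝ) (a β : A), 0 < η →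
    IsSelfAdjoint a → IsSelfAdjoint β → ‖a‖ ≤ 1 → ‖β‖ ≤ 1 → ‖a * β - β * a‖ ≤ η →
    ∃ G κ : A, IsSelfAdjoint G ∧ G * G = G ∧ IsSelfAdjoint κ ∧
      (∀ e, β * e = -e → G * e = e ∧ κ * e = 0) ∧ (∀ e, β * e = e → G * e = 0 ∧ κ * e = 0) ∧
      ‖G * (cfc unitStep a + κ) - (cfc unitStep a + κ) * G‖ ≤ C * η ∧
      ∀ e, a * e = e ∨ a * e = -e → ‖κ * e‖ ≤ C * η * ‖e‖ := by
  let A := AlmostCommutingPair.A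
  let a : bdd A := ⟨fun i => i.a, 1, fun i => i.norm_a⟩
  let β : bdd A := ⟨fun i => i.β, 1, fun i => i.norm_β⟩
  have hc : Commute (cls (AlmostCommutingPair.η) a) (cls AlmostCommutingPair.η β) := by
    rw [commute_iff_eq, ← map_mul, ← map_mul, cls_eq]
    exact ⟨1, fun i => by rw [one_mul]; exact i.norm_comm⟩
  have ha : SA a := fun i => i.sa_a
  have hβ : SA β := fun i => i.sa_β
  obtain ⟨G, κ, sG, GG, sκ, h1, h2, h3, h4⟩ := hole_family (fun i => i.η_pos) ha
    hβ (fun i => i.norm_a) (fun i => i.norm_β) hc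
  let p : ℝ → ℝ := fun t => if t * t = 1 then 1 else 0
  let E : bdd A := rfc p ⟨1, fun t => by simp only [p]; split_ifs <;> simp⟩ a
  have hE : a * a * E = E := by
    ext i
    change i.a * i.a * cfc p i.a = cfc p i.a
    conv_lhs => enter [1]; rw [← rcfc_id i.sa_a]
    rw [rcfc_mul, rcfc_mul]
    refine cfc_congr fun t _ => ?_
    simp only [p]; split_ifs with h <;> simp [h]
  have h5 := h4 E hE
  rw [commute_iff_eq, ← map_mul, ← map_mul, cls_eq] at h3
  rw [← map_mul, cls_eq_zero] at h5
  obtain ⟨C, hC⟩ := h3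
  obtain ⟨D, hD⟩ := h5
  refine ⟨max (max C D) 0, le_max_right _ _, ?_⟩
  intro A _ _ _ _ η a₀ β₀ hη sa sb na nb hab
  let i : AlmostCommutingPair := ⟨A, η, a₀, β₀, hη, sa, sb, na, nb, hab⟩
  refine ⟨G.1 i, κ.1 i, sG i, congrFun (congrArg Subtype.val GG) i, sκ i, h1 i, h2 i,
    (hC i).trans ?_, ?_⟩
  · exact mul_le_mul_of_nonneg_right ((le_max_left _ _).trans (le_max_left _ _)) hη.le
  · intro e he
    have hEe : cfc p a₀ * e = e := by
      rcases he with he | he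
      · rw [rcfc_mul_of_eigen p sa (r := 1) (by simpa using he)]; simp [p]
      · rw [rcfc_mul_of_eigen p sa (r := -1) (by simpa using he)]; simp [p]
    have h6 : ‖κ.1 i * cfc p a₀‖ ≤ D * η := hD i
    calc ‖κ.1 i * e‖ = ‖κ.1 i * cfc p a₀ * e‖ := by rw [mul_assoc, hEe]
      _ ≤ ‖κ.1 i * cfc p a₀‖ * ‖e‖ := norm_mul_le _ _
      _ ≤ D * η * ‖e‖ := by gcongr
      _ ≤ _ := by gcongr; exact (le_max_right _ _).trans (le_max_left _ _)

end Uniform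

section Pinching

variable {A : Type*} [CStarAlgebra A]

/-- An increasing sequence of projections starting at `0` and equal to `1` beyond index `m`. -/
structure Flag (m : ℕ) (G : ℕ → A) : Prop where
  sa : ∀ k, IsSelfAdjoint (G k)
  mul : ∀ k l, k ≤ l → G k * G l = G k
  zero : G 0 = 0
  one : ∀ k, m < k → G k = 1

/-- Compression to the blocks of a flag. -/
def pinch (m : ℕ) (G : ℕ → A) (B : A) : A :=
  ∑ k ∈ Finset.range (m + 1), (G (k + 1) - G k) * B * (G (k + 1) - G k)

theorem norm_le_one_of_proj {p : A} (h : IsSelfAdjoint p) (h2 : p * p = p) : ‖p‖ ≤ 1 := by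
  have h3 : ‖p‖ * ‖p‖ = ‖p‖ := by rw [← CStarRing.norm_star_mul_self, h.star_eq, h2]
  nlinarith [norm_nonneg p]

namespace Flag

variable {m : ℕ} {G : ℕ → A}

theorem mul' (F : Flag m G) (k l : ℕ) (h : l ≤ k) : G k * G l = G l := by
  have := congrArg star (F.mul l k h)
  rwa [star_mul, (F.sa k).star_eq, (F.sa l).star_eq] at this

theorem norm_le (F : Flag m G) (k : ℕ) :
    ‖G k‖ ≤ 1 := norm_le_one_of_proj (F.sa k) (F.mul k k le_rfl)

theorem norm_one_sub_le (F : Flag m G) (k : ℕ) : ‖1 - G k‖ ≤ 1 := by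
  refine norm_le_one_of_proj ((IsSelfAdjoint.one A).sub (F.sa k)) ?_
  have := F.mul k k le_rfl
  simp [mul_sub, sub_mul, this]

theorem sa_diff (F : Flag m G) (k : ℕ) : IsSelfAdjoint (G (k + 1) - G k) := (F.sa _).sub (F.sa _)

theorem diff_mul_self (F : Flag m G) (k : ℕ) :
    (G (k + 1) - G k) * (G (k + 1) - G k) = G (k + 1) - G k := by
  simp [mul_sub, sub_mul, F.mul k (k + 1) (by lia), F.mul' (k + 1) k (by lia), F.mul _ _ le_rfl]

theorem norm_diff_le (F : Flag m G) (k : ℕ) : ‖G (k + 1) - G k‖ ≤ 1 :=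
  norm_le_one_of_proj (F.sa_diff k) (F.diff_mul_self k)

theorem diff_mul_of_lt (F : Flag m G) (k j : ℕ) (h : k < j) :
    (G (k + 1) - G k) * G j = G (k + 1) - G k ∧ G j * (G (k + 1) - G k) = G (k + 1) - G k := by
  constructor
  · rw [sub_mul, F.mul _ _ (by lia), F.mul _ _ (by lia)]
  · rw [mul_sub, F.mul' _ _ (by lia), F.mul' _ _ (by lia)]

theorem diff_mul_of_le (F : Flag m G) (k j : ℕ) (h : j ≤ k) :
    (G (k + 1) - G k) * G j = 0 ∧ G j * (G (k + 1) - G k) = 0 := by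
  constructor
  · rw [sub_mul, F.mul' _ _ (by lia), F.mul' _ _ (by lia), sub_self]
  · rw [mul_sub, F.mul _ _ (by lia), F.mul _ _ (by lia), sub_self]

theorem pinch_commute (F : Flag m G) (B : A) (j : ℕ) : Commute (G j) (pinch m G B) := by
  refine Commute.sum_right _ _ _ fun k _ => ?_
  rw [commute_iff_eq]
  rcases lt_or_ge k j with h | h
  · obtain ⟨h1, h2⟩ := F.diff_mul_of_lt k j h
    calc _ = G j * (G (k + 1) - G k) * B * (G (k + 1) - G k) := by simp only [mul_assoc]
      _ = (G (k + 1) - G k) * B * ((G (k + 1) - G k) * G j) := by rw [h2, h1]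
      _ = _ := by simp only [mul_assoc]
  · obtain ⟨h1, h2⟩ := F.diff_mul_of_le k j h
    calc _ = G j * (G (k + 1) - G k) * B * (G (k + 1) - G k) := by simp only [mul_assoc]
      _ = (G (k + 1) - G k) * B * ((G (k + 1) - G k) * G j) := by rw [h2, h1]; simp
      _ = _ := by simp only [mul_assoc]

theorem sa_pinch (F : Flag m G) {B : A} (hB : IsSelfAdjoint B) : IsSelfAdjoint (pinch m G B) := by
  rw [pinch, isSelfAdjoint_iff, star_sum]
  refine Finset.sum_congr rfl fun k _ => ?_
  rw [star_mul, star_mul, (F.sa_diff k).star_eq, hB.star_eq, mul_assoc]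

theorem sub_pinch (F : Flag m G) {B : A} (hB : IsSelfAdjoint B) :
    B - pinch m G B =
      (∑ k ∈ Finset.range (m + 1), (G (k + 1) - G k) * B * (1 - G (k + 1))) +
      star (∑ k ∈ Finset.range (m + 1), (G (k + 1) - G k) * B * (1 - G (k + 1))) := by
  have key : ∀ N, B - (1 - G N) * B * (1 - G N) =
      (∑ k ∈ Finset.range N, (G (k + 1) - G k) * B * (G (k + 1) - G k)) +
      ((∑ k ∈ Finset.range N, (G (k + 1) - G k) * B * (1 - G (k + 1))) +
      star (∑ k ∈ Finset.range N, (G (k + 1) - G k) * B * (1 - G (k + 1)))) := by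
    intro N
    induction N with
    | zero => simp [F.zero]
    | succ N ih =>
      rw [Finset.sum_range_succ, Finset.sum_range_succ, star_add]
      rw [star_mul ((G (N + 1) - G N) * B), star_mul, (F.sa_diff N).star_eq, hB.star_eq, star_sub,
        star_one, (F.sa (N + 1)).star_eq]
      rw [← sub_eq_iff_eq_add.2 ih]
      noncomm_ring
  have := key (m + 1)
  rw [F.one (m + 1) (by lia), sub_self, zero_mul, zero_mul, sub_zero] at this
  rw [sub_eq_iff_eq_add']
  exact this

variable [PartialOrder A] [StarOrderedRing A]

theorem near_le (F : Flag m G) {B : A} {ε : ℝ}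
    (h : ∀ k, ‖G k * B * (1 - G k)‖ ≤ ε) (N : ℕ) :
    (∑ k ∈ Finset.range N, (G (k + 1) - G k) * B * (G (k + 2) - G (k + 1))) *
      star (∑ k ∈ Finset.range N, (G (k + 1) - G k) * B * (G (k + 2) - G (k + 1))) ≤
    (ε * ε) • G N := by
  induction N with
  | zero => simp [F.zero]
  | succ N ih =>
    rw [Finset.sum_range_succ, star_add]
    set S := ∑ k ∈ Finset.range N, (G (k + 1) - G k) * B * (G (k + 2) - G (k + 1))
    set D := G (N + 1) - G N with hD
    set D' := G (N + 2) - G (N + 1) with hD'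
    have sD : star D = D := (F.sa_diff N).star_eq
    have sD' : star D' = D' := (F.sa_diff (N + 1)).star_eq
    set T := D * B * D' with hT
    have h1 : S * D' = 0 := by
      rw [Finset.sum_mul]
      refine Finset.sum_eq_zero fun k hk => ?_
      rw [Finset.mem_range] at hk
      rw [mul_assoc, hD', mul_sub, (F.diff_mul_of_lt (k + 1) (N + 2) (by lia)).1,
        (F.diff_mul_of_lt (k + 1) (N + 1) (by lia)).1, sub_self, mul_zero]
    have h2 : S * star T = 0 := by
      rw [hT, star_mul, sD', ← mul_assoc, h1, zero_mul]
    have h3 : T * star S = 0 := by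
      have := congrArg star h2
      simpa using this
    have hTn : ‖T‖ ≤ ε := by
      have e : T = D * (G (N + 1) * B * (1 - G (N + 1))) * D' := by
        have e1 : D * G (N + 1) = D := (F.diff_mul_of_lt N (N + 1) (by lia)).1
        have e2 : (1 - G (N + 1)) * D' = D' := by
          rw [sub_mul, one_mul, (F.diff_mul_of_le (N + 1) (N + 1) le_rfl).2, sub_zero]
        rw [hT]
        nth_rewrite 1 [← e1, ← e2]
        simp only [mul_assoc]
      rw [e]
      have h0 := h (N + 1)
      have hd := F.norm_diff_le N
      have hd' := F.norm_diff_le (N + 1)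
      calc _ ≤ ‖D‖ * ‖G (N + 1) * B * (1 - G (N + 1))‖ * ‖D'‖ :=
            (norm_mul_le _ _).trans (by gcongr; exact norm_mul_le _ _)
        _ ≤ 1 * ε * 1 := by gcongr; simpa using (norm_nonneg _).trans h0
        _ = ε := by ring
    have hε : 0 ≤ ε := (norm_nonneg _).trans hTn
    have hTT : T * star T ≤ (ε * ε) • D := by
      have e : T * star T = D * (T * star T) * star D := by
        have e1 : D * T = T := by rw [hT, ← mul_assoc, ← mul_assoc, F.diff_mul_self]
        have e2 : star T * star D = star T := by rw [← star_mul, e1]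
        calc T * star T = D * T * (star T * star D) := by rw [e1, e2]
          _ = _ := by simp only [mul_assoc]
      have h4 : T * star T ≤ algebraMap ℝ A (ε * ε) := by
        rw [← CStarAlgebra.norm_le_iff_le_algebraMap _ (by positivity) (mul_star_self_nonneg T),
          CStarRing.norm_self_mul_star]
        gcongr
      rw [e]
      refine (star_right_conjugate_le_conjugate h4 D).trans (le_of_eq ?_)
      rw [sD, Algebra.algebraMap_eq_smul_one, mul_smul_comm, mul_one, smul_mul_assoc,
        F.diff_mul_self]
    have : (S + T) * (star S + star T) = S * star S + T * star T := by
      rw [add_mul, mul_add, mul_add, h2, h3, add_zero, zero_add]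
    rw [this]
    refine (add_le_add ih hTT).trans (le_of_eq ?_)
    rw [← smul_add, hD, add_sub_cancel]

theorem norm_sub_pinch_le (F : Flag m G) {B : A} (hB : IsSelfAdjoint B) {ε₁ ε₂ : ℝ}
    (h₁ : ∀ k, ‖G k * B * (1 - G k)‖ ≤ ε₁) (h₂ : ∀ k, ‖G k * B * (1 - G (k + 1))‖ ≤ ε₂) :
    ‖B - pinch m G B‖ ≤ 2 * (ε₁ + (m + 1) * ε₂) := by
  have hε : 0 ≤ ε₁ := (norm_nonneg _).trans (h₁ 0)
  have key : ‖∑ k ∈ Finset.range (m + 1), (G (k + 1) - G k) * B * (1 - G (k + 1))‖ ≤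
      ε₁ + (m + 1) * ε₂ := by
    have e : ∑ k ∈ Finset.range (m + 1), (G (k + 1) - G k) * B * (1 - G (k + 1)) =
        (∑ k ∈ Finset.range (m + 1), (G (k + 1) - G k) * B * (G (k + 2) - G (k + 1))) +
        ∑ k ∈ Finset.range (m + 1), (G (k + 1) - G k) * B * (1 - G (k + 2)) := by
      rw [← Finset.sum_add_distrib]
      refine Finset.sum_congr rfl fun k _ => ?_
      rw [← mul_add]; congr 1; abel
    rw [e]
    refine (norm_add_le _ _).trans (add_le_add ?_ ?_)
    · have h := F.near_le h₁ (m + 1)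
      rw [F.one (m + 1) (by lia), ← Algebra.algebraMap_eq_smul_one,
        ← CStarAlgebra.norm_le_iff_le_algebraMap _ (by positivity) (mul_star_self_nonneg _),
        CStarRing.norm_self_mul_star] at h
      exact abs_le_of_sq_le_sq' (by nlinarith) hε |>.2
    · refine (norm_sum_le _ _).trans ?_
      refine (Finset.sum_le_card_nsmul _ _ ε₂ fun k _ => ?_).trans (by simp)
      have e1 : (G (k + 1) - G k) * B * (1 - G (k + 2)) =
          (G (k + 1) - G k) * (G (k + 1) * B * (1 - G (k + 2))) := by
        rw [← mul_assoc, ← mul_assoc, (F.diff_mul_of_lt k (k + 1) (by lia)).1]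
      rw [e1]
      calc _ ≤ ‖G (k + 1) - G k‖ * ‖G (k + 1) * B * (1 - G (k + 2))‖ := norm_mul_le _ _
        _ ≤ 1 * ε₂ := by
          gcongr
          · exact F.norm_diff_le k
          · exact h₂ (k + 1)
        _ = ε₂ := one_mul _
  rw [F.sub_pinch hB]
  refine (norm_add_le _ _).trans ?_
  rw [norm_star]
  linarith

end Flag
end Pinching

section Chain

variable {A : Type} [CStarAlgebra A] [FiniteDimensional ℂ A]

/-- The indicator function of `(-∞, s)`. -/
def stepBelow (s t : ℝ) : ℝ := if t < s then 1 else 0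

/-- The spectral projection of `Y` for `(-∞, s)`. -/
def below (Y : A) (s : ℝ) : A := cfc (stepBelow s) Y

/-- The smoothed sign of `Y - s`. -/
def signAt (Y : A) (s : ℝ) : A := cfc (fun t => signStep (t - s)) Y

variable {Y : A}

theorem sa_below (s : ℝ) : IsSelfAdjoint (below Y s) := cfc_predicate _ Y

theorem one_sub_below (hY : IsSelfAdjoint Y) (s : ℝ) :
    1 - below Y s = cfc (fun t => 1 - stepBelow s t) Y := by
  rw [← rcfc_sub (fun _ => 1), cfc_const_one ℝ Y]; rfl

theorem signAt_mul_below {r s : ℝ} (h : r + 1 / 4 ≤ s) :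
    signAt Y s * below Y r = -below Y r := by
  rw [signAt, below, rcfc_mul, ← cfc_neg]
  refine cfc_congr fun t _ => ?_
  simp only [stepBelow]
  split_ifs with ht
  · rw [signStep_of_le (by linarith)]; norm_num
  · simp

theorem signAt_mul_one_sub_below (hY : IsSelfAdjoint Y) {r s : ℝ} (h : s + 1 / 4 ≤ r) :
    signAt Y s * (1 - below Y r) = 1 - below Y r := by
  rw [one_sub_below hY, signAt, rcfc_mul]
  refine cfc_congr fun t _ => ?_
  simp only [stepBelow]
  split_ifs with ht
  · simp
  · rw [signStep_of_ge (by linarith)]; norm_num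

theorem signAt_eq_one (hY : IsSelfAdjoint Y) {s : ℝ} (h : ∀ t ∈ spectrum ℝ Y, s + 1 / 4 ≤ t) :
    signAt Y s = 1 := by
  rw [← cfc_const_one ℝ Y]
  exact cfc_congr fun t ht => signStep_of_ge (by linarith [h t ht])

theorem signAt_eq_neg_one (hY : IsSelfAdjoint Y) {s : ℝ}
    (h : ∀ t ∈ spectrum ℝ Y, t + 1 / 4 ≤ s) : signAt Y s = -1 := by
  rw [← cfc_const_one ℝ Y, ← cfc_neg]
  exact cfc_congr fun t ht => signStep_of_le (by linarith [h t ht])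

theorem norm_signAt_le (s : ℝ) : ‖signAt Y s‖ ≤ 1 :=
  norm_cfc_le zero_le_one fun _ _ => abs_signStep_le _

theorem sa_signAt (s : ℝ) : IsSelfAdjoint (signAt Y s) := cfc_predicate _ Y

theorem signAt_comm : ∃ K : ℝ, 0 ≤ K ∧ ∀ (A : Type) [CStarAlgebra A] [FiniteDimensional ℂ A]
    (Y x : A) (s : ℝ), IsSelfAdjoint Y →
    ‖x * signAt Y s - signAt Y s * x‖ ≤ K * ‖x * Y - Y * x‖ := by
  obtain ⟨K, hK, h⟩ := opLip_signStep.exists_const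
  refine ⟨K, hK, fun A _ _ Y x s hY => ?_⟩
  have hs : IsSelfAdjoint (Y - algebraMap ℝ A s) := hY.sub (.algebraMap A (.all s))
  have e : signAt Y s = cfc signStep (Y - algebraMap ℝ A s) := by
    have : Y - algebraMap ℝ A s = cfc (fun t : ℝ => t - s) Y := by
      rw [← rcfc_sub (fun t => t) (fun _ => s), rcfc_id hY, cfc_const s Y]
    rw [this, ← cfc_comp signStep (fun t : ℝ => t - s) Y hY
      (((finite_spectrum_real Y).image _).continuousOn _) (continuousOn_spectrum_real _ _)]
    rfl
  have := h A (Y - algebraMap ℝ A s) x hs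
  rw [← e, mul_sub, sub_mul, Algebra.commutes s x, sub_sub_sub_cancel_right] at this
  exact this

/-- A flag of projections sandwiched between the spectral projections of `Y`. -/
structure Chain (m : ℕ) (Y : A) (G : ℕ → A) : Prop extends Flag m G where
  mul_below : ∀ k : ℕ, G k * below Y (k + 1 / 2) = G k
  succ_mul_below : ∀ k : ℕ, G (k + 1) * below Y (k + 1 / 2) = below Y (k + 1 / 2)

theorem chain_of_signAt (hY : IsSelfAdjoint Y) {m : ℕ}
    (hs : ∀ t ∈ spectrum ℝ Y, 1 / 2 ≤ t ∧ t ≤ m + 1 / 2) {G : ℕ → A}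
    (sG : ∀ k, IsSelfAdjoint (G k)) (GG : ∀ k, G k * G k = G k)
    (h₁ : ∀ (k : ℕ) e, signAt Y k * e = -e → G k * e = e)
    (h₂ : ∀ (k : ℕ) e, signAt Y k * e = e → G k * e = 0) : Chain m Y G := by
  have a1 : ∀ k : ℕ, G k * below Y (k + 1 / 2) = G k := fun k => by
    have := h₂ k _ (signAt_mul_one_sub_below hY (r := k + 1 / 2) (by linarith))
    rw [mul_sub, mul_one, sub_eq_zero] at this
    exact this.symm
  have a2 : ∀ k l : ℕ, k < l → G l * below Y (k + 1 / 2) = below Y (k + 1 / 2) := fun k l h => by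
    have : (k : ℝ) + 1 ≤ l := by exact_mod_cast h
    exact h₁ l _ (signAt_mul_below (by linarith))
  refine ⟨⟨sG, fun k l h => ?_, ?_, fun k hk => ?_⟩, a1, fun k => a2 k _ (Nat.lt_succ_self k)⟩
  · rcases h.eq_or_lt with rfl | h
    · exact GG k
    · have e : below Y (k + 1 / 2) * G l = below Y (k + 1 / 2) := by
        have := congrArg star (a2 k l h)
        rwa [star_mul, (sG l).star_eq, (sa_below _).star_eq] at this
      rw [← a1 k, mul_assoc, e]
  · have := h₂ 0 1 (by
      rw [mul_one]; exact signAt_eq_one hY fun t ht => by have := (hs t ht).1; simp; linarith)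
    rwa [mul_one] at this
  · have hk' : (m : ℝ) + 1 ≤ k := by exact_mod_cast hk
    have := h₁ k 1 (by
      rw [mul_one]; exact signAt_eq_neg_one hY fun t ht => by have := (hs t ht).2; linarith)
    rwa [mul_one] at this

theorem Chain.commute_of_ne {m : ℕ} {G : ℕ → A} (F : Chain m Y G) (hY : IsSelfAdjoint Y)
    {κ : A} {l : ℕ} (sκ : IsSelfAdjoint κ) (h₁ : ∀ e, signAt Y l * e = -e → κ * e = 0)
    (h₂ : ∀ e, signAt Y l * e = e → κ * e = 0) {k : ℕ} (hk : k ≠ l) : Commute (G k) κ := by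
  have sb := fun s => (sa_below (Y := Y) s).star_eq
  rcases hk.lt_or_gt with h | h
  · have hl : (k : ℝ) + 1 ≤ l := by exact_mod_cast h
    have e1 : κ * below Y (k + 1 / 2) = 0 := h₁ _ (signAt_mul_below (by linarith))
    have e2 : G k = below Y (k + 1 / 2) * G k := by
      have := congrArg star (F.mul_below k)
      rw [star_mul, sb, (F.sa k).star_eq] at this
      exact this.symm
    have e3 : κ * G k = 0 := by rw [e2, ← mul_assoc, e1, zero_mul]
    have e4 := congrArg star e3
    rw [star_mul, sκ.star_eq, (F.sa k).star_eq, star_zero] at e4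
    rw [commute_iff_eq, e3, e4]
  · obtain ⟨j, rfl⟩ : ∃ j, k = j + 1 := ⟨k - 1, by lia⟩
    have hl : (l : ℝ) ≤ j := by exact_mod_cast Nat.lt_succ_iff.1 h
    have e1 : κ * (1 - below Y (j + 1 / 2)) = 0 :=
      h₂ _ (signAt_mul_one_sub_below hY (by linarith))
    rw [mul_sub, mul_one, sub_eq_zero] at e1
    have e2 : below Y (j + 1 / 2) * G (j + 1) = below Y (j + 1 / 2) := by
      have := congrArg star (F.succ_mul_below j)
      rwa [star_mul, sb, (F.sa _).star_eq] at this
    have e3 : κ * G (j + 1) = κ := by rw [e1, mul_assoc, e2]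
    have e4 := congrArg star e3
    rw [star_mul, sκ.star_eq, (F.sa _).star_eq] at e4
    rw [commute_iff_eq, e3, e4]

theorem count_le (m : ℕ) {t : ℝ} (ht : 1 / 2 ≤ t) :
    ∑ k ∈ Finset.range m, (1 - stepBelow (k + 1 / 2) t) ≤ min (t + 1 / 2) m := by
  induction m with
  | zero => simp; linarith
  | succ m ih =>
    rw [Finset.sum_range_succ]
    have h1 := ih.trans (min_le_left _ _)
    have h2 := ih.trans (min_le_right _ _)
    push_cast
    unfold stepBelow at *
    refine le_min ?_ ?_ <;> split_ifs <;> linarith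

theorem le_count (m : ℕ) (t : ℝ) :
    min (t - 3 / 2) m ≤ ∑ k ∈ Finset.range m, (1 - stepBelow ((k + 1 : ℕ) + 1 / 2) t) := by
  induction m with
  | zero => simp
  | succ m ih =>
    rw [Finset.sum_range_succ]
    push_cast at ih ⊢
    unfold stepBelow at *
    split_ifs with h
    · rw [min_eq_left (by linarith)] at ih
      exact (min_le_left _ _).trans (by linarith)
    · rw [min_eq_right (by linarith)] at ih
      exact (min_le_right _ _).trans (by linarith)

variable [PartialOrder A] [StarOrderedRing A]

theorem norm_le_of_mem_Icc {x : A} {r : ℝ} (hr : 0 ≤ r) (h : IsSelfAdjoint x)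
    (h₁ : algebraMap ℝ A (-r) ≤ x) (h₂ : x ≤ algebraMap ℝ A r) : ‖x‖ ≤ r := by
  have a1 := (algebraMap_le_iff_le_spectrum (a := x)).1 h₁
  have a2 := (le_algebraMap_iff_spectrum_le (a := x)).1 h₂
  rw [← rcfc_id h]
  exact norm_cfc_le hr fun t ht => abs_le.2 ⟨a1 t ht, a2 t ht⟩

theorem proj_le_of_mul_eq {p q : A} (hp : IsSelfAdjoint p) (hq : IsSelfAdjoint q)
    (hqq : q * q = q) (hpp : p * p = p) (h : p * q = p) : p ≤ q := by
  have h' : q * p = p := by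
    have := congrArg star h
    rwa [star_mul, hp.star_eq, hq.star_eq] at this
  rw [← sub_nonneg]
  have : q - p = star (q - p) * (q - p) := by
    rw [star_sub, hp.star_eq, hq.star_eq, mul_sub, sub_mul, sub_mul, hqq, h, h', hpp, sub_self,
      sub_zero]
  rw [this]; exact star_mul_self_nonneg _

theorem below_mul_self (s : ℝ) : below Y s * below Y s = below Y s := by
  rw [below, rcfc_mul]
  exact cfc_congr fun t _ => by simp [stepBelow]

theorem Chain.norm_sub_sum_le {m : ℕ} {G : ℕ → A} (F : Chain m Y G) (hY : IsSelfAdjoint Y)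
    (hs : ∀ t ∈ spectrum ℝ Y, 1 / 2 ≤ t ∧ t ≤ m + 1 / 2) :
    ‖Y - ∑ k ∈ Finset.range m, (1 - G (k + 1))‖ ≤ 3 / 2 := by
  set T := ∑ k ∈ Finset.range m, (1 - G (k + 1)) with hT
  have sT : IsSelfAdjoint T := by
    rw [isSelfAdjoint_iff, star_sum]
    exact Finset.sum_congr rfl fun k _ => ((IsSelfAdjoint.one A).sub (F.sa _)).star_eq
  have u : ∀ k, G k ≤ below Y (k + 1 / 2) := fun k =>
    proj_le_of_mul_eq (F.sa k) (sa_below _) (below_mul_self _) (F.mul _ _ le_rfl) (F.mul_below k)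
  have l : ∀ k : ℕ, below Y (k + 1 / 2) ≤ G (k + 1) := fun k =>
    proj_le_of_mul_eq (sa_below _) (F.sa _) (F.mul _ _ le_rfl) (below_mul_self _) (by
      have := congrArg star (F.succ_mul_below k)
      rwa [star_mul, (F.sa _).star_eq, (sa_below _).star_eq] at this)
  have e : ∀ g : ℕ → ℝ, ∑ k ∈ Finset.range m, (1 - below Y (g k)) =
      cfc (fun t => ∑ k ∈ Finset.range m, (1 - stepBelow (g k) t)) Y := fun g => by
    rw [show (fun t => ∑ k ∈ Finset.range m, (1 - stepBelow (g k) t)) =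
      ∑ k ∈ Finset.range m, (fun t => 1 - stepBelow (g k) t) by ext t; simp]
    rw [cfc_sum _ _ _ fun k _ => continuousOn_spectrum_real _ _]
    exact Finset.sum_congr rfl fun k _ => one_sub_below hY _
  have lower : cfc (fun t : ℝ => t - 3 / 2) Y ≤ T := by
    have : ∑ k ∈ Finset.range m, (1 - below Y ((k + 1 : ℕ) + 1 / 2)) ≤ T :=
      Finset.sum_le_sum fun k _ => sub_le_sub_left (u (k + 1)) 1
    rw [e fun k => ((k + 1 : ℕ) : ℝ) + 1 / 2] at this
    refine (rcfc_mono _ _ _ fun t ht => ?_).trans this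
    refine le_trans (le_of_eq ?_) (le_count m t)
    exact (min_eq_left (by have := (hs t ht).2; linarith)).symm
  have upper : T ≤ cfc (fun t : ℝ => t + 1 / 2) Y := by
    have : T ≤ ∑ k ∈ Finset.range m, (1 - below Y (k + 1 / 2)) :=
      Finset.sum_le_sum fun k _ => sub_le_sub_left (l k) 1
    rw [e fun k => (k : ℝ) + 1 / 2] at this
    exact this.trans (rcfc_mono _ _ _ fun t ht =>
      (count_le m (hs t ht).1).trans (min_le_left _ _))
  rw [← rcfc_sub (fun t => t) fun _ => 3 / 2, rcfc_id hY, cfc_const _ Y] at lower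
  rw [← rcfc_add (fun t => t) fun _ => 1 / 2, rcfc_id hY, cfc_const _ Y] at upper
  refine norm_le_of_mem_Icc (by norm_num) (hY.sub sT) ?_ (sub_le_comm.1 lower)
  refine le_trans ?_ (sub_le_sub_left upper Y)
  rw [sub_add_cancel_left, map_neg]
  exact neg_le_neg (algebraMap_mono A (by norm_num))

end Chain

section Core

theorem exists_chain : ∃ C : ℝ, 0 ≤ C ∧ ∀ (A : Type) [CStarAlgebra A]
    [FiniteDimensional ℂ A] [PartialOrder A] [StarOrderedRing A] (m : ℕ) (η : ℝ) (a Y : A), 0 < η →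
    IsSelfAdjoint a → ‖a‖ ≤ 1 → IsSelfAdjoint Y →
    (∀ t ∈ spectrum ℝ Y, 1 / 2 ≤ t ∧ t ≤ m + 1 / 2) → ‖a * Y - Y * a‖ ≤ η →
    ∃ G κ : ℕ → A, Chain m Y G ∧ (∀ k, IsSelfAdjoint (κ k)) ∧
      (∀ k l, k ≠ l → Commute (G k) (κ l)) ∧
      (∀ k, ‖G k * (cfc unitStep a + κ k) - (cfc unitStep a + κ k) * G k‖ ≤ C * η) ∧
      ∀ k e, a * e = e ∨ a * e = -e → ‖κ k * e‖ ≤ C * η * ‖e‖ := by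
  obtain ⟨C, hC, H⟩ := exists_almost_commuting_projection
  obtain ⟨K, hK, HK⟩ := signAt_comm
  refine ⟨C * (K + 1), by positivity, ?_⟩
  intro A _ _ _ _ m η a Y hη sa na sY hs hc
  have h : ∀ k : ℕ, ‖a * signAt Y k - signAt Y k * a‖ ≤ (K + 1) * η := fun k => by
    refine (HK A Y a k sY).trans ?_
    nlinarith [mul_le_mul_of_nonneg_left hc hK]
  choose G κ sG GG sκ h₁ h₂ h₃ h₄ using fun k : ℕ =>
    H A ((K + 1) * η) a (signAt Y k) (by positivity) sa (sa_signAt _) na (norm_signAt_le _) (h k)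
  have F : Chain m Y G := chain_of_signAt sY hs sG GG (fun k e he => (h₁ k e he).1)
    (fun k e he => (h₂ k e he).1)
  refine ⟨G, κ, F, sκ, fun k l hkl => F.commute_of_ne sY (sκ l) (fun e he => (h₁ l e he).2)
    (fun e he => (h₂ l e he).2) hkl, fun k => ?_, fun k e he => ?_⟩
  · rw [mul_assoc]; exact h₃ k
  · rw [mul_assoc C]; exact h₄ k e he

variable {A : Type} [CStarAlgebra A]

theorem norm_proj_mul_mul_one_sub_le {p x : A} (np : ‖p‖ ≤ 1) (pp : p * p = p) :
    ‖p * x * (1 - p)‖ ≤ ‖p * x - x * p‖ := by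
  have : p * x * (1 - p) = p * (p * x - x * p) := by
    rw [mul_sub, mul_sub, mul_one, ← mul_assoc p p, pp, mul_assoc]
  rw [this]
  exact (norm_mul_le _ _).trans (mul_le_of_le_one_left (norm_nonneg _) np)

theorem Flag.norm_far_le {m : ℕ} {G : ℕ → A} (F : Flag m G) (x : A) (k : ℕ) :
    ‖G k * x * (1 - G (k + 1))‖ ≤ ‖G k * x * (1 - G k)‖ := by
  have : (1 - G k) * (1 - G (k + 1)) = 1 - G (k + 1) := by
    rw [sub_mul, one_mul, mul_sub, mul_one, F.mul _ _ (Nat.le_succ k), sub_self, sub_zero]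
  rw [← this, ← mul_assoc]
  exact (norm_mul_le _ _).trans (mul_le_of_le_one_right (norm_nonneg _) (F.norm_one_sub_le _))

theorem norm_commutator_le {x y : A} {r s : ℝ} (hx : ‖x‖ ≤ r) (hy : ‖y‖ ≤ s) :
    ‖x * y - y * x‖ ≤ 2 * (r * s) := by
  have h1 : ‖x * y‖ ≤ r * s := (norm_mul_le _ _).trans (by
    gcongr; exact (norm_nonneg _).trans hx)
  have h2 : ‖y * x‖ ≤ s * r := (norm_mul_le _ _).trans (by
    gcongr; exact (norm_nonneg _).trans hy)
  have := norm_sub_le (x * y) (y * x)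
  linarith

/-- The indicator function of `(1/2, ∞)`. -/
def stepHalf (t : ℝ) : ℝ := if 1 / 2 < t then 1 else 0

variable [FiniteDimensional ℂ A]

theorem stepHalf_mul_self (x : A) : cfc stepHalf x * cfc stepHalf x = cfc stepHalf x := by
  rw [rcfc_mul]
  exact cfc_congr fun t _ => by simp [stepHalf]

theorem norm_one_sub_stepHalf_mul_le {x e : A} (hx : IsSelfAdjoint x) :
    ‖(1 - cfc stepHalf x) * e‖ ≤ 2 * ‖x * e - e‖ := by
  have h : 1 - cfc stepHalf x =
    cfc (fun t : ℝ => if 1 / 2 < t then 0 else (t - 1)⁻¹) x * (x - 1) := by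
    have h1 : x - 1 = cfc (fun t : ℝ => t - 1) x := by
      rw [← rcfc_sub (fun t => t), rcfc_id hx, cfc_const_one ℝ x]
    rw [h1, rcfc_mul, ← cfc_const_one ℝ x, rcfc_sub]
    refine cfc_congr fun t _ => ?_
    simp only [stepHalf]
    split_ifs with ht
    · simp
    · rw [inv_mul_cancel₀ (by linarith), sub_zero]
  rw [h, mul_assoc, sub_mul, one_mul]
  refine (norm_mul_le _ _).trans ?_
  gcongr
  refine norm_cfc_le (by norm_num) fun t _ => ?_
  split_ifs with ht
  · simp
  · rw [Real.norm_eq_abs, abs_inv, abs_of_nonpos (by linarith)]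
    exact inv_le_of_inv_le₀ (by norm_num) (by linarith)

theorem norm_stepHalf_mul_le {x e : A} (hx : IsSelfAdjoint x) :
    ‖cfc stepHalf x * e‖ ≤ 2 * ‖x * e‖ := by
  have h : cfc stepHalf x = cfc (fun t : ℝ => if 1 / 2 < t then t⁻¹ else 0) x * x := by
    conv_rhs => enter [2]; rw [← rcfc_id hx]
    rw [rcfc_mul]
    refine cfc_congr fun t _ => ?_
    simp only [stepHalf]
    split_ifs with ht
    · rw [inv_mul_cancel₀ (by linarith)]
    · simp
  rw [h, mul_assoc]
  refine (norm_mul_le _ _).trans ?_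
  gcongr
  refine norm_cfc_le (by norm_num) fun t _ => ?_
  split_ifs with ht
  · rw [Real.norm_eq_abs, abs_inv, abs_of_nonneg (by linarith)]
    exact inv_le_of_inv_le₀ (by norm_num) (by linarith)
  · simp

theorem norm_stepHalf_sub_le {x : A} (hx : IsSelfAdjoint x) :
    ‖cfc stepHalf x - x‖ ≤ 2 * ‖x * x - x‖ := by
  have h1 : x * x - x = cfc (fun t : ℝ => t * t - t) x := by
    rw [← rcfc_sub (fun t => t * t) fun t => t, ← rcfc_mul (fun t => t), rcfc_id hx]
  have h : cfc stepHalf x - x =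
      cfc (fun t : ℝ => if 1 / 2 < t then -t⁻¹ else (1 - t)⁻¹) x * (x * x - x) := by
    rw [h1, rcfc_mul]
    conv_lhs => enter [2]; rw [← rcfc_id hx]
    rw [rcfc_sub]
    refine cfc_congr fun t _ => ?_
    simp only [stepHalf]
    split_ifs with ht
    · field_simp; ring
    · have : 1 - t ≠ 0 := by linarith
      field_simp; ring
  rw [h]
  refine (norm_mul_le _ _).trans ?_
  gcongr
  refine norm_cfc_le (by norm_num) fun t _ => ?_
  split_ifs with ht
  · rw [norm_neg, Real.norm_eq_abs, abs_inv, abs_of_nonneg (by linarith)]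
    exact inv_le_of_inv_le₀ (by norm_num) (by linarith)
  · rw [Real.norm_eq_abs, abs_inv, abs_of_nonneg (by linarith)]
    exact inv_le_of_inv_le₀ (by norm_num) (by linarith)

/-- A projection almost dominating `E₁` and almost orthogonal to `E₂` can be perturbed to do so
exactly. -/
theorem exists_proj_near {P E₁ E₂ : A} {d : ℝ} (sP : IsSelfAdjoint P) (PP : P * P = P)
    (s₁ : IsSelfAdjoint E₁) (s₂ : IsSelfAdjoint E₂) (e₁ : E₁ * E₁ = E₁) (e₂ : E₂ * E₂ = E₂)
    (e₁₂ : E₁ * E₂ = 0) (h₁ : ‖(1 - P) * E₁‖ ≤ d) (h₂ : ‖P * E₂‖ ≤ d) :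
    ∃ Q : A, IsSelfAdjoint Q ∧ Q * Q = Q ∧ Q * E₁ = E₁ ∧ Q * E₂ = 0 ∧ ‖Q - P‖ ≤ 36 * d := by
  have e₂₁ : E₂ * E₁ = 0 := by
    have := congrArg star e₁₂
    rwa [star_mul, s₁.star_eq, s₂.star_eq, star_zero] at this
  set M := 1 - E₁ - E₂ with hM
  have sM : IsSelfAdjoint M := ((IsSelfAdjoint.one A).sub s₁).sub s₂
  have M₁ : M * E₁ = 0 := by rw [hM, sub_mul, sub_mul, one_mul, e₁, e₂₁, sub_self, sub_zero]
  have M₂ : M * E₂ = 0 := by rw [hM, sub_mul, sub_mul, one_mul, e₁₂, e₂, sub_zero, sub_self]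
  have MM : M * M = M := by
    nth_rewrite 2 [hM]
    rw [mul_sub, mul_sub, mul_one, M₁, M₂, sub_zero, sub_zero]
  have nM : ‖M‖ ≤ 1 := norm_le_one_of_proj sM MM
  have nP : ‖P‖ ≤ 1 := norm_le_one_of_proj sP PP
  set T := E₁ + M * P * M with hT
  have sT : IsSelfAdjoint T := by
    refine s₁.add ?_
    have := sP.conjugate M
    rwa [sM.star_eq] at this
  have T₁ : T * E₁ = (1 : ℝ) • E₁ := by
    rw [hT, add_mul, e₁, mul_assoc, M₁, mul_zero, add_zero, one_smul]
  have T₂ : T * E₂ = (0 : ℝ) • E₂ := by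
    rw [hT, add_mul, e₁₂, mul_assoc, M₂, mul_zero, add_zero, zero_smul]
  have nT : ‖T‖ ≤ 2 := by
    have n₁ : ‖E₁‖ ≤ 1 := norm_le_one_of_proj s₁ e₁
    have n2 : ‖M * P * M‖ ≤ 1 := (norm_mul_le _ _).trans (mul_le_one₀ ((norm_mul_le _ _).trans
      (mul_le_one₀ nM (norm_nonneg _) nP)) (norm_nonneg _) nM)
    have := norm_add_le E₁ (M * P * M)
    linarith
  have key : T - P = star ((1 - P) * E₁) - star (P * E₂) +
      M * ((1 - P) * E₁ - P * E₂) := by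
    have a1 : M * ((1 - P) * E₁ - P * E₂) = M * P * M - M * P := by
      have : (1 - P) * E₁ - P * E₂ = P * M - P + E₁ := by rw [hM]; noncomm_ring
      rw [this, mul_add, M₁, add_zero, mul_sub, mul_assoc]
    rw [a1, star_mul, star_mul, star_sub, star_one, sP.star_eq, s₁.star_eq, s₂.star_eq, hT]
    have a2 : M * P = P - E₁ * P - E₂ * P := by rw [hM]; noncomm_ring
    have a3 : M * P * M - M * P = M * P * M - (P - E₁ * P - E₂ * P) := by rw [← a2]
    rw [a3, mul_sub E₁, mul_one]
    abel
  have nTP : ‖T - P‖ ≤ 4 * d := by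
    have b1 := norm_sub_le (star ((1 - P) * E₁)) (star (P * E₂))
    have b2 := norm_sub_le ((1 - P) * E₁) (P * E₂)
    rw [norm_star, norm_star] at b1
    have b3 : ‖M * ((1 - P) * E₁ - P * E₂)‖ ≤ ‖(1 - P) * E₁ - P * E₂‖ :=
      (norm_mul_le _ _).trans (mul_le_of_le_one_left (norm_nonneg _) nM)
    rw [key]
    have := norm_add_le (star ((1 - P) * E₁) - star (P * E₂)) (M * ((1 - P) * E₁ - P * E₂))
    linarith
  have nTT : ‖T * T - T‖ ≤ 16 * d := by
    have e : T * T - T = (T - P) * T + P * (T - P) - (T - P) := by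
      rw [sub_mul, mul_sub, PP]; abel
    rw [e]
    have b1 : ‖(T - P) * T‖ ≤ 4 * d * 2 := (norm_mul_le _ _).trans (by
      gcongr; exact (norm_nonneg _).trans nTP)
    have b2 : ‖P * (T - P)‖ ≤ 4 * d :=
      (norm_mul_le _ _).trans ((mul_le_of_le_one_left (norm_nonneg _) nP).trans nTP)
    have := norm_sub_le ((T - P) * T + P * (T - P)) (T - P)
    have := norm_add_le ((T - P) * T) (P * (T - P))
    linarith
  refine ⟨cfc stepHalf T, cfc_predicate _ T, stepHalf_mul_self T, ?_, ?_, ?_⟩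
  · rw [rcfc_mul_of_eigen _ sT T₁, stepHalf, if_pos (by norm_num), one_smul]
  · rw [rcfc_mul_of_eigen _ sT T₂, stepHalf, if_neg (by norm_num), zero_smul]
  · have b := norm_stepHalf_sub_le sT
    have := norm_add_le (cfc stepHalf T - T) (T - P)
    rw [sub_add_sub_cancel] at this
    linarith

theorem exists_cutting_projection : ∃ C : ℝ, 0 ≤ C ∧ ∀ (A : Type) [CStarAlgebra A]
    [FiniteDimensional ℂ A] [PartialOrder A] [StarOrderedRing A] (m : ℕ) (η : ℝ) (a Y : A), 0 < η →
    IsSelfAdjoint a → ‖a‖ ≤ 1 → IsSelfAdjoint Y →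
    (∀ t ∈ spectrum ℝ Y, 1 / 2 ≤ t ∧ t ≤ m + 1 / 2) → ‖a * Y - Y * a‖ ≤ η →
    ∃ Q : A, IsSelfAdjoint Q ∧ Q * Q = Q ∧ (∀ e, a * e = -e → Q * e = e) ∧
      (∀ e, a * e = e → Q * e = 0) ∧ ‖Q * Y - Y * Q‖ ≤ 3 + C * (m + 1) ^ 2 * η := by
  obtain ⟨C, hC, H⟩ := exists_chain
  refine ⟨720 * C, by positivity, ?_⟩
  intro A _ _ _ _ m η a Y hη sa na sY hs hc
  obtain ⟨G, κ, F, sκ, hκ, h₁, h₂⟩ := H A m η a Y hη sa na sY hs hc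
  set s := cfc unitStep a + ∑ l ∈ Finset.range (m + 1), κ l with hsdef
  have ss : IsSelfAdjoint s := by
    refine (cfc_predicate unitStep a : IsSelfAdjoint _).add ?_
    rw [isSelfAdjoint_iff, star_sum]
    exact Finset.sum_congr rfl fun k _ => (sκ k).star_eq
  have hGs : ∀ k, ‖G k * s - s * G k‖ ≤ C * η := fun k => by
    by_cases hk : k < m + 1
    · have e : G k * s - s * G k =
          G k * (cfc unitStep a + κ k) - (cfc unitStep a + κ k) * G k := by
        rw [hsdef, ← Finset.add_sum_erase _ _ (Finset.mem_range.2 hk), ← add_assoc, mul_add,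
          add_mul]
        have : Commute (G k) (∑ l ∈ (Finset.range (m + 1)).erase k, κ l) :=
          Commute.sum_right _ _ _ fun l hl => hκ k l (Finset.ne_of_mem_erase hl).symm
        rw [this.eq, add_sub_add_right_eq_sub]
      rw [e]; exact h₁ k
    · rw [F.one k (by lia), one_mul, mul_one, sub_self, norm_zero]; positivity
  have near : ∀ k, ‖G k * s * (1 - G k)‖ ≤ C * η := fun k =>
    (norm_proj_mul_mul_one_sub_le (F.norm_le k) (F.mul k k le_rfl)).trans (hGs k)
  set s' := pinch m G s with hs'
  have ss' : IsSelfAdjoint s' := F.sa_pinch ss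
  have nss : ‖s - s'‖ ≤ 2 * (C * η + (m + 1) * (C * η)) :=
    F.norm_sub_pinch_le ss near fun k => (F.norm_far_le s k).trans (near k)
  have hκe : ∀ e, a * e = e ∨ a * e = -e →
      ‖s' * e - cfc unitStep a * e‖ ≤ 5 * (m + 1) * (C * η) * ‖e‖ := by
    intro e he
    have e1 : s' * e - cfc unitStep a * e =
        (∑ l ∈ Finset.range (m + 1), κ l * e) - (s - s') * e := by
      rw [← Finset.sum_mul, hsdef]; noncomm_ring
    have b1 : ‖∑ l ∈ Finset.range (m + 1), κ l * e‖ ≤ (m + 1) * (C * η * ‖e‖) :=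
      (norm_sum_le _ _).trans
        ((Finset.sum_le_card_nsmul _ _ _ fun k _ => h₂ k e he).trans (by simp))
    have b2 : ‖(s - s') * e‖ ≤ 2 * (C * η + (m + 1) * (C * η)) * ‖e‖ :=
      (norm_mul_le _ _).trans (by gcongr)
    have b3 : 0 ≤ (m : ℝ) * (C * η * ‖e‖) := by positivity
    rw [e1]
    refine (norm_sub_le _ _).trans ((add_le_add b1 b2).trans ?_)
    nlinarith
  set P := cfc stepHalf s' with hP
  have sP : IsSelfAdjoint P := cfc_predicate _ s'
  have PP : P * P = P := stepHalf_mul_self s'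
  set E₁ := cfc (fun t : ℝ => if t = 1 then 1 else 0) a with hE₁
  set E₂ := cfc (fun t : ℝ => if t = -1 then 1 else 0) a with hE₂
  have s₁ : IsSelfAdjoint E₁ := cfc_predicate _ a
  have s₂ : IsSelfAdjoint E₂ := cfc_predicate _ a
  have e₁ : E₁ * E₁ = E₁ := by
    rw [hE₁, rcfc_mul]; exact cfc_congr fun t _ => by simp
  have e₂ : E₂ * E₂ = E₂ := by
    rw [hE₂, rcfc_mul]; exact cfc_congr fun t _ => by simp
  have e₁₂ : E₁ * E₂ = 0 := by
    rw [hE₁, hE₂, rcfc_mul, ← cfc_zero ℝ a]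
    refine cfc_congr fun t _ => ?_
    by_cases h : t = 1
    · simp [h]; norm_num
    · simp [h]
  have a₁ : a * E₁ = E₁ := by
    conv_lhs => enter [1]; rw [← rcfc_id sa]
    rw [hE₁, rcfc_mul]
    refine cfc_congr fun t _ => ?_
    by_cases h : t = 1 <;> simp [h]
  have a₂ : a * E₂ = -E₂ := by
    conv_lhs => enter [1]; rw [← rcfc_id sa]
    rw [hE₂, rcfc_mul, ← cfc_neg]
    refine cfc_congr fun t _ => ?_
    by_cases h : t = -1 <;> simp [h]
  have f₁ : cfc unitStep a * E₁ = E₁ := by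
    rw [rcfc_mul_of_eigen unitStep sa (r := 1) (by simpa using a₁),
      unitStep_of_ge (by norm_num), one_smul]
  have f₂ : cfc unitStep a * E₂ = 0 := by
    rw [rcfc_mul_of_eigen unitStep sa (r := -1) (by simpa using a₂),
      unitStep_of_le (by norm_num), zero_smul]
  have n₁ := norm_le_one_of_proj s₁ e₁
  have n₂ := norm_le_one_of_proj s₂ e₂
  have hd : 0 ≤ 5 * (m + 1) * (C * η) := by positivity
  have d₁ : ‖(1 - P) * E₁‖ ≤ 2 * (5 * (m + 1) * (C * η)) := by
    refine (norm_one_sub_stepHalf_mul_le ss').trans ?_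
    have := hκe E₁ (.inl a₁)
    rw [f₁] at this
    nlinarith
  have d₂ : ‖P * E₂‖ ≤ 2 * (5 * (m + 1) * (C * η)) := by
    refine (norm_stepHalf_mul_le ss').trans ?_
    have := hκe E₂ (.inr a₂)
    rw [f₂, sub_zero] at this
    nlinarith
  obtain ⟨Q, sQ, QQ, Q₁, Q₂, hQ⟩ := exists_proj_near sP PP s₁ s₂ e₁ e₂ e₁₂ d₁ d₂
  refine ⟨1 - Q, (IsSelfAdjoint.one A).sub sQ, by simp [sub_mul, mul_sub, QQ], fun e he => ?_,
    fun e he => ?_, ?_⟩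
  · have : E₂ * e = e := by
      rw [hE₂, rcfc_mul_of_eigen _ sa (r := -1) (by simpa using he)]; simp
    rw [← this, ← mul_assoc, sub_mul, Q₂, one_mul, sub_zero]
  · have : E₁ * e = e := by
      rw [hE₁, rcfc_mul_of_eigen _ sa (r := 1) (by simpa using he)]; simp
    rw [← this, ← mul_assoc, sub_mul, Q₁, one_mul, sub_self, zero_mul]
  · set S := ∑ k ∈ Finset.range m, (1 - G (k + 1)) with hS
    have hYS : ‖Y - S‖ ≤ 3 / 2 := F.norm_sub_sum_le sY hs
    have cPS : Commute P S := by
      refine Commute.sum_right _ _ _ fun k _ => (Commute.one_right _).sub_right ?_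
      exact (Commute.cfc_real (F.pinch_commute s (k + 1)).symm stepHalf)
    have nP := norm_le_one_of_proj sP PP
    have nY : ‖Y‖ ≤ m + 1 := by
      rw [← rcfc_id sY]
      refine norm_cfc_le (by positivity) fun t ht => abs_le.2 ?_
      have := hs t ht
      constructor <;> linarith
    have e : (1 - Q) * Y - Y * (1 - Q) =
        -((P * (Y - S) - (Y - S) * P) + ((Q - P) * Y - Y * (Q - P))) := by
      have := cPS.eq
      simp only [sub_mul, mul_sub, one_mul, mul_one, this]
      abel
    rw [e, norm_neg]
    refine (norm_add_le _ _).trans ((add_le_add (norm_commutator_le nP hYS)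
      (norm_commutator_le hQ nY)).trans (le_of_eq ?_))
    ring

end Core

section Outer

section

variable {A : Type} [CStarAlgebra A] [FiniteDimensional ℂ A] [PartialOrder A] [StarOrderedRing A]

theorem norm_below_mul_mul_le {x : A} (hx : IsSelfAdjoint x) (y : A) {r s : ℝ} (hrs : r < s) :
    (s - r) * ‖below x r * y * (1 - below x s)‖ ≤ ‖x * y - y * x‖ := by
  have h := sylvester (W := below x r * y * (1 - below x s)) hrs
    (cfc_predicate (fun t => min t r) x) (cfc_predicate (fun t => max t s) x)
    (rcfc_le_algebraMap _ x (fun t _ => min_le_right t r) hx)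
    (algebraMap_le_rcfc _ x (fun t _ => le_max_right t s) hx)
  have e1 : cfc (fun t => min t r) x * below x r = below x r * x := by
    conv_rhs => enter [2]; rw [← rcfc_id hx]
    rw [below, rcfc_mul, rcfc_mul]
    refine cfc_congr fun t _ => ?_
    simp only [stepBelow]
    split_ifs with ht
    · rw [min_eq_left ht.le, mul_comm]
    · simp
  have e2 : (1 - below x s) * cfc (fun t => max t s) x = x * (1 - below x s) := by
    conv_rhs => enter [1]; rw [← rcfc_id hx]
    rw [one_sub_below hx, rcfc_mul, rcfc_mul]
    refine cfc_congr fun t _ => ?_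
    simp only [stepBelow]
    split_ifs with ht
    · simp
    · rw [max_eq_left (not_lt.1 ht), mul_comm]
  have e : cfc (fun t => min t r) x * (below x r * y * (1 - below x s)) -
      below x r * y * (1 - below x s) * cfc (fun t => max t s) x =
      below x r * (x * y - y * x) * (1 - below x s) := by
    rw [mul_assoc _ _ (cfc _ x), e2, mul_assoc (below x r), ← mul_assoc (cfc _ x), e1]
    noncomm_ring
  rw [e] at h
  have n1 : ‖below x r‖ ≤ 1 := norm_le_one_of_proj (sa_below r) (below_mul_self r)
  have n2 : ‖1 - below x s‖ ≤ 1 := norm_le_one_of_proj ((IsSelfAdjoint.one A).sub (sa_below s)) (by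
    rw [mul_sub, mul_one, sub_mul, one_mul, below_mul_self, sub_self, sub_zero])
  refine h.trans ((norm_mul_le _ _).trans ((mul_le_of_le_one_right (norm_nonneg _) n2).trans
    ((norm_mul_le _ _).trans (mul_le_of_le_one_left (norm_nonneg _) n1))))

theorem norm_cut_far_le {x p q : A} (hx : IsSelfAdjoint x) (y : A) {s : ℝ}
    (sp : IsSelfAdjoint p) (pp : p * p = p) (sq : IsSelfAdjoint q) (qq : q * q = q)
    (hp : p * (1 - below x (s + 1 / 4)) = 0) (hq : q * below x (s + 3 / 4) = below x (s + 3 / 4)) :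
    ‖p * y * (1 - q)‖ ≤ 2 * ‖x * y - y * x‖ := by
  have h := norm_below_mul_mul_le hx y (show s + 1 / 4 < s + 3 / 4 by linarith)
  rw [show s + 3 / 4 - (s + 1 / 4) = 1 / 2 by ring] at h
  have e1 : p = p * below x (s + 1 / 4) := by
    rw [mul_sub, mul_one, sub_eq_zero] at hp
    exact hp
  have e2 : 1 - q = (1 - below x (s + 3 / 4)) * (1 - q) := by
    have := congrArg star hq
    rw [star_mul, sq.star_eq, (sa_below (Y := x) _).star_eq] at this
    rw [sub_mul, mul_sub (below _ _), this, mul_one, sub_self, sub_zero, one_mul]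
  have e : p * y * (1 - q) =
      p * (below x (s + 1 / 4) * y * (1 - below x (s + 3 / 4))) * (1 - q) := by
    conv_lhs => rw [e1, e2]
    noncomm_ring
  have n1 : ‖p‖ ≤ 1 := norm_le_one_of_proj sp pp
  have n2 : ‖1 - q‖ ≤ 1 := norm_le_one_of_proj ((IsSelfAdjoint.one A).sub sq) (by
    rw [mul_sub, mul_one, sub_mul, one_mul, qq, sub_self, sub_zero])
  rw [e]
  refine ((norm_mul_le _ _).trans ((mul_le_of_le_one_right (norm_nonneg _) n2).trans
    ((norm_mul_le _ _).trans (mul_le_of_le_one_left (norm_nonneg _) n1)))).trans ?_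
  linarith

end

/-- Almost commuting self-adjoint elements with spectra in a long interval are at bounded distance
from commuting ones. -/
theorem exists_commuting_near : ∃ C : ℝ, 0 ≤ C ∧ ∀ (A : Type) [CStarAlgebra A]
    [FiniteDimensional ℂ A] [PartialOrder A] [StarOrderedRing A] (m : ℕ) (η : ℝ) (x y : A), 0 < η →
    IsSelfAdjoint x → IsSelfAdjoint y →
    (∀ t ∈ spectrum ℝ x, 1 / 2 ≤ t ∧ t ≤ m + 1 / 2) →
    (∀ t ∈ spectrum ℝ y, 1 / 2 ≤ t ∧ t ≤ m + 1 / 2) → ‖x * y - y * x‖ ≤ η →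
    ∃ x' y' : A, IsSelfAdjoint x' ∧ IsSelfAdjoint y' ∧ Commute x' y' ∧ ‖x - x'‖ ≤ 3 / 2 ∧
      ‖y - y'‖ ≤ 6 + C * (m + 1) ^ 2 * η := by
  obtain ⟨C, hC, H⟩ := exists_cutting_projection
  obtain ⟨K, hK, HK⟩ := signAt_comm
  refine ⟨2 * (C * (K + 1)) + 4, by positivity, ?_⟩
  intro A _ _ _ _ m η x y hη sx sy hsx hsy hc
  have h : ∀ k : ℕ, ‖signAt x k * y - y * signAt x k‖ ≤ (K + 1) * η := fun k => by
    rw [norm_sub_rev]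
    refine (HK A x y k sx).trans ?_
    rw [norm_sub_rev]
    nlinarith [mul_le_mul_of_nonneg_left hc hK]
  choose P sP PP h₁ h₂ h₃ using fun k : ℕ =>
    H A m ((K + 1) * η) (signAt x k) y (by positivity) (sa_signAt _) (norm_signAt_le _) sy hsy (h k)
  have F : Chain m x P := chain_of_signAt sx hsx sP PP h₁ h₂
  refine ⟨∑ k ∈ Finset.range m, (1 - P (k + 1)), pinch m P y, ?_, F.sa_pinch sy, ?_,
    F.norm_sub_sum_le sx hsx, ?_⟩
  · rw [isSelfAdjoint_iff, star_sum]
    exact Finset.sum_congr rfl fun k _ => ((IsSelfAdjoint.one A).sub (sP _)).star_eq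
  · exact Commute.sum_left _ _ _ fun k _ =>
      (Commute.one_left _).sub_left (F.pinch_commute y (k + 1))
  · have near : ∀ k, ‖P k * y * (1 - P k)‖ ≤ 3 + C * (m + 1) ^ 2 * ((K + 1) * η) := fun k =>
      (norm_proj_mul_mul_one_sub_le (F.norm_le k) (PP k)).trans (h₃ k)
    have far : ∀ k, ‖P k * y * (1 - P (k + 1))‖ ≤ 2 * η := fun k => by
      refine (norm_cut_far_le sx y (s := k) (sP k) (PP k) (sP _) (PP _) ?_ ?_).trans (by linarith)
      · exact h₂ k _ (signAt_mul_one_sub_below sx le_rfl)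
      · refine h₁ (k + 1) _ (signAt_mul_below ?_)
        push_cast
        linarith
    refine (F.norm_sub_pinch_le sy near far).trans ?_
    have : (m + 1 : ℝ) * η ≤ (m + 1) ^ 2 * η := by
      have : (0 : ℝ) ≤ m := m.cast_nonneg
      gcongr
      nlinarith
    nlinarith

end Outer

section Normal

section

variable {A : Type} [CStarAlgebra A]

theorem exists_normal_contraction_near {X Z : A} {d : ℝ} (hX : ‖X‖ ≤ 1)
    (hZ : star Z * Z = Z * star Z) (h : ‖X - Z‖ ≤ d) :
    ∃ Y : A, star Y * Y = Y * star Y ∧ ‖Y‖ ≤ 1 ∧ ‖X - Y‖ ≤ 2 * d := by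
  have hd : 0 ≤ d := (norm_nonneg _).trans h
  by_cases hn : ‖Z‖ ≤ 1
  · exact ⟨Z, hZ, hn, by linarith⟩
  · have hn : 1 < ‖Z‖ := not_le.1 hn
    have hn0 : 0 < ‖Z‖ := by linarith
    have hi : ‖Z‖⁻¹ ≤ 1 := inv_le_one_of_one_le₀ hn.le
    refine ⟨‖Z‖⁻¹ • Z, by simp [star_smul, hZ], ?_, ?_⟩
    · rw [norm_smul, norm_inv, norm_norm, inv_mul_cancel₀ hn0.ne']
    · have e : X - ‖Z‖⁻¹ • Z = (X - Z) + (1 - ‖Z‖⁻¹) • Z := by rw [sub_smul, one_smul]; abel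
      have b : ‖(1 - ‖Z‖⁻¹) • Z‖ = ‖Z‖ - 1 := by
        rw [norm_smul, Real.norm_of_nonneg (by linarith), sub_mul, one_mul,
          inv_mul_cancel₀ hn0.ne']
      have b2 := norm_sub_norm_le Z X
      rw [norm_sub_rev] at b2
      rw [e]
      have := norm_add_le (X - Z) ((1 - ‖Z‖⁻¹) • Z)
      linarith

theorem star_mul_sub_mul_star_eq {a b : A} (ha : IsSelfAdjoint a) (hb : IsSelfAdjoint b) :
    star (a + Complex.I • b) * (a + Complex.I • b) - (a + Complex.I • b) * star (a + Complex.I • b)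
      = (2 * Complex.I) • (a * b - b * a) := by
  rw [star_add, star_smul, ha.star_eq, hb.star_eq]
  simp only [Complex.star_def, Complex.conj_I, add_mul, mul_add, smul_mul_assoc, mul_smul_comm,
    smul_smul, smul_sub, smul_add, neg_smul, neg_mul, mul_neg, smul_neg, Complex.I_mul_I]
  rw [mul_comm 2 Complex.I, mul_two, add_smul, add_smul]
  abel

variable [FiniteDimensional ℂ A]

theorem spectrum_scale {a : A} (sa : IsSelfAdjoint a) (ha : ‖a‖ ≤ 1) {m : ℝ} (hm : 0 ≤ m) {t : ℝ}
    (ht : t ∈ spectrum ℝ ((m / 2) • a + algebraMap ℝ A (m / 2 + 1 / 2))) :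
    1 / 2 ≤ t ∧ t ≤ m + 1 / 2 := by
  have e : (m / 2) • a + algebraMap ℝ A (m / 2 + 1 / 2) =
      cfc (fun t : ℝ => m / 2 * t + (m / 2 + 1 / 2)) a := by
    rw [← rcfc_add (fun t => m / 2 * t), cfc_const _ a, cfc_const_mul _ _ a
      (continuousOn_spectrum_real _ _), rcfc_id sa]
  rw [e, cfc_map_spectrum _ a sa (continuousOn_spectrum_real _ _)] at ht
  obtain ⟨u, hu, rfl⟩ := ht
  have := mem_Icc_of_norm_le_one ha hu
  constructor <;> nlinarith [this.1, this.2]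

end

theorem exists_normal_near : ∃ C : ℝ, 1 ≤ C ∧ ∀ (A : Type) [CStarAlgebra A]
    [FiniteDimensional ℂ A] [PartialOrder A] [StarOrderedRing A] (δ : ℝ) (X : A), 0 < δ →
    ‖X‖ ≤ 1 → ‖star X * X - X * star X‖ ≤ δ →
    ∃ Y : A, star Y * Y = Y * star Y ∧ ‖Y‖ ≤ 1 ∧ ‖X - Y‖ ≤ C * δ ^ (1 / 4 : ℝ) := by
  obtain ⟨C, hC, H⟩ := exists_commuting_near
  refine ⟨30 + 144 * C, by linarith, ?_⟩
  intro A _ _ _ _ δ X hδ hX hc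
  set q := δ ^ (1 / 4 : ℝ) with hq
  have q0 : 0 < q := Real.rpow_pos_of_pos hδ _
  have hq4 : δ = q ^ 4 := by
    rw [hq, ← Real.rpow_natCast, ← Real.rpow_mul hδ.le]; norm_num
  by_cases hδ1 : 1 ≤ q
  · exact ⟨0, by simp, by simp, by rw [sub_zero]; nlinarith⟩
  have hδ1 : q < 1 := not_le.1 hδ1
  obtain ⟨a, b, sa, sb, na, nb, hab⟩ : ∃ a b : A, IsSelfAdjoint a ∧ IsSelfAdjoint b ∧ ‖a‖ ≤ 1 ∧
      ‖b‖ ≤ 1 ∧ X = a + Complex.I • b :=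
    ⟨realPart X, imaginaryPart X, (realPart X).2, (imaginaryPart X).2,
      (realPart.norm_le X).trans hX, (imaginaryPart.norm_le X).trans hX,
      (realPart_add_I_smul_imaginaryPart X).symm⟩
  have hcab : ‖a * b - b * a‖ ≤ δ / 2 := by
    rw [hab, star_mul_sub_mul_star_eq sa sb, norm_smul] at hc
    norm_num at hc
    linarith
  set m := ⌈q⁻¹⌉₊ with hm
  have hm1 : q⁻¹ ≤ m := Nat.le_ceil _
  have hm2 : (m : ℝ) ≤ 2 * q⁻¹ := by
    have := Nat.ceil_lt_add_one (inv_nonneg.2 q0.le)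
    have := (one_lt_inv₀ q0).2 hδ1
    linarith
  have hm0 : (0 : ℝ) < m := (inv_pos.2 q0).trans_le hm1
  have hqm : q * m ≤ 2 := by
    calc q * m ≤ q * (2 * q⁻¹) := by gcongr
      _ = 2 := by field_simp
  have hqm1 : q * (m + 1) ≤ 3 := by linarith
  have hmq : 1 / m ≤ q := by
    rw [one_div]
    exact inv_le_of_inv_le₀ q0 hm1
  set c := algebraMap ℝ A (m / 2 + 1 / 2 : ℝ) with hcdef
  have sc : IsSelfAdjoint c := .algebraMap A (.all _)
  have sm : IsSelfAdjoint ((m : ℝ) / 2) := .all _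
  have s2 : IsSelfAdjoint (2 / (m : ℝ)) := .all _
  have hxy : ‖((m / 2 : ℝ) • a + c) * ((m / 2 : ℝ) • b + c) -
      ((m / 2 : ℝ) • b + c) * ((m / 2 : ℝ) • a + c)‖ ≤ m ^ 2 * δ := by
    have e : ((m / 2 : ℝ) • a + c) * ((m / 2 : ℝ) • b + c) -
      ((m / 2 : ℝ) • b + c) * ((m / 2 : ℝ) • a + c) =
        ((m / 2 : ℝ) * (m / 2 : ℝ)) • (a * b - b * a) := by
      have ca : c * a = a * c := Algebra.commutes _ _
      have cb : c * b = b * c := Algebra.commutes _ _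
      simp only [add_mul, mul_add, smul_mul_assoc, mul_smul_comm, smul_smul, smul_sub, smul_add,
        ca, cb]
      abel
    rw [e, norm_smul, Real.norm_of_nonneg (by positivity)]
    have : (m / 2 : ℝ) * (m / 2) * ‖a * b - b * a‖ ≤ (m / 2 : ℝ) * (m / 2) * (δ / 2) := by gcongr
    have : 0 ≤ (m : ℝ) ^ 2 * δ := by positivity
    linarith
  obtain ⟨x', y', sx', sy', hcomm, hx', hy'⟩ := H A m (m ^ 2 * δ) _ _ (by positivity)
    ((sm.smul sa).add sc) ((sm.smul sb).add sc) (fun t ht => spectrum_scale sa na hm0.le ht)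
    (fun t ht => spectrum_scale sb nb hm0.le ht) hxy
  have hy' : ‖(m / 2 : ℝ) • b + c - y'‖ ≤ 6 + C * 36 := by
    refine hy'.trans ?_
    rw [hq4, mul_assoc]
    have : (m + 1 : ℝ) ^ 2 * (m ^ 2 * q ^ 4) = (q * (m + 1)) ^ 2 * (q * m) ^ 2 := by ring
    have : (m + 1 : ℝ) ^ 2 * (m ^ 2 * q ^ 4) ≤ 3 ^ 2 * 2 ^ 2 := by
      rw [this]; gcongr
    nlinarith [mul_le_mul_of_nonneg_left this hC]
  have scale : ∀ u u' : A, ‖u - (2 / m : ℝ) • (u' - c)‖ =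
      2 * (1 / m) * ‖(m / 2 : ℝ) • u + c - u'‖ := fun u u' => by
    have e : u - (2 / m : ℝ) • (u' - c) = (2 / m : ℝ) • ((m / 2 : ℝ) • u + c - u') := by
      simp only [smul_sub, smul_add, smul_smul]
      rw [show (2 / m : ℝ) * (m / 2) = 1 by field_simp, one_smul]
      abel
    rw [e, norm_smul, Real.norm_of_nonneg (by positivity)]
    ring
  set a' := (2 / m : ℝ) • (x' - c) with ha'
  set b' := (2 / m : ℝ) • (y' - c) with hb'
  have sa' : IsSelfAdjoint a' := s2.smul (sx'.sub sc)
  have sb' : IsSelfAdjoint b' := s2.smul (sy'.sub sc)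
  have cab : a' * b' = b' * a' := by
    have cx : Commute c (y' - c) := Algebra.commutes _ _
    exact ((hcomm.sub_right (Algebra.commutes (m / 2 + 1 / 2 : ℝ) x').symm).sub_left cx).smul_left _
      |>.smul_right _
  have na' : ‖a - a'‖ ≤ 3 * q := by
    rw [ha', scale]
    calc 2 * (1 / (m : ℝ)) * _ ≤ 2 * q * (3 / 2) := by gcongr
      _ = 3 * q := by ring
  have nb' : ‖b - b'‖ ≤ (12 + 72 * C) * q := by
    rw [hb', scale]
    calc 2 * (1 / (m : ℝ)) * _ ≤ 2 * q * (6 + C * 36) := by gcongr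
      _ = _ := by ring
  have hZ : star (a' + Complex.I • b') * (a' + Complex.I • b') =
      (a' + Complex.I • b') * star (a' + Complex.I • b') := by
    rw [← sub_eq_zero, star_mul_sub_mul_star_eq sa' sb', cab, sub_self, smul_zero]
  have hXZ : ‖X - (a' + Complex.I • b')‖ ≤ (15 + 72 * C) * q := by
    have e : X - (a' + Complex.I • b') = (a - a') + Complex.I • (b - b') := by
      rw [hab, smul_sub]; abel
    have := norm_add_le (a - a') (Complex.I • (b - b'))
    rw [norm_smul, Complex.norm_I, one_mul] at this
    rw [e]
    linarith
  obtain ⟨Y, h1, h2, h3⟩ := exists_normal_contraction_near hX hZ hXZ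
  exact ⟨Y, h1, h2, h3.trans (le_of_eq (by ring))⟩

theorem exists_normal_matrix_near : ∃ C : ℝ, 1 ≤ C ∧ ∀ (n : ℕ) (δ : ℝ)
    (X : Matrix (Fin n) (Fin n) ℂ), 0 < δ → ‖toEuclideanCLM (𝕜 := ℂ) X‖ ≤ 1 →
    ‖toEuclideanCLM (𝕜 := ℂ) (Xᴴ * X - X * Xᴴ)‖ ≤ δ →
    ∃ Y : Matrix (Fin n) (Fin n) ℂ, Yᴴ * Y = Y * Yᴴ ∧ ‖toEuclideanCLM (𝕜 := ℂ) Y‖ ≤ 1 ∧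
      ‖toEuclideanCLM (𝕜 := ℂ) (X - Y)‖ ≤ C * δ ^ (1 / 4 : ℝ) := by
  obtain ⟨C, hC, H⟩ := exists_normal_near
  refine ⟨C, hC, fun n δ X hδ hX hc => ?_⟩
  rw [map_sub, map_mul, map_mul, ← star_eq_conjTranspose, map_star] at hc
  obtain ⟨Z, h1, h2, h3⟩ := H _ δ _ hδ hX hc
  obtain ⟨Y, rfl⟩ : ∃ Y, toEuclideanCLM (n := Fin n) (𝕜 := ℂ) Y = Z := EquivLike.surjective _ Z
  refine ⟨Y, EquivLike.injective (toEuclideanCLM (n := Fin n) (𝕜 := ℂ)) ?_, h2, ?_⟩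
  · rw [map_mul, map_mul, ← star_eq_conjTranspose, map_star]
    exact h1
  · rw [map_sub]
    exact h3

theorem tendsto_mul_rpow_div (C : ℝ) {p r : ℝ} (h : r < p) :
    Filter.Tendsto (fun δ : ℝ => C * δ ^ p / δ ^ r) (nhdsWithin 0 (Set.Ioi 0)) (nhds 0) := by
  have h0 : Filter.Tendsto (fun δ : ℝ => C * δ ^ (p - r)) (nhdsWithin 0 (Set.Ioi 0)) (nhds 0) := by
    have := ((Real.continuousAt_rpow_const 0 (p - r) (.inr (by linarith))).tendsto.const_mul C)
    rw [Real.zero_rpow (by linarith), mul_zero] at this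
    exact this.mono_left nhdsWithin_le_nhds
  refine h0.congr' ?_
  filter_upwards [self_mem_nhdsWithin] with δ hδ
  rw [mul_div_assoc, ← Real.rpow_sub hδ]

end Normal

end AlmostNormal

/-- Theorem (`thm:QuantitativeDisk`): there is a dimension-independent function `ε` with
`ε(δ) = E(1/δ)·δ^{1/6}` (so `ε(δ)/δ^{1/6−α} → 0` as `δ → 0⁺` for every `α ∈ (0, 1/6)`)
such that any δ-representation of the disk (a contraction `X` with `‖[X*,X]‖ ≤ δ`) is
within `ε(δ)` of a normal contraction. -/
theorem disk_quantitative :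
    ∃ ε : ℝ → ℝ,
      (∀ δ > (0 : ℝ), 0 < ε δ) ∧
      (∀ α ∈ Set.Ioo (0 : ℝ) (1/6),
        Filter.Tendsto (fun δ : ℝ => ε δ / δ ^ ((1:ℝ)/6 - α))
          (nhdsWithin 0 (Set.Ioi 0)) (nhds 0)) ∧
      (∀ (n : ℕ), 1 ≤ n → ∀ δ : ℝ, 0 < δ →
        ∀ X : Matrix (Fin n) (Fin n) ℂ,
          AC.opNorm X ≤ 1 →
          AC.opNorm (Xᴴ * X - X * Xᴴ) ≤ δ →
          ∃ Y : Matrix (Fin n) (Fin n) ℂ,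
            Yᴴ * Y = Y * Yᴴ ∧
            AC.opNorm Y ≤ 1 ∧
            AC.opNorm (X - Y) ≤ ε δ) := by
  obtain ⟨C, hC, H⟩ := AlmostNormal.exists_normal_matrix_near
  have hC0 : 0 < C := by linarith
  exact ⟨fun δ => C * δ ^ (1 / 4 : ℝ), fun δ hδ => mul_pos hC0 (Real.rpow_pos_of_pos hδ _),
    fun α hα => AlmostNormal.tendsto_mul_rpow_div C (by linarith [hα.1]),
    fun n _ δ hδ X hX hc => H n δ X hδ hX hc⟩
end
end

section
/- Let H₁, H₂, H₃ be pairwise commuting Hermitian n×n complex matrices such that S(H₁,H₂,H₃) is invertible (so the Bott index is defined). Then bott(H₁,H₂,H₃) = 0. -/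
open Matrix

noncomputable section

namespace AC

open Polynomial

/-- The determinant of a block matrix whose two lower blocks commute, over a domain, when the
lower right block is nonsingular. -/
theorem det_fromBlocks_of_commute {R m : Type*} [CommRing R] [IsDomain R] [Fintype m]
    [DecidableEq m] (A B C D : Matrix m m R) (h : Commute C D) (hD : D.det ≠ 0) :
    (fromBlocks A B C D).det = (A * D - B * C).det := by
  refine mul_right_cancel₀ hD ?_
  have key : fromBlocks A B C D * fromBlocks D 0 (-C) 1 = fromBlocks (A * D - B * C) B 0 D := by
    simp [fromBlocks_multiply, h.eq, sub_eq_add_neg]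
  simpa using congrArg det key

/-- The characteristic polynomial of `S(H₁,H₂,H₃)` for commuting matrices is that of
`H₁² + H₂² + H₃²`, evaluated at `X²`. -/
theorem charpoly_sphS {m : Type*} [Fintype m] [DecidableEq m] {H₁ H₂ H₃ : Matrix m m ℂ}
    (h12 : H₁ * H₂ = H₂ * H₁) (h13 : H₁ * H₃ = H₃ * H₁) (h23 : H₂ * H₃ = H₃ * H₂) :
    (sphS H₁ H₂ H₃).charpoly =
      (scalar m (X ^ 2 : ℂ[X]) -
        (C : ℂ →+* ℂ[X]).mapMatrix (H₁ * H₁ + H₂ * H₂ + H₃ * H₃)).det := by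
  have hX (M : Matrix m m ℂ[X]) : Commute (scalar m (X : ℂ[X])) M :=
    scalar_commute _ (fun _ => Commute.all _ _) M
  have hC : Commute (H₁ + Complex.I • H₂) H₃ :=
    Commute.add_left h13 (Commute.smul_left h23 _)
  have hprod : (H₁ - Complex.I • H₂) * (H₁ + Complex.I • H₂) = H₁ * H₁ + H₂ * H₂ := by
    simp only [sub_mul, mul_add, smul_mul_assoc, mul_smul_comm, smul_sub, smul_smul,
      Complex.I_mul_I, neg_smul, one_smul, h12]
    abel
  rw [charpoly, sphS, charmatrix_fromBlocks, det_fromBlocks_of_commute]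
  · congr 1
    have hB : (H₁ - Complex.I • H₂).map C * (H₁ + Complex.I • H₂).map C =
        (C : ℂ →+* ℂ[X]).mapMatrix (H₁ * H₁ + H₂ * H₂) := by
      rw [← hprod, map_mul]; rfl
    rw [neg_mul_neg, hB, charmatrix, charmatrix]
    simp only [map_add, map_mul, map_neg, sub_neg_eq_add, sub_mul, mul_add, pow_two,
      (hX ((C : ℂ →+* ℂ[X]).mapMatrix H₃)).eq]
    abel
  · rw [charmatrix, map_neg, sub_neg_eq_add]
    exact Commute.add_right (hX _).symm
      (Commute.neg_left (hC.map (C : ℂ →+* ℂ[X]).mapMatrix))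
  · exact (charpoly_monic _).ne_zero

/-- For commuting matrices, the characteristic polynomial of `S(H₁,H₂,H₃)` is even. -/
theorem charpoly_sphS_comp_neg_X {m : Type*} [Fintype m] [DecidableEq m]
    {H₁ H₂ H₃ : Matrix m m ℂ}
    (h12 : H₁ * H₂ = H₂ * H₁) (h13 : H₁ * H₃ = H₃ * H₁) (h23 : H₂ * H₃ = H₃ * H₂) :
    (sphS H₁ H₂ H₃).charpoly.comp (-X) = (sphS H₁ H₂ H₃).charpoly := by
  rw [charpoly_sphS h12 h13 h23, ← coe_compRingHom_apply, RingHom.map_det]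
  congr 1
  ext1 i j
  by_cases hij : i = j <;> simp [scalar_apply, hij]

/-- An invertible Hermitian matrix with even characteristic polynomial has as many positive
eigenvalues as negative ones. -/
theorem two_mul_card_pos_eigenvalues {k : Type*} [Fintype k] [DecidableEq k] {A : Matrix k k ℂ}
    (hA : A.IsHermitian) (hinv : IsUnit A) (heven : A.charpoly.comp (-X) = A.charpoly)
    [DecidablePred fun i => 0 < hA.eigenvalues i] :
    2 * (Finset.univ.filter fun i => 0 < hA.eigenvalues i).card = Fintype.card k := by
  classical
  have hne (i : k) : hA.eigenvalues i ≠ 0 := by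
    have hdet := ((isUnit_iff_isUnit_det A).1 hinv).ne_zero
    rw [hA.det_eq_prod_eigenvalues, Finset.prod_ne_zero_iff] at hdet
    simpa using hdet i (Finset.mem_univ i)
  have hroots := roots_comp_neg_X A.charpoly
  rw [heven, hA.roots_charpoly_eq_eigenvalues, Multiset.map_map] at hroots
  have hcount := congrArg (Multiset.countP fun z : ℂ => 0 < z.re) hroots
  simp only [Multiset.countP_map, Function.comp_apply, Complex.neg_re,
    RCLike.ofReal_eq_complex_ofReal, Complex.ofReal_re, Left.neg_pos_iff] at hcount
  have hneg : (Finset.univ.filter fun i => ¬ 0 < hA.eigenvalues i) =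
      Finset.univ.filter fun i => hA.eigenvalues i < 0 :=
    Finset.filter_congr fun i _ => by rw [not_lt, (hne i).le_iff_lt]
  have hsum := Finset.card_filter_add_card_filter_not (s := Finset.univ)
    (fun i => 0 < hA.eigenvalues i)
  have hcard : (Finset.univ.filter fun i => 0 < hA.eigenvalues i).card =
      (Finset.univ.filter fun i => hA.eigenvalues i < 0).card := by
    convert hcount <;> rfl
  rw [hneg, Finset.card_univ] at hsum
  omega

end AC

/-- Lemma (`lem:commutingKillsIndex`): if `H₁, H₂, H₃` are pairwise commuting Hermitian
matrices such that `S(H₁,H₂,H₃)` is invertible (so the Bott index is defined), then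
`bott(H₁,H₂,H₃) = 0`. -/
theorem bott_of_commuting {n : ℕ}
    (H₁ H₂ H₃ : Matrix (Fin n) (Fin n) ℂ)
    (hH₁ : H₁.IsHermitian) (hH₂ : H₂.IsHermitian) (hH₃ : H₃.IsHermitian)
    (h12 : H₁ * H₂ = H₂ * H₁) (h13 : H₁ * H₃ = H₃ * H₁) (h23 : H₂ * H₃ = H₃ * H₂)
    (hinv : IsUnit (AC.sphS H₁ H₂ H₃)) :
    AC.bott H₁ H₂ H₃ = 0 := by
  classical
  unfold AC.bott
  split_ifs with h
  · have := AC.two_mul_card_pos_eigenvalues h hinv (AC.charpoly_sphS_comp_neg_X h12 h13 h23)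
    rw [Fintype.card_sum] at this
    rw [sub_eq_zero, Nat.cast_inj]
    omega
  · rfl
end
end

section
/- Let 0 ≤ δ < 1/4 and let (H₁, H₂, H₃) be a δ-representation of the sphere by n×n complex matrices. Then (H₁ᵀ, H₂ᵀ, H₃ᵀ) is also a δ-representation of the sphere, and bott(H₁ᵀ, H₂ᵀ, H₃ᵀ) = −bott(H₁, H₂, H₃), where Aᵀ denotes the transpose. -/
open Matrix

noncomputable section

section Norms

open scoped Matrix.Norms.L2Operator

variable {m : Type*} [Fintype m] [DecidableEq m]

/-- Transposition does not increase the `ℓ²` operator norm. -/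
theorem l2_opNorm_transpose_le (A : Matrix m m ℂ) : ‖Aᵀ‖ ≤ ‖A‖ :=
  let φ : Matrix m m ℂ →⋆ₐ[ℂ] (Matrix m m ℂ)ᵐᵒᵖ :=
    { (transposeAlgEquiv m ℂ ℂ).toAlgHom with
      map_star' := fun _ => rfl }
  NonUnitalStarAlgHom.norm_apply_le φ A

/-- The block-diagonal embedding `A ↦ A ⊕ A` is norm contractive. -/
theorem l2_opNorm_fromBlocks_diag_le (A : Matrix m m ℂ) : ‖fromBlocks A 0 0 A‖ ≤ ‖A‖ :=
  let φ : Matrix m m ℂ →⋆ₙₐ[ℂ] Matrix (m ⊕ m) (m ⊕ m) ℂ :=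
    { toFun := fun A => fromBlocks A 0 0 A
      map_smul' := fun c A => by simp [fromBlocks_smul]
      map_zero' := fromBlocks_zero
      map_add' := fun A B => by simp [fromBlocks_add]
      map_mul' := fun A B => by simp [fromBlocks_multiply]
      map_star' := fun A => by simp [star_eq_conjTranspose, fromBlocks_conjTranspose] }
  NonUnitalStarAlgHom.norm_apply_le φ A

theorem l2_opNorm_unitary_mul_fromBlocks_diag_le {U : Matrix (m ⊕ m) (m ⊕ m) ℂ}
    (hU : U ∈ unitary (Matrix (m ⊕ m) (m ⊕ m) ℂ)) (A : Matrix m m ℂ) :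
    ‖U * fromBlocks A 0 0 A‖ ≤ ‖A‖ := by
  rw [CStarRing.norm_mem_unitary_mul _ hU]
  exact l2_opNorm_fromBlocks_diag_le A

end Norms

section Eigenvalues

variable {m : Type*} [Fintype m] [DecidableEq m]

theorem charpoly_neg_eq_prod {A : Matrix m m ℂ} (hA : A.IsHermitian) :
    (-A).charpoly = ∏ i, (Polynomial.X - Polynomial.C ((-hA.eigenvalues i : ℝ) : ℂ)) := by
  have h := hA.charpoly_cfc_eq (fun x => -x)
  rwa [cfc_neg_id (R := ℝ) A hA.isSelfAdjoint] at h

/-- If `B` has the characteristic polynomial of `-A`, its positive eigenvalues correspond to the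
negative eigenvalues of `A`. -/
theorem card_pos_eigenvalues_of_charpoly_eq_neg {A B : Matrix m m ℂ} (hA : A.IsHermitian)
    (hB : B.IsHermitian) (h : B.charpoly = (-A).charpoly) :
    (Finset.univ.filter fun i => 0 < hB.eigenvalues i).card =
      (Finset.univ.filter fun i => hA.eigenvalues i < 0).card := by
  have hroots : Finset.univ.val.map hB.eigenvalues =
      Finset.univ.val.map fun i => -hA.eigenvalues i := by
    have h' := congrArg (fun p => p.roots.map RCLike.re) h
    have hprod := Polynomial.roots_multiset_prod_X_sub_C
      (Finset.univ.val.map fun i => ((-hA.eigenvalues i : ℝ) : ℂ))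
    rw [Multiset.map_map] at hprod
    simp only [charpoly_neg_eq_prod hA, hB.roots_charpoly_eq_eigenvalues, Finset.prod] at h'
    erw [hprod] at h'
    simpa [Multiset.map_map, Function.comp_def] using h'
  have hcount := congrArg (Multiset.countP fun x => 0 < x) hroots
  simpa [Multiset.countP_map, Finset.card_def] using hcount

/-- An invertible Hermitian matrix has only positive and negative eigenvalues. -/
theorem card_pos_add_card_neg_eigenvalues {A : Matrix m m ℂ} (hA : A.IsHermitian)
    (hu : IsUnit A) :
    (Finset.univ.filter fun i => 0 < hA.eigenvalues i).card +
      (Finset.univ.filter fun i => hA.eigenvalues i < 0).card = Fintype.card m := by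
  have h0 : ∀ i, hA.eigenvalues i ≠ 0 := by
    have hdet := ((isUnit_iff_isUnit_det A).mp hu).ne_zero
    rw [hA.det_eq_prod_eigenvalues, Finset.prod_ne_zero_iff] at hdet
    exact fun i hi => hdet i (Finset.mem_univ i) (by simp [hi])
  rw [← Finset.card_univ, ← Finset.card_filter_add_card_filter_not (s := Finset.univ)
    fun i => 0 < hA.eigenvalues i]
  congr 2
  ext i
  simp [le_iff_lt_or_eq, h0 i]

end Eigenvalues

namespace AC

theorem isHermitian_sphS {m : Type*} {H₁ H₂ H₃ : Matrix m m ℂ} (h₁ : H₁.IsHermitian)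
    (h₂ : H₂.IsHermitian) (h₃ : H₃.IsHermitian) : (sphS H₁ H₂ H₃).IsHermitian := by
  simp [IsHermitian, sphS, fromBlocks_conjTranspose, h₁.eq, h₂.eq, h₃.eq, sub_eq_add_neg]

section SphereRep

variable {m : Type*} [Fintype m] [DecidableEq m]

theorem opNorm_transpose_le (A : Matrix m m ℂ) : opNorm Aᵀ ≤ opNorm A :=
  l2_opNorm_transpose_le A

theorem IsSphereRep.transpose {δ : ℝ} {H₁ H₂ H₃ : Matrix m m ℂ} (h : IsSphereRep δ H₁ H₂ H₃) :
    IsSphereRep δ H₁ᵀ H₂ᵀ H₃ᵀ := by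
  obtain ⟨h₁, h₂, h₃, h₁₂, h₁₃, h₂₃, hs⟩ := h
  have key : ∀ A B : Matrix m m ℂ, opNorm (A * B - B * A) ≤ δ →
      opNorm (Aᵀ * Bᵀ - Bᵀ * Aᵀ) ≤ δ := by
    intro A B hAB
    have hneg : Aᵀ * Bᵀ - Bᵀ * Aᵀ = -(A * B - B * A)ᵀ := by simp [transpose_mul]
    rw [hneg, opNorm, map_neg, norm_neg]
    exact (opNorm_transpose_le _).trans hAB
  refine ⟨h₁.transpose, h₂.transpose, h₃.transpose, key _ _ h₁₂, key _ _ h₁₃, key _ _ h₂₃, ?_⟩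
  have ht : H₁ᵀ ^ 2 + H₂ᵀ ^ 2 + H₃ᵀ ^ 2 - 1 = (H₁ ^ 2 + H₂ ^ 2 + H₃ ^ 2 - 1)ᵀ := by
    simp [transpose_pow]
  rw [ht]
  exact (opNorm_transpose_le _).trans hs

theorem sphS_mul_self (H₁ H₂ H₃ : Matrix m m ℂ) :
    sphS H₁ H₂ H₃ * sphS H₁ H₂ H₃ = 1 +
      (fromBlocks (H₁ ^ 2 + H₂ ^ 2 + H₃ ^ 2 - 1) 0 0 (H₁ ^ 2 + H₂ ^ 2 + H₃ ^ 2 - 1) +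
      fromBlocks (Complex.I • 1) 0 0 (-(Complex.I • 1)) *
        fromBlocks (H₁ * H₂ - H₂ * H₁) 0 0 (H₁ * H₂ - H₂ * H₁) +
      fromBlocks 0 (-1) 1 0 * fromBlocks (H₁ * H₃ - H₃ * H₁) 0 0 (H₁ * H₃ - H₃ * H₁) +
      fromBlocks 0 (Complex.I • 1) (Complex.I • 1) 0 *
        fromBlocks (H₂ * H₃ - H₃ * H₂) 0 0 (H₂ * H₃ - H₃ * H₂)) := by
  rw [← fromBlocks_one]
  simp only [sphS, fromBlocks_multiply, fromBlocks_add]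
  have hI : ∀ A B : Matrix m m ℂ, (Complex.I • A) * (Complex.I • B) = -(A * B) := by
    intro A B
    simp [smul_smul]
  congr 1 <;> simp only [pow_two, mul_add, add_mul, mul_sub, sub_mul, hI] <;>
    simp <;> abel

open scoped Matrix.Norms.L2Operator in
/-- For `δ < 1/4`, the square of `S(H₁, H₂, H₃)` is within distance `4δ < 1` of the identity. -/
theorem IsSphereRep.isUnit_sphS {δ : ℝ} (hδ : δ < 1 / 4) {H₁ H₂ H₃ : Matrix m m ℂ}
    (h : IsSphereRep δ H₁ H₂ H₃) : IsUnit (sphS H₁ H₂ H₃) := by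
  obtain ⟨-, -, -, h₁₂, h₁₃, h₂₃, hs⟩ := h
  have hsq : IsUnit (sphS H₁ H₂ H₃ * sphS H₁ H₂ H₃) := by
    rw [sphS_mul_self, ← sub_neg_eq_add]
    refine isUnit_one_sub_of_norm_lt_one ?_
    rw [norm_neg]
    refine (norm_add₄_le).trans_lt ?_
    have e₀ := (l2_opNorm_fromBlocks_diag_le _).trans hs
    have e₁ := (l2_opNorm_unitary_mul_fromBlocks_diag_le
      (U := fromBlocks (Complex.I • 1) 0 0 (-(Complex.I • 1))) (by
        simp [Unitary.mem_iff, star_eq_conjTranspose, fromBlocks_conjTranspose,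
          fromBlocks_multiply, smul_smul]) _).trans h₁₂
    have e₂ := (l2_opNorm_unitary_mul_fromBlocks_diag_le (U := fromBlocks 0 (-1) 1 0) (by
        simp [Unitary.mem_iff, star_eq_conjTranspose, fromBlocks_conjTranspose,
          fromBlocks_multiply]) _).trans h₁₃
    have e₃ := (l2_opNorm_unitary_mul_fromBlocks_diag_le
      (U := fromBlocks 0 (Complex.I • 1) (Complex.I • 1) 0) (by
        simp [Unitary.mem_iff, star_eq_conjTranspose, fromBlocks_conjTranspose,
          fromBlocks_multiply, smul_smul]) _).trans h₂₃
    linarith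
  exact isUnit_of_mul_isUnit_left hsq

/-- `S(H₁ᵀ, H₂ᵀ, H₃ᵀ)` is unitarily conjugate to `-S(H₁, H₂, H₃)ᵀ`. -/
theorem charpoly_sphS_transpose (H₁ H₂ H₃ : Matrix m m ℂ) :
    (sphS H₁ᵀ H₂ᵀ H₃ᵀ).charpoly = (-sphS H₁ H₂ H₃).charpoly := by
  let Q : (Matrix (m ⊕ m) (m ⊕ m) ℂ)ˣ :=
    { val := fromBlocks 0 1 (-1) 0
      inv := fromBlocks 0 (-1) 1 0
      val_inv := by simp [fromBlocks_multiply]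
      inv_val := by simp [fromBlocks_multiply] }
  have hQ : sphS H₁ᵀ H₂ᵀ H₃ᵀ = Q.val * (-sphS H₁ H₂ H₃)ᵀ * Q⁻¹.val := by
    simp [Q, sphS, fromBlocks_transpose, fromBlocks_neg, fromBlocks_multiply, sub_eq_add_neg]
  rw [hQ, coe_units_inv, charpoly_units_conj, charpoly_transpose]

end SphereRep

end AC

/-- Lemma (transpose flips the index): if `(H₁,H₂,H₃)` is a δ-representation of the
sphere with `0 ≤ δ < 1/4`, then `(H₁ᵀ,H₂ᵀ,H₃ᵀ)` is also a δ-representation of the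
sphere and `bott(H₁ᵀ,H₂ᵀ,H₃ᵀ) = −bott(H₁,H₂,H₃)`. -/
theorem bott_transpose {n : ℕ} (δ : ℝ) (hδ0 : 0 ≤ δ) (hδ : δ < 1/4)
    (H₁ H₂ H₃ : Matrix (Fin n) (Fin n) ℂ)
    (hrep : AC.IsSphereRep δ H₁ H₂ H₃) :
    AC.IsSphereRep δ H₁ᵀ H₂ᵀ H₃ᵀ ∧
    AC.bott H₁ᵀ H₂ᵀ H₃ᵀ = -AC.bott H₁ H₂ H₃ := by
  refine ⟨hrep.transpose, ?_⟩
  have hA := AC.isHermitian_sphS hrep.1 hrep.2.1 hrep.2.2.1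
  have hB := AC.isHermitian_sphS hrep.transpose.1 hrep.transpose.2.1 hrep.transpose.2.2.1
  have hflip := card_pos_eigenvalues_of_charpoly_eq_neg hA hB
    (AC.charpoly_sphS_transpose H₁ H₂ H₃)
  have hsum := card_pos_add_card_neg_eigenvalues hA (hrep.isUnit_sphS hδ)
  rw [Fintype.card_sum] at hsum
  rw [AC.bott, AC.bott, dif_pos hA, dif_pos hB]
  omega
end
end
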